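/- Let Ω ⊊ ℂ be a bounded simply connected domain. Then Ω is a QH-visibility domain if and only if the Euclidean boundary ∂Ω is locally connected. Moreover, Ω is a QH-visibility domain with no geodesic loop in the Euclidean closure Ω̄^Euc if and only if Ω is a Jordan domain. -/

import Mathlib

open Metric Set Filter Topology MeasureTheory
open scoped NNReal ENNReal

noncomputable section

variable {E : Type*} [NormedAddCommGroup E] [NormedSpace ℝ E]

/-- The quasihyperbolic length of a path `γ : [a, b] → Ω`, i.e. `∫ ‖γ'(t)‖ / δ_Ω(γ t) dt`. -/
def qhLength (Ω : Set E) (γ : ℝ → E) (a b : ℝ) : ℝ :=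
  ∫ t in a..b, ‖deriv γ t‖ / infDist (γ t) Ωᶜ

/-- Admissible (Lipschitz, i.e. rectifiable) paths joining `x` to `y` inside `Ω`. -/
def qhAdmissible (Ω : Set E) (x y : E) (γ : ℝ → E) (a b : ℝ) : Prop :=
  a ≤ b ∧ γ a = x ∧ γ b = y ∧ (∀ t ∈ Icc a b, γ t ∈ Ω) ∧
    ∃ K : ℝ≥0, LipschitzOnWith K γ (Icc a b)

/-- The quasihyperbolic distance `k_Ω` on a domain `Ω`. -/
def qhDist (Ω : Set E) (x y : E) : ℝ :=
  sInf { L : ℝ | ∃ γ a b, qhAdmissible Ω x y γ a b ∧ L = qhLength Ω γ a b }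

/-- `γ` is a (unit-speed) quasihyperbolic geodesic on the parameter set `s`. -/
def IsQHGeodesicOn (Ω : Set E) (γ : ℝ → E) (s : Set ℝ) : Prop :=
  (∀ t ∈ s, γ t ∈ Ω) ∧ ∀ a ∈ s, ∀ b ∈ s, qhDist Ω (γ a) (γ b) = |a - b|

/-- `Ω` is a QH-visibility domain: any two distinct Euclidean boundary points have
neighbourhoods with disjoint closures together with a compact subset of `Ω` which is met by
every quasihyperbolic geodesic joining the two neighbourhoods. -/
def QHVisibilityDomain (Ω : Set E) : Prop :=
  ∀ p ∈ frontier Ω, ∀ q ∈ frontier Ω, p ≠ q →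
    ∃ U V : Set E, IsOpen U ∧ IsOpen V ∧ p ∈ U ∧ q ∈ V ∧
      closure U ∩ closure V = ∅ ∧
      ∃ K : Set E, IsCompact K ∧ K ⊆ Ω ∧
        ∀ (γ : ℝ → E) (T : ℝ), 0 ≤ T → IsQHGeodesicOn Ω γ (Icc 0 T) →
          γ 0 ∈ U → γ T ∈ V → ∃ t ∈ Icc 0 T, γ t ∈ K

/-- A quasihyperbolic geodesic line. -/
def IsQHGeodesicLine (Ω : Set E) (γ : ℝ → E) : Prop :=
  IsQHGeodesicOn Ω γ univ

/-- `Ω` has no geodesic loop in its Euclidean closure: no quasihyperbolic geodesic line has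
equal cluster sets at `+∞` and `-∞`. -/
def NoGeodesicLoop (Ω : Set E) : Prop :=
  ∀ γ : ℝ → E, IsQHGeodesicLine Ω γ →
    {x : E | MapClusterPt x atTop γ} ≠ {x : E | MapClusterPt x atBot γ}

/-- `h` has a continuous logarithm on `S`. -/
def HasContLogOn (h : ℂ → ℂ) (S : Set ℂ) : Prop :=
  ∃ L : ℂ → ℂ, ContinuousOn L S ∧ ∀ z ∈ S, Complex.exp (L z) = h z

theorem eq_of_exp_eq_one {α : Type*} [TopologicalSpace α] {S : Set α} (hS : IsPreconnected S)
    {D : α → ℂ} (hD : ContinuousOn D S) (h1 : ∀ z ∈ S, Complex.exp (D z) = 1) {x y : α}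
    (hx : x ∈ S) (hy : y ∈ S) : D x = D y := by
  have hdisc : IsDiscrete (range ((↑) : ℤ → ℝ)) :=
    Int.isClosedEmbedding_coe_real.isEmbedding.isDiscrete_range
  have key : ∀ z ∈ S, ∃ n : ℤ, D z = n * (2 * Real.pi * Complex.I) := by
    intro z hz
    exact Complex.exp_eq_one_iff.1 (h1 z hz)
  have hpi := Real.pi_pos
  have := hS.constant_of_mapsTo hdisc (f := fun z => (D z).im / (2 * Real.pi))
    ((Complex.continuous_im.comp_continuousOn hD).div_const _) (by
      intro z hz
      obtain ⟨n, hn⟩ := key z hz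
      refine ⟨n, ?_⟩
      simp only [hn]
      simp) hx hy
  obtain ⟨n, hn⟩ := key x hx
  obtain ⟨m, hm⟩ := key y hy
  have him : (D x).im = (D y).im := by
    have h2 : (2 * Real.pi) ≠ 0 := by positivity
    rwa [div_left_inj' h2] at this
  apply Complex.ext _ him
  rw [hn, hm]
  simp

theorem not_hasContLogOn_sphere (w : ℂ) {R : ℝ} (hR : 0 < R) :
    ¬ HasContLogOn (fun z => z - w) (sphere w R) := by
  rintro ⟨L, hL, hexp⟩
  have hmem : ∀ t : ℝ, w + R * Complex.exp (t * Complex.I) ∈ sphere w R := by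
    intro t
    simp [Complex.norm_exp_ofReal_mul_I, abs_of_pos hR]
  have hc : Continuous fun t : ℝ => L (w + R * Complex.exp (t * Complex.I)) :=
    hL.comp_continuous (by fun_prop) hmem
  have := eq_of_exp_eq_one (α := ℝ) (S := univ) isPreconnected_univ
    (D := fun t : ℝ => L (w + R * Complex.exp (t * Complex.I)) - t * Complex.I - Real.log R)
    ((hc.sub (by fun_prop)).sub (by fun_prop)).continuousOn (by
      intro t _
      have hR' : (R : ℂ) ≠ 0 := by exact_mod_cast hR.ne'
      rw [Complex.exp_sub, Complex.exp_sub, hexp _ (hmem t), ← Complex.ofReal_exp,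
        Real.exp_log hR]
      have := Complex.exp_ne_zero (t * Complex.I)
      field_simp
      ring) (mem_univ 0) (mem_univ (2 * Real.pi))
  have hpi := Real.pi_ne_zero
  simp [Complex.exp_two_pi_mul_I, sub_eq_add_neg] at this

theorem HasContLogOn.mono {h : ℂ → ℂ} {S T : Set ℂ} (H : HasContLogOn h S) (hT : T ⊆ S) :
    HasContLogOn h T :=
  let ⟨L, hL, he⟩ := H
  ⟨L, hL.mono hT, fun z hz => he z (hT hz)⟩

theorem hasContLogOn_div_of_isPreconnected {Ω S : Set ℂ} (hΩ : IsOpen Ω) (hc : IsPreconnected Ω)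
    (hS : Disjoint S Ω) {w o : ℂ} (hw : w ∈ Ω) (ho : o ∈ Ω) :
    HasContLogOn (fun z => (z - w) / (z - o)) S := by
  have hne : ∀ x ∈ Ω, ∀ z ∈ S, z - x ≠ 0 := by
    intro x hx z hz h
    rw [sub_eq_zero] at h
    exact disjoint_left.1 hS hz (h ▸ hx)
  refine hc.induction₂ (fun w o => HasContLogOn (fun z => (z - w) / (z - o)) S) ?_ ?_ ?_ hw ho
  · intro x hx
    obtain ⟨r, hr, hball⟩ := Metric.isOpen_iff.1 hΩ x hx
    filter_upwards [self_mem_nhdsWithin, mem_nhdsWithin_of_mem_nhds (ball_mem_nhds x (half_pos hr))]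
      with y hy hyr
    have hsl : ∀ z ∈ S, (z - x) / (z - y) ∈ Complex.slitPlane := by
      intro z hz
      have h1 : ‖y - x‖ < ‖z - y‖ := by
        have h2 : r ≤ dist z x := by
          by_contra hlt
          exact disjoint_left.1 hS hz (hball (by simpa using hlt))
        have h3 : dist y x < r / 2 := hyr
        have h4 := dist_triangle z y x
        rw [← dist_eq_norm, ← dist_eq_norm]
        linarith
      have h5 : (z - x) / (z - y) = 1 + (y - x) / (z - y) := by
        have := hne y hy z hz
        field_simp
        ring
      rw [h5]
      apply Complex.mem_slitPlane_of_norm_lt_one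
      rw [norm_div, div_lt_one (lt_of_le_of_lt (norm_nonneg _) h1)]
      exact h1
    refine ⟨fun z => Complex.log ((z - x) / (z - y)), ?_, fun z hz =>
      Complex.exp_log (div_ne_zero (hne x hx z hz) (hne y hy z hz))⟩
    apply ContinuousOn.clog _ hsl
    exact ContinuousOn.div (by fun_prop) (by fun_prop) (hne y hy)
  · rintro x y z hx hy hz ⟨L, hL, he⟩ ⟨M, hM, he'⟩
    refine ⟨fun u => L u + M u, hL.add hM, fun u hu => ?_⟩
    rw [Complex.exp_add, he u hu, he' u hu]
    have := hne y hy u hu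
    have := hne z hz u hu
    field_simp
  · rintro x y hx hy ⟨L, hL, he⟩
    refine ⟨fun u => - L u, hL.neg, fun u hu => ?_⟩
    rw [Complex.exp_neg, he u hu, inv_div]

theorem hasContLogOn_div_closedBall {c w o : ℂ} {r : ℝ} (hw : r < dist c w) (ho : r < dist c o) :
    HasContLogOn (fun z => (z - w) / (z - o)) (closedBall c r) := by
  have key : ∀ x : ℂ, r < dist c x → ∀ z ∈ closedBall c r, z - x ≠ 0 ∧ c - x ≠ 0 ∧
      (z - x) / (c - x) ∈ Complex.slitPlane := by
    intro x hx z hz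
    have hz' : dist z c ≤ r := hz
    have h1 : ‖z - c‖ < ‖c - x‖ := by
      rw [← dist_eq_norm, ← dist_eq_norm]; linarith
    have hcx : c - x ≠ 0 := norm_pos_iff.1 (lt_of_le_of_lt (norm_nonneg _) h1)
    refine ⟨?_, hcx, ?_⟩
    · intro h
      rw [sub_eq_zero] at h
      rw [h, dist_comm] at hz'
      linarith
    · have h5 : (z - x) / (c - x) = 1 + (z - c) / (c - x) := by
        field_simp
        ring
      rw [h5]
      apply Complex.mem_slitPlane_of_norm_lt_one
      rwa [norm_div, div_lt_one (lt_of_le_of_lt (norm_nonneg _) h1)]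
  refine ⟨fun z => Complex.log ((z - w) / (c - w)) - Complex.log ((z - o) / (c - o))
    + Complex.log ((c - w) / (c - o)), ?_, ?_⟩
  · refine ((ContinuousOn.clog (by fun_prop) fun z hz => (key w hw z hz).2.2).sub
      (ContinuousOn.clog (by fun_prop) fun z hz => (key o ho z hz).2.2)).add continuousOn_const
  · intro z hz
    obtain ⟨h1, h2, -⟩ := key w hw z hz
    obtain ⟨h3, h4, -⟩ := key o ho z hz
    rw [Complex.exp_add, Complex.exp_sub, Complex.exp_log (div_ne_zero h1 h2),
      Complex.exp_log (div_ne_zero h3 h4), Complex.exp_log (div_ne_zero h2 h4)]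
    field_simp

/-- Gluing continuous logarithms on closed sets with preconnected intersection. -/
theorem HasContLogOn.union {h : ℂ → ℂ} {S T : Set ℂ} (hS : HasContLogOn h S)
    (hT : HasContLogOn h T) (hSc : IsClosed S) (hTc : IsClosed T)
    (hST : IsPreconnected (S ∩ T)) : HasContLogOn h (S ∪ T) := by
  classical
  obtain ⟨L, hL, he⟩ := hS
  obtain ⟨M, hM, he'⟩ := hT
  obtain ⟨c, hc, hcE⟩ : ∃ c : ℂ, Complex.exp c = 1 ∧ ∀ z ∈ S ∩ T, L z = M z + c := by
    rcases (S ∩ T).eq_empty_or_nonempty with hemp | ⟨x, hx⟩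
    · exact ⟨0, by simp, by simp [hemp]⟩
    · have hexp : ∀ z ∈ S ∩ T, Complex.exp (L z - M z) = 1 := by
        intro z hz
        rw [Complex.exp_sub, he z hz.1, he' z hz.2, div_self]
        rw [← he z hz.1]
        exact Complex.exp_ne_zero _
      refine ⟨L x - M x, hexp x hx, fun z hz => ?_⟩
      have := eq_of_exp_eq_one hST ((hL.mono inter_subset_left).sub (hM.mono inter_subset_right))
        hexp hz hx
      simp only [Pi.sub_apply] at this
      rw [← this]; ring
  refine ⟨fun z => if z ∈ S then L z else M z + c, ?_, ?_⟩
  · apply ContinuousOn.union_of_isClosed _ _ hSc hTc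
    · exact hL.congr fun z hz => by simp [hz]
    · refine (hM.add continuousOn_const).congr (f := fun z => M z + c) fun z hz => ?_
      by_cases h : z ∈ S
      · simp [h, hcE z ⟨h, hz⟩]
      · simp [h]
  · intro z hz
    by_cases h : z ∈ S
    · simp [h, he z h]
    · have hzT : z ∈ T := hz.resolve_left h
      simp [h, Complex.exp_add, hc, he' z hzT]

theorem hasContLogOn_univ {h : ℂ → ℂ} (hc : Continuous h) (h0 : ∀ z, h z ≠ 0) :
    HasContLogOn h univ := by
  have : IsSimplyConnected (univ : Set ℂ) := by
    exact (Homeomorph.Set.univ ℂ).toHomotopyEquiv.simplyConnectedSpace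
  obtain ⟨L, hL, he⟩ := Complex.exists_continuousOn_eqOn_exp_comp this isOpen_univ
    hc.continuousOn (by rintro ⟨z, -, hz⟩; exact h0 z hz)
  exact ⟨L, hL, fun z hz => he hz⟩

/-- If `(z - w) / (z - o)` has a continuous logarithm on a closed set containing the boundary of a
bounded open set `U`, then `U` does not separate `w` from `o`. -/
theorem HasContLogOn.false_of_frontier_subset {w o : ℂ} {Z U : Set ℂ} (hZ : IsClosed Z)
    (hlog : HasContLogOn (fun z => (z - w) / (z - o)) Z)
    (hUb : Bornology.IsBounded U) (hfr : frontier U ⊆ Z) (hw : w ∈ U) (ho : o ∉ closure U) :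
    False := by
  classical
  obtain ⟨L, hL, he⟩ := hlog
  obtain ⟨g, hg⟩ := ContinuousMap.exists_restrict_eq hZ ⟨Z.domRestrict L, hL.domRestrict⟩
  have hgL : ∀ z ∈ Z, g z = L z := fun z hz => DFunLike.congr_fun hg ⟨z, hz⟩
  let h : ℂ → ℂ := fun z => if z ∈ U then Complex.exp (g z) * (z - o) else z - w
  have hcont : Continuous h := by
    apply continuous_if
    · intro z hz
      have hzU : z ∈ frontier U := hz
      rw [hgL z (hfr hzU), he z (hfr hzU)]
      have : z - o ≠ 0 := fun h => ho (by rw [← sub_eq_zero.1 h]; exact frontier_subset_closure hz)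
      field_simp
    · fun_prop
    · fun_prop
  have hne : ∀ z, h z ≠ 0 := by
    intro z
    by_cases hz : z ∈ U
    · simp only [h, hz, if_true]
      refine mul_ne_zero (Complex.exp_ne_zero _) fun h => ho ?_
      rw [← sub_eq_zero.1 h]; exact subset_closure hz
    · simp only [h, hz, if_false]
      exact fun h => hz (by rwa [sub_eq_zero.1 h])
  obtain ⟨R, hR⟩ := hUb.subset_ball w
  have hRpos : 0 < R := pos_of_mem_ball (hR hw)
  obtain ⟨M, hM, hM'⟩ := hasContLogOn_univ hcont hne
  refine not_hasContLogOn_sphere w hRpos ⟨M, hM.mono (subset_univ _), fun z hz => ?_⟩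
  rw [hM' z (mem_univ _)]
  have : z ∉ U := fun hzU => by
    have := hR hzU
    rw [mem_ball] at this
    exact this.ne hz
  simp [h, this]

theorem separation_of_isPreconnected {Ω X U : Set ℂ} (hΩ : IsOpen Ω) (hc : IsPreconnected Ω)
    (hX : IsClosed X) (hXc : IsPreconnected (X ∩ Ωᶜ)) {w o : ℂ}
    (hlog : HasContLogOn (fun z => (z - w) / (z - o)) X) 
    (hUb : Bornology.IsBounded U) (hfr : frontier U ⊆ X ∪ Ωᶜ) (hw : w ∈ U) (hwΩ : w ∈ Ω)
    (hoΩ : o ∈ Ω) (ho : o ∉ closure U) : False :=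
  (hlog.union (hasContLogOn_div_of_isPreconnected hΩ hc
    (disjoint_compl_left) hwΩ hoΩ) hX hΩ.isClosed_compl hXc).false_of_frontier_subset
    (hX.union hΩ.isClosed_compl) hUb hfr hw ho

theorem exists_bound_of_le_log {a : ℝ} (ha : 0 < a) (b : ℝ) :
    ∃ M > 0, ∀ y, 0 ≤ y → y ≤ a * Real.log (1 + 2 * y) + b → y ≤ M := by
  refine ⟨2 * (1 / 4 + a * |Real.log (4 * a)| + |b|), by positivity, fun y hy h => ?_⟩
  have h1 : Real.log ((1 + 2 * y) / (4 * a)) ≤ (1 + 2 * y) / (4 * a) - 1 :=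
    Real.log_le_sub_one_of_pos (by positivity)
  rw [Real.log_div (by positivity) (by positivity)] at h1
  have h2 : a * Real.log (1 + 2 * y) ≤ a * ((1 + 2 * y) / (4 * a) + |Real.log (4 * a)|) := by
    gcongr
    linarith [le_abs_self (Real.log (4 * a))]
  have h3 : a * ((1 + 2 * y) / (4 * a)) = (1 + 2 * y) / 4 := by field_simp
  rw [mul_add, h3] at h2
  linarith [le_abs_self b]

/-- A curve in the unit disk satisfying the two-sided comparison with the quasihyperbolic metric
of the disk which pullbacks of quasihyperbolic geodesics enjoy. -/
structure IsDiskQuasiGeodesic (C : ℝ) (g : ℝ → ℂ) (I : Set ℝ) : Prop where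
  norm_lt : ∀ t ∈ I, ‖g t‖ < 1
  lower : ∀ s ∈ I, ∀ t ∈ I, ‖g s - g t‖ ≤ (1 - ‖g s‖) * (Real.exp (2 * |s - t|) - 1)
  upper : ∀ s ∈ I, ∀ t ∈ I, |s - t| ≤ C * (Real.log (1 + ‖g s - g t‖ / (1 - ‖g s‖)) +
    Real.log (1 + ‖g s - g t‖ / (1 - ‖g t‖)) + 1)

namespace IsDiskQuasiGeodesic

variable {C : ℝ} {g : ℝ → ℂ} {I : Set ℝ}

theorem mono (h : IsDiskQuasiGeodesic C g I) {J : Set ℝ} (hJ : J ⊆ I) :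
    IsDiskQuasiGeodesic C g J :=
  ⟨fun t ht => h.norm_lt t (hJ ht), fun s hs t ht => h.lower s (hJ hs) t (hJ ht),
    fun s hs t ht => h.upper s (hJ hs) t (hJ ht)⟩

theorem comp_neg (h : IsDiskQuasiGeodesic C g I) :
    IsDiskQuasiGeodesic C (fun t => g (-t)) (Neg.neg ⁻¹' I) := by
  have habs : ∀ s t : ℝ, |s - t| = |-s - -t| := fun s t => by
    rw [← abs_neg]; congr 1; ring
  refine ⟨fun t ht => h.norm_lt _ ht, fun s hs t ht => ?_, fun s hs t ht => ?_⟩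
  · rw [habs]; exact h.lower _ hs _ ht
  · rw [habs]; exact h.upper _ hs _ ht

theorem depth_le (h : IsDiskQuasiGeodesic C g I) {s t : ℝ} (hs : s ∈ I) (ht : t ∈ I) :
    1 - ‖g t‖ ≤ (1 - ‖g s‖) * Real.exp (2 * |s - t|) := by
  have h1 := h.lower s hs t ht
  have h2 := norm_sub_norm_le (g s) (g t)
  linarith

theorem continuousOn (h : IsDiskQuasiGeodesic C g I) : ContinuousOn g I := by
  intro s hs
  rw [ContinuousWithinAt, tendsto_iff_norm_sub_tendsto_zero]
  refine squeeze_zero' (Eventually.of_forall fun _ => norm_nonneg _)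
    (g := fun t => (1 - ‖g s‖) * (Real.exp (2 * |s - t|) - 1)) ?_ ?_
  · filter_upwards [self_mem_nhdsWithin] with t ht
    rw [norm_sub_rev]
    exact h.lower s hs t ht
  · have : Continuous fun t => (1 - ‖g s‖) * (Real.exp (2 * |s - t|) - 1) := by fun_prop
    have h0 := this.tendsto s
    simp only [sub_self, abs_zero, mul_zero, Real.exp_zero] at h0
    exact h0.mono_left nhdsWithin_le_nhds

theorem norm_sub_le_of_depth_le (h : IsDiskQuasiGeodesic C g I) {η : ℝ}
    (h_nonneg : 0 ≤ η) (n : ℕ) {s t : ℝ}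
    (hst : s ≤ t) (hI : Icc s t ⊆ I) (hη : ∀ u ∈ Ioc s t, 1 - ‖g u‖ ≤ η) (hn : t - s ≤ n) :
    ‖g s - g t‖ ≤ n * ((Real.exp 2 - 1) * η) := by
  induction n generalizing s with
  | zero =>
    have : s = t := by push_cast at hn; linarith
    simp [this]
  | succ n ih =>
    rcases hst.eq_or_lt with rfl | hlt
    · have h2 : (1:ℝ) < Real.exp 2 := Real.one_lt_exp_iff.2 two_pos
      have : 0 ≤ Real.exp 2 - 1 := by linarith
      simp only [sub_self, norm_zero]
      positivity
    · set u := min t (s + 1) with hu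
      have hut : u ≤ t := min_le_left _ _
      have hsu : s < u := lt_min hlt (by linarith)
      have hus : u - s ≤ 1 := by have := min_le_right t (s + 1); linarith
      have h1 := h.lower u (hI ⟨hsu.le, hut⟩) s (hI ⟨le_rfl, hst⟩)
      have h2 : ‖g u - g s‖ ≤ (Real.exp 2 - 1) * η := by
        refine h1.trans ?_
        rw [mul_comm]
        have hd := h.norm_lt u (hI ⟨hsu.le, hut⟩)
        have he : Real.exp (2 * |u - s|) ≤ Real.exp 2 := by
          rw [Real.exp_le_exp, abs_of_pos (by linarith)]; linarith
        have he1 : (1:ℝ) ≤ Real.exp (2 * |u - s|) := Real.one_le_exp (by positivity)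
        exact mul_le_mul (by linarith) (hη u ⟨hsu, hut⟩) (by linarith) (by linarith)
      have h3 := ih hut (fun x hx => hI ⟨hsu.le.trans hx.1, hx.2⟩)
        (fun x hx => hη x ⟨hsu.trans hx.1, hx.2⟩) (by
          push_cast at hn
          rcases le_total t (s + 1) with hc | hc
          · rw [hu, min_eq_left hc]; simp
          · rw [hu, min_eq_right hc]; linarith)
      have h4 := norm_sub_le_norm_sub_add_norm_sub (g s) (g u) (g t)
      rw [norm_sub_rev (g s) (g u)] at h4
      push_cast
      linarith


theorem exists_norm_sub_le_of_comparable (hC : 0 < C) :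
    ∃ M > 0, ∀ (g : ℝ → ℂ) (I : Set ℝ), IsDiskQuasiGeodesic C g I → ∀ η s t : ℝ, 0 < η → s ≤ t →
      Icc s t ⊆ I → (∀ u ∈ Ioc s t, 1 - ‖g u‖ ≤ η) → η / 2 ≤ 1 - ‖g s‖ → η / 2 ≤ 1 - ‖g t‖ →
      ‖g s - g t‖ ≤ M * η := by
  have hE : 0 < Real.exp 2 - 1 := by
    have : (1:ℝ) < Real.exp 2 := Real.one_lt_exp_iff.2 two_pos
    linarith
  obtain ⟨M, hM, hb⟩ := exists_bound_of_le_log (a := (Real.exp 2 - 1) * (2 * C)) (by positivity)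
    ((Real.exp 2 - 1) * (C + 1))
  refine ⟨M, hM, fun g I h η s t hη hst hI hd hs ht => ?_⟩
  obtain ⟨n, hn, hn'⟩ : ∃ n : ℕ, t - s ≤ n ∧ (n : ℝ) ≤ t - s + 1 :=
    ⟨⌈t - s⌉₊, Nat.le_ceil _, (Nat.ceil_lt_add_one (by linarith)).le⟩
  have h1 := h.norm_sub_le_of_depth_le hη.le n hst hI hd hn
  have h2 := h.upper s (hI ⟨le_rfl, hst⟩) t (hI ⟨hst, le_rfl⟩)
  have hlog : ∀ d, η / 2 ≤ d →
      Real.log (1 + ‖g s - g t‖ / d) ≤ Real.log (1 + 2 * (‖g s - g t‖ / η)) := fun d hd => by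
    have : ‖g s - g t‖ / d ≤ ‖g s - g t‖ / (η / 2) := by gcongr
    have h4 : ‖g s - g t‖ / (η / 2) = 2 * (‖g s - g t‖ / η) := by field_simp
    have hd0 : 0 < d := by linarith
    apply Real.log_le_log (by positivity)
    linarith
  rw [← div_le_iff₀ hη]
  refine hb _ (by positivity) ?_
  have h3 : ‖g s - g t‖ / η ≤ n * (Real.exp 2 - 1) := by
    rw [div_le_iff₀ hη]; linarith
  have h5 : (n : ℝ) ≤ 2 * C * Real.log (1 + 2 * (‖g s - g t‖ / η)) + C + 1 := by
    rw [abs_sub_comm, abs_of_nonneg (by linarith)] at h2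
    have := mul_le_mul_of_nonneg_left (add_le_add (hlog _ hs) (hlog _ ht)) hC.le
    linarith
  have := mul_le_mul_of_nonneg_left h5 hE.le
  linarith

theorem exists_norm_sub_le_of_half_le (hC : 0 < C) :
    ∃ M > 0, ∀ (g : ℝ → ℂ) (I : Set ℝ), IsDiskQuasiGeodesic C g I → ∀ η s t : ℝ, 0 < η → s ≤ t →
      Icc s t ⊆ I → (∀ u ∈ Ioc s t, 1 - ‖g u‖ ≤ η) → η / 2 ≤ 1 - ‖g s‖ →
      ‖g s - g t‖ ≤ M * η := by
  obtain ⟨M, hM, hb⟩ := exists_norm_sub_le_of_comparable hC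
  refine ⟨2 * M, by positivity, fun g I h η s t hη hst hI hd hs => ?_⟩
  have key : ∀ n : ℕ, ∀ η s : ℝ, 0 < η → s ≤ t → Icc s t ⊆ I → (∀ u ∈ Ioc s t, 1 - ‖g u‖ ≤ η) →
      η / 2 ≤ 1 - ‖g s‖ → η / 2 ^ (n + 1) ≤ 1 - ‖g t‖ → ‖g s - g t‖ ≤ 2 * M * η := by
    intro n
    induction n with
    | zero =>
      intro η s hη hst hI hd hs ht
      have := hb g I h η s t hη hst hI hd hs (by simpa using ht)
      have : 0 ≤ M * η := by positivity
      linarith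
    | succ n ih =>
      intro η s hη hst hI hd hs ht
      have hcont : ContinuousOn (fun u => 1 - ‖g u‖) (Icc s t) :=
        continuousOn_const.sub (h.continuousOn.mono hI).norm
      have hcl : IsCompact (Icc s t ∩ (fun u => 1 - ‖g u‖) ⁻¹' Ici (η / 2)) :=
        isCompact_Icc.of_isClosed_subset (hcont.preimage_isClosed_of_isClosed isClosed_Icc
          isClosed_Ici) inter_subset_left
      obtain ⟨v, ⟨hv, hv2⟩, hmax⟩ := hcl.exists_isGreatest ⟨s, ⟨le_rfl, hst⟩, hs⟩
      have h1 := hb g I h η s v hη hv.1 (fun x hx => hI ⟨hx.1, hx.2.trans hv.2⟩)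
        (fun u hu => hd u ⟨hu.1, hu.2.trans hv.2⟩) hs hv2
      have h2 := ih (η / 2) v (by positivity) hv.2 (fun x hx => hI ⟨hv.1.trans hx.1, hx.2⟩)
        (fun u hu => by
          by_contra! hc
          exact absurd (hmax ⟨⟨hv.1.trans hu.1.le, hu.2⟩, hc.le⟩) (not_le.2 hu.1))
        (by have := mem_preimage.1 hv2; rw [mem_Ici] at this; linarith)
        (by rw [div_div, ← pow_succ']; exact ht)
      have := norm_sub_le_norm_sub_add_norm_sub (g s) (g v) (g t)
      linarith
  have ht : 0 < 1 - ‖g t‖ := by linarith [h.norm_lt t (hI ⟨hst, le_rfl⟩)]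
  obtain ⟨n, hn⟩ := exists_pow_lt_of_lt_one (y := (1/2 : ℝ)) (x := (1 - ‖g t‖) / η)
    (by positivity) (by norm_num)
  refine key n η s hη hst hI hd hs ?_
  rw [lt_div_iff₀ hη] at hn
  have : η / 2 ^ (n + 1) = (1/2) ^ n * η / 2 := by rw [pow_succ, one_div, inv_pow]; field_simp
  rw [this]
  linarith

/-- A sub-arc of a quasigeodesic on which the depth is at most `η` has diameter `O(η)`. -/
theorem exists_norm_sub_le (hC : 0 < C) :
    ∃ M > 0, ∀ (g : ℝ → ℂ) (I : Set ℝ), IsDiskQuasiGeodesic C g I → ∀ η s t : ℝ, s ≤ t →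
      Icc s t ⊆ I → (∀ u ∈ Icc s t, 1 - ‖g u‖ ≤ η) → ‖g s - g t‖ ≤ M * η := by
  obtain ⟨M, hM, hb⟩ := exists_norm_sub_le_of_half_le hC
  refine ⟨2 * M, by positivity, fun g I h η s t hst hI hd => ?_⟩
  have hcont : ContinuousOn (fun u => 1 - ‖g u‖) (Icc s t) :=
    continuousOn_const.sub (h.continuousOn.mono hI).norm
  obtain ⟨v, hv, hmax⟩ := isCompact_Icc.exists_isMaxOn ⟨s, ⟨le_rfl, hst⟩⟩ hcont
  have hpos : 0 < 1 - ‖g v‖ := by linarith [h.norm_lt v (hI hv)]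
  have h1 := hb g I h (1 - ‖g v‖) v t hpos hv.2 (fun x hx => hI ⟨hv.1.trans hx.1, hx.2⟩)
    (fun u hu => hmax ⟨hv.1.trans hu.1.le, hu.2⟩) (by linarith)
  have h2 := hb _ _ h.comp_neg (1 - ‖g v‖) (-v) (-s) hpos (by linarith [hv.1])
    (fun x hx => hI ⟨by linarith [hx.2], by linarith [hx.1, hv.2]⟩)
    (fun u hu => hmax ⟨by linarith [hu.2], by linarith [hu.1, hv.2]⟩)
    (by simp only [neg_neg]; linarith)
  simp only [neg_neg] at h2
  rw [norm_sub_rev] at h2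
  have h3 := norm_sub_le_norm_sub_add_norm_sub (g s) (g v) (g t)
  have h4 : M * (1 - ‖g v‖) ≤ M * η := by gcongr; exact hd v hv
  linarith

/-- If the endpoints of a quasigeodesic are within `r` of each other and of the circle then the
whole quasigeodesic stays at depth `O(r)`. -/
theorem exists_depth_le (hC : 0 < C) :
    ∃ M > 0, ∀ (g : ℝ → ℂ) (I : Set ℝ), IsDiskQuasiGeodesic C g I → ∀ r s t : ℝ, 0 < r → s ≤ t →
      Icc s t ⊆ I → ‖g s - g t‖ ≤ r → 1 - ‖g s‖ ≤ r → 1 - ‖g t‖ ≤ r →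
      ∀ u ∈ Icc s t, 1 - ‖g u‖ ≤ M * r := by
  obtain ⟨M, hM, hb⟩ := exists_norm_sub_le hC
  set A := C * (2 * Real.log (1 + (2 * M + 2 * M + 1)) + 1) with hA
  have hA0 : 0 ≤ A := by
    have : 0 ≤ Real.log (1 + (2 * M + 2 * M + 1)) := Real.log_nonneg (by linarith)
    positivity
  refine ⟨2 * Real.exp (2 * A), by positivity, fun g I h r s t hr hst hI hst' hs ht u hu => ?_⟩
  have hexp : 1 ≤ Real.exp (2 * A) := Real.one_le_exp (by positivity)
  rcases le_or_gt (1 - ‖g u‖) (2 * r) with hle | hlt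
  · have : 2 * r * 1 ≤ 2 * r * Real.exp (2 * A) := by gcongr
    linarith
  have hcont : ContinuousOn (fun u => 1 - ‖g u‖) (Icc s t) :=
    continuousOn_const.sub (h.continuousOn.mono hI).norm
  have hcl : ∀ a b, s ≤ a → b ≤ t → IsCompact (Icc a b ∩ (fun u => 1 - ‖g u‖) ⁻¹' Ici (2 * r)) :=
    fun a b ha hb => isCompact_Icc.of_isClosed_subset ((hcont.mono (Icc_subset_Icc ha hb)
      ).preimage_isClosed_of_isClosed isClosed_Icc isClosed_Ici) inter_subset_left
  obtain ⟨a, ⟨ha, ha2⟩, hamin⟩ := (hcl s u le_rfl hu.2).exists_isLeast ⟨u, ⟨hu.1, le_rfl⟩, hlt.le⟩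
  obtain ⟨b, ⟨hb', hb2⟩, hbmax⟩ := (hcl u t hu.1 le_rfl).exists_isGreatest
    ⟨u, ⟨le_rfl, hu.2⟩, hlt.le⟩
  have hat : a ≤ t := ha.2.trans hu.2
  have hsb : s ≤ b := hu.1.trans hb'.1
  -- the depth is at most `2 r` before `a` and after `b`
  have hda : ∀ v ∈ Ico s a, 1 - ‖g v‖ < 2 * r := fun v hv => by
    by_contra! hc
    exact absurd (hamin ⟨⟨hv.1, hv.2.le.trans ha.2⟩, hc⟩) (not_le.2 hv.2)
  have hdb : ∀ v ∈ Ioc b t, 1 - ‖g v‖ < 2 * r := fun v hv => by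
    by_contra! hc
    exact absurd (hbmax ⟨⟨hb'.1.trans hv.1.le, hv.2⟩, hc⟩) (not_le.2 hv.1)
  have hsa : s < a := by
    rcases ha.1.eq_or_lt with h1 | h1
    · have := mem_Ici.1 (mem_preimage.1 ha2); rw [← h1] at this; linarith
    · exact h1
  have hbt : b < t := by
    rcases hb'.2.eq_or_lt with h1 | h1
    · have := mem_Ici.1 (mem_preimage.1 hb2); rw [h1] at this; linarith
    · exact h1
  have hda' : ∀ v ∈ Icc s a, 1 - ‖g v‖ ≤ 2 * r := by
    have hc : ContinuousOn (fun u => 1 - ‖g u‖) (Icc s a) :=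
      hcont.mono (Icc_subset_Icc le_rfl hat)
    rw [← closure_Ico hsa.ne] at hc
    intro v hv
    rw [← closure_Ico hsa.ne] at hv
    exact closure_minimal (t := Iic (2 * r)) (by rintro _ ⟨x, hx, rfl⟩; exact (hda x hx).le)
      isClosed_Iic (hc.image_closure ⟨v, hv, rfl⟩)
  have hdb' : ∀ v ∈ Icc b t, 1 - ‖g v‖ ≤ 2 * r := by
    have hc : ContinuousOn (fun u => 1 - ‖g u‖) (Icc b t) :=
      hcont.mono (Icc_subset_Icc hsb le_rfl)
    rw [← closure_Ioc hbt.ne] at hc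
    intro v hv
    rw [← closure_Ioc hbt.ne] at hv
    exact closure_minimal (t := Iic (2 * r)) (by rintro _ ⟨x, hx, rfl⟩; exact (hdb x hx).le)
      isClosed_Iic (hc.image_closure ⟨v, hv, rfl⟩)
  have e1 := hb g I h (2 * r) s a ha.1 ((Icc_subset_Icc le_rfl hat).trans hI) hda'
  have e2 := hb g I h (2 * r) b t hb'.2 ((Icc_subset_Icc hsb le_rfl).trans hI) hdb'
  have hab : ‖g a - g b‖ ≤ (2 * M + 2 * M + 1) * r := by
    have t1 := norm_sub_le_norm_sub_add_norm_sub (g a) (g s) (g b)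
    have t2 := norm_sub_le_norm_sub_add_norm_sub (g s) (g t) (g b)
    have t3 := norm_sub_rev (g a) (g s)
    have t4 := norm_sub_rev (g t) (g b)
    linarith
  have haI : a ∈ I := hI ⟨ha.1, hat⟩
  have hbI : b ∈ I := hI ⟨hsb, hb'.2⟩
  have hlog : ∀ d, 2 * r ≤ d →
      Real.log (1 + ‖g a - g b‖ / d) ≤ Real.log (1 + (2 * M + 2 * M + 1)) := fun d hd => by
    have hd0 : 0 < d := by linarith
    apply Real.log_le_log (by positivity)
    gcongr
    rw [div_le_iff₀ hd0]
    refine hab.trans ?_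
    gcongr
    linarith
  have hT : |a - b| ≤ A := by
    refine (h.upper a haI b hbI).trans ?_
    rw [hA]
    gcongr
    linarith [hlog _ ha2, hlog _ hb2]
  have h5 := h.depth_le haI (hI hu)
  have h6 : 1 - ‖g a‖ ≤ 2 * r := hda' a ⟨ha.1, le_rfl⟩
  have h7 : |a - u| ≤ A := by
    rw [abs_sub_comm] at hT ⊢
    rw [abs_of_nonneg (by linarith [ha.2])]
    rw [abs_of_nonneg (by linarith [ha.2, hb'.1])] at hT
    linarith [hb'.1]
  calc 1 - ‖g u‖ ≤ (1 - ‖g a‖) * Real.exp (2 * |a - u|) := h5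
    _ ≤ (2 * r) * Real.exp (2 * A) := by gcongr
    _ = _ := by ring

end IsDiskQuasiGeodesic

/-- An injective map from `Ω` into the unit disk with nowhere vanishing complex derivative. -/
structure IsDiskEmbedding (Ω : Set ℂ) (h : ℂ → ℂ) : Prop where
  mapsTo : MapsTo h Ω (ball 0 1)
  injOn : InjOn h Ω
  deriv_ne_zero : ∀ z ∈ Ω, deriv h z ≠ 0

theorem IsDiskEmbedding.differentiableAt {Ω : Set ℂ} {h : ℂ → ℂ} (H : IsDiskEmbedding Ω h) {z : ℂ}
    (hz : z ∈ Ω) : DifferentiableAt ℂ h z :=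
  differentiableAt_of_deriv_ne_zero (H.deriv_ne_zero z hz)

theorem IsDiskEmbedding.differentiableOn {Ω : Set ℂ} {h : ℂ → ℂ} (H : IsDiskEmbedding Ω h) :
    DifferentiableOn ℂ h Ω :=
  fun _ hz => (H.differentiableAt hz).differentiableWithinAt

theorem IsDiskEmbedding.norm_sub_le {Ω : Set ℂ} {h : ℂ → ℂ} (H : IsDiskEmbedding Ω h) {z w : ℂ}
    {r : ℝ} (hr : ball z r ⊆ Ω) (hw : w ∈ ball z r) : ‖h w - h z‖ ≤ 2 / r * ‖w - z‖ := by
  have hr0 : 0 < r := pos_of_mem_ball hw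
  have hz : z ∈ Ω := hr (mem_ball_self hr0)
  have := Complex.dist_le_div_mul_dist_of_mapsTo_ball (R₂ := 2) (H.differentiableOn.mono hr)
    (fun x hx => by
      have h1 := H.mapsTo (hr hx)
      have h2 := H.mapsTo hz
      rw [mem_ball_zero_iff] at h1 h2
      rw [mem_closedBall, dist_eq_norm]
      linarith [_root_.norm_sub_le (h x) (h z)]) hw
  simpa [dist_eq_norm] using this

/-- The disk automorphism exchanging `a` and `0` (up to rotation). -/
noncomputable def diskShift (a z : ℂ) : ℂ := (z - a) / (1 - (starRingEnd ℂ) a * z)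

theorem one_sub_conj_mul_ne_zero {a z : ℂ} (ha : ‖a‖ < 1) (hz : ‖z‖ < 1) :
    1 - (starRingEnd ℂ) a * z ≠ 0 := by
  intro h
  have h1 : (starRingEnd ℂ) a * z = 1 := (sub_eq_zero.1 h).symm
  have h2 : ‖a‖ * ‖z‖ = 1 := by
    rw [← Complex.norm_conj a, ← norm_mul, h1, norm_one]
  nlinarith [norm_nonneg a, norm_nonneg z]

theorem hasDerivAt_diskShift {a z : ℂ} (ha : ‖a‖ < 1) (hz : ‖z‖ < 1) :
    HasDerivAt (diskShift a) ((1 - ‖a‖ ^ 2) / (1 - (starRingEnd ℂ) a * z) ^ 2) z := by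
  have h1 : HasDerivAt (fun z => z - a) 1 z := (hasDerivAt_id z).sub_const a
  have h2 : HasDerivAt (fun z => 1 - (starRingEnd ℂ) a * z) (-((starRingEnd ℂ) a)) z := by
    simpa using ((hasDerivAt_id z).const_mul ((starRingEnd ℂ) a)).const_sub 1
  convert! h1.div h2 (one_sub_conj_mul_ne_zero ha hz) using 1
  congr 1
  have := Complex.mul_conj' a
  linear_combination this

theorem diskShift_mem_ball {a z : ℂ} (ha : ‖a‖ < 1) (hz : ‖z‖ < 1) : ‖diskShift a z‖ < 1 := by
  rw [diskShift, norm_div, div_lt_one (norm_pos_iff.2 (one_sub_conj_mul_ne_zero ha hz))]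
  have key : ‖1 - (starRingEnd ℂ) a * z‖ ^ 2 - ‖z - a‖ ^ 2 = (1 - ‖a‖ ^ 2) * (1 - ‖z‖ ^ 2) := by
    simp only [← Complex.normSq_eq_norm_sq, Complex.normSq_apply]
    simp
    ring
  have : 0 < (1 - ‖a‖ ^ 2) * (1 - ‖z‖ ^ 2) := by
    apply mul_pos <;> nlinarith [norm_nonneg a, norm_nonneg z]
  exact lt_of_pow_lt_pow_left₀ 2 (norm_nonneg _) (by linarith)

theorem one_sub_norm_sq_ne_zero {a : ℂ} (ha : ‖a‖ < 1) : (1 - (‖a‖ : ℂ) ^ 2) ≠ 0 := by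
  have : (1 - ‖a‖ ^ 2) ≠ 0 := by nlinarith [norm_nonneg a]
  exact_mod_cast this

theorem diskShift_injOn {a : ℂ} (ha : ‖a‖ < 1) : InjOn (diskShift a) (ball 0 1) := by
  intro z hz w hw h
  rw [mem_ball_zero_iff] at hz hw
  rw [diskShift, diskShift, div_eq_div_iff (one_sub_conj_mul_ne_zero ha hz)
    (one_sub_conj_mul_ne_zero ha hw)] at h
  have h1 := Complex.mul_conj' a
  have : (1 - (‖a‖ : ℂ) ^ 2) * (z - w) = 0 := by
    linear_combination h + (z - w) * h1
  rcases mul_eq_zero.1 this with h2 | h2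
  · exact absurd h2 (one_sub_norm_sq_ne_zero ha)
  · exact sub_eq_zero.1 h2

theorem IsDiskEmbedding.deriv_diskShift_comp {Ω : Set ℂ} {h : ℂ → ℂ} (H : IsDiskEmbedding Ω h)
    {a z : ℂ} (ha : ‖a‖ < 1) (hz : z ∈ Ω) : deriv (fun z => diskShift a (h z)) z =
      (1 - ‖a‖ ^ 2) / (1 - (starRingEnd ℂ) a * h z) ^ 2 * deriv h z :=
  ((hasDerivAt_diskShift ha (mem_ball_zero_iff.1 (H.mapsTo hz))).comp z
    (H.differentiableAt hz).hasDerivAt).deriv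

theorem IsDiskEmbedding.diskShift_comp {Ω : Set ℂ} {h : ℂ → ℂ} (H : IsDiskEmbedding Ω h) {a : ℂ}
    (ha : ‖a‖ < 1) : IsDiskEmbedding Ω (fun z => diskShift a (h z)) := by
  have hm : ∀ z ∈ Ω, ‖h z‖ < 1 := fun z hz => mem_ball_zero_iff.1 (H.mapsTo hz)
  refine ⟨fun z hz => mem_ball_zero_iff.2 (diskShift_mem_ball ha (hm z hz)),
    (diskShift_injOn ha).comp H.injOn H.mapsTo, fun z hz => ?_⟩
  rw [H.deriv_diskShift_comp ha hz]
  exact mul_ne_zero (div_ne_zero (one_sub_norm_sq_ne_zero ha)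
    (pow_ne_zero _ (one_sub_conj_mul_ne_zero ha (hm z hz)))) (H.deriv_ne_zero z hz)

/-- A branch of the square root along a nonvanishing differentiable function. -/
theorem exists_sqrt_branch {Ω : Set ℂ} (hO : IsOpen Ω) (hSC : SimplyConnectedSpace ↥Ω)
    {h : ℂ → ℂ} (hd : ∀ z ∈ Ω, DifferentiableAt ℂ h z) (h0 : ∀ z ∈ Ω, h z ≠ 0) :
    ∃ u : ℂ → ℂ, (∀ z, u z ^ 2 = h z) ∧ ∀ z ∈ Ω, HasDerivAt u (deriv h z / (2 * u z)) z := by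
  obtain ⟨u, huc, hu⟩ := Complex.exists_continuousOn_pow_eq (U := Ω) hSC hO (g := h)
    (fun z hz => (hd z hz).continuousAt.continuousWithinAt)
    (by rintro ⟨z, hz, h⟩; exact h0 z hz h) two_ne_zero
  have hu0 : ∀ z ∈ Ω, u z ≠ 0 := fun z hz h => h0 z hz (by rw [← hu, h]; simp)
  refine ⟨u, hu, fun z hz => ?_⟩
  have hc : ContinuousAt u z := huc.continuousAt (hO.mem_nhds hz)
  -- the difference quotient of `u` is that of `h` divided by `u w + u z`
  rw [hasDerivAt_iff_tendsto_slope]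
  have h1 := hasDerivAt_iff_tendsto_slope.1 (hd z hz).hasDerivAt
  have h2 : Tendsto (fun w => u w + u z) (𝓝[≠] z) (𝓝 (2 * u z)) := by
    rw [two_mul]
    exact (hc.tendsto.mono_left nhdsWithin_le_nhds).add_const _
  refine (h1.div h2 (mul_ne_zero two_ne_zero (hu0 z hz))).congr' ?_
  filter_upwards [h2.eventually_ne (mul_ne_zero two_ne_zero (hu0 z hz)), self_mem_nhdsWithin]
    with w hw hwz
  simp only [slope_def_field, Pi.div_apply]
  rw [← hu, ← hu, div_right_comm]
  congr 1
  rw [div_eq_iff hw]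
  ring

/-- The Koebe square-root improvement. -/
theorem IsDiskEmbedding.exists_larger_deriv {Ω : Set ℂ} (hO : IsOpen Ω)
    (hSC : SimplyConnectedSpace ↥Ω) {h : ℂ → ℂ} (H : IsDiskEmbedding Ω h) {x a : ℂ} (hx : x ∈ Ω)
    (hx0 : h x = 0) (ha : ‖a‖ < 1) (haΩ : a ∉ h '' Ω) :
    ∃ k, IsDiskEmbedding Ω k ∧ k x = 0 ∧ ‖deriv h x‖ < ‖deriv k x‖ := by
  have H' := H.diskShift_comp ha
  have hm : ∀ z ∈ Ω, ‖h z‖ < 1 := fun z hz => mem_ball_zero_iff.1 (H.mapsTo hz)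
  have hne : ∀ z ∈ Ω, diskShift a (h z) ≠ 0 := fun z hz h0 => by
    rw [diskShift, div_eq_zero_iff, or_iff_left (one_sub_conj_mul_ne_zero ha (hm z hz)),
      sub_eq_zero] at h0
    exact haΩ ⟨z, hz, h0⟩
  obtain ⟨u, hu, hud⟩ := exists_sqrt_branch hO hSC (fun z hz => H'.differentiableAt hz) hne
  have hu0 : ∀ z ∈ Ω, u z ≠ 0 := fun z hz h => hne z hz (by rw [← hu, h]; simp)
  have hU : IsDiskEmbedding Ω u := by
    refine ⟨fun z hz => ?_, fun z hz w hw e => ?_, fun z hz => ?_⟩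
    · have := mem_ball_zero_iff.1 (H'.mapsTo hz)
      rw [← hu, norm_pow] at this
      exact mem_ball_zero_iff.2 ((sq_lt_one_iff₀ (norm_nonneg _)).1 this)
    · exact H'.injOn hz hw (by simp only [← hu, e])
    · rw [(hud z hz).deriv]
      exact div_ne_zero (H'.deriv_ne_zero z hz) (mul_ne_zero two_ne_zero (hu0 z hz))
  have hb : ‖u x‖ < 1 := mem_ball_zero_iff.1 (hU.mapsTo hx)
  refine ⟨_, hU.diskShift_comp hb, by simp [diskShift], ?_⟩
  rw [hU.deriv_diskShift_comp hb hx, (hud x hx).deriv, H.deriv_diskShift_comp ha hx, hx0]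
  have hsq : ‖u x‖ ^ 2 = ‖a‖ := by
    rw [← norm_pow, hu, hx0]; simp [diskShift]
  have hupos : 0 < ‖u x‖ := norm_pos_iff.2 (hu0 x hx)
  have e1 : (starRingEnd ℂ) (u x) * u x = (‖u x‖ : ℂ) ^ 2 := by
    rw [mul_comm]; exact Complex.mul_conj' _
  have n1 : ∀ a : ℂ, ‖a‖ < 1 → ‖(1 - (‖a‖ : ℂ) ^ 2)‖ = 1 - ‖a‖ ^ 2 := fun a ha => by
    have : (1 - (‖a‖ : ℂ) ^ 2) = ((1 - ‖a‖ ^ 2 : ℝ) : ℂ) := by push_cast; ring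
    rw [this, Complex.norm_real, Real.norm_of_nonneg (by nlinarith [norm_nonneg a])]
  rw [e1]
  simp only [norm_mul, norm_div, norm_pow, n1 _ ha, n1 _ hb, mul_zero, sub_zero, norm_one,
    Complex.norm_ofNat]
  have hd0 : 0 < ‖deriv h x‖ := norm_pos_iff.2 (H.deriv_ne_zero x hx)
  rw [← hsq]
  have hp : 0 < 1 - ‖u x‖ ^ 2 := by nlinarith
  have : (1 - ‖u x‖ ^ 2) / (1 - ‖u x‖ ^ 2) ^ 2 * ((1 - (‖u x‖ ^ 2) ^ 2) / 1 ^ 2 * ‖deriv h x‖ /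
      (2 * ‖u x‖)) = (1 + ‖u x‖ ^ 2) / (2 * ‖u x‖) * ‖deriv h x‖ := by
    field_simp
    ring
  rw [this]
  refine lt_mul_left hd0 ?_
  rw [one_lt_div (by positivity)]
  nlinarith [sq_pos_of_pos (sub_pos.2 hb)]

/-- Local form of Hurwitz' theorem. -/
theorem TendstoLocallyUniformlyOn.eventually_eq_zero_of_ne_zero {ι : Type*} {φ : Filter ι}
    [φ.NeBot] {F : ι → ℂ → ℂ} {G : ℂ → ℂ} {U : Set ℂ} (h : TendstoLocallyUniformlyOn F G φ U)
    (hU : IsOpen U) (hF : ∀ n, DifferentiableOn ℂ (F n) U) (h0 : ∀ n, ∀ z ∈ U, F n z ≠ 0)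
    {z : ℂ} (hz : z ∈ U) (hG : G z = 0) : ∀ᶠ w in 𝓝 z, G w = 0 := by
  have hGd : DifferentiableOn ℂ G U := h.differentiableOn (Eventually.of_forall hF) hU
  rcases (hGd.analyticAt (hU.mem_nhds hz)).eventually_eq_zero_or_eventually_ne_zero with h1 | h1
  · exact h1
  exfalso
  rw [eventually_nhdsWithin_iff] at h1
  obtain ⟨r, hr, hrU⟩ := nhds_basis_closedBall.eventually_iff.1 (h1.and (hU.mem_nhds hz))
  have hKU : closedBall z r ⊆ U := fun x hx => (hrU hx).2
  have hne : ∀ w ∈ sphere z r, G w ≠ 0 := fun w hw =>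
    (hrU (sphere_subset_closedBall hw)).1 (ne_of_mem_sphere hw hr.ne')
  obtain ⟨w₀, hw₀, hmin⟩ := (isCompact_sphere z r).exists_isMinOn
    (NormedSpace.sphere_nonempty.2 hr.le)
    (hGd.continuousOn.mono (sphere_subset_closedBall.trans hKU)).norm
  set m := ‖G w₀‖ with hm
  have hm0 : 0 < m := norm_pos_iff.2 (hne w₀ hw₀)
  have hunif := (tendstoLocallyUniformlyOn_iff_tendstoUniformlyOn_of_compact
    (isCompact_closedBall z r)).1 (h.mono hKU)
  rw [Metric.tendstoUniformlyOn_iff] at hunif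
  obtain ⟨n, hn⟩ := (hunif (m / 2) (by positivity)).exists
  have hz1 : ‖F n z‖ < m / 2 := by
    have := hn z (mem_closedBall_self hr.le)
    rwa [hG, dist_zero_left] at this
  have hz2 : ‖(F n z)⁻¹‖ ≤ 2 / m := by
    have hd : DifferentiableOn ℂ (fun w => (F n w)⁻¹) (closedBall z r) :=
      ((hF n).mono hKU).inv fun w hw => h0 n w (hKU hw)
    refine Complex.norm_le_of_forall_mem_frontier_norm_le (U := ball z r) isBounded_ball
      (hd.diffContOnCl_ball Subset.rfl) (fun w hw => ?_)
      (subset_closure (mem_ball_self hr))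
    rw [frontier_ball z hr.ne'] at hw
    have h2 := hn w (sphere_subset_closedBall hw)
    rw [dist_eq_norm] at h2
    have h3 : m ≤ ‖G w‖ := hmin hw
    have h4 := norm_sub_norm_le (G w) (F n w)
    rw [norm_inv, inv_le_comm₀ (by linarith) (by positivity), inv_div]
    linarith
  rw [norm_inv, inv_le_comm₀ (norm_pos_iff.2 (h0 n z (hKU (mem_closedBall_self hr.le))))
    (by positivity), inv_div] at hz2
  linarith

/-- Montel's theorem for disk embeddings: along any ultrafilter they converge locally uniformly. -/
theorem exists_tendstoLocallyUniformlyOn_of_isDiskEmbedding {ι : Type*} (φ : Ultrafilter ι)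
    {Ω : Set ℂ} (hO : IsOpen Ω) {F : ι → ℂ → ℂ} (hF : ∀ n, IsDiskEmbedding Ω (F n)) :
    ∃ G, TendstoLocallyUniformlyOn F G φ Ω := by
  have hlim : ∀ z, ∃ w, z ∈ Ω → Tendsto (fun n => F n z) φ (𝓝 w) := by
    intro z
    by_cases hz : z ∈ Ω
    · obtain ⟨w, -, hw⟩ := (isCompact_closedBall (0:ℂ) 1).ultrafilter_le_nhds
        (φ.map (fun n => F n z)) (by
          rw [le_principal_iff]
          exact Eventually.of_forall (f := (φ : Filter ι)) fun n =>
            ball_subset_closedBall ((hF n).mapsTo hz))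
      exact ⟨w, fun _ => hw⟩
    · exact ⟨0, fun h => absurd h hz⟩
  choose G hG using hlim
  refine ⟨G, Metric.tendstoLocallyUniformlyOn_iff.2 fun ε hε z hz => ?_⟩
  obtain ⟨r, hr, hrΩ⟩ := Metric.isOpen_iff.1 hO z hz
  set ρ := min r (r * ε / 8) with hρ
  have hρ0 : 0 < ρ := by positivity
  have hnear : ∀ n, ∀ w ∈ ball z ρ, ‖F n w - F n z‖ ≤ ε / 4 := fun n w hw => by
    have h1 := (hF n).norm_sub_le hrΩ (ball_subset_ball (min_le_left _ _) hw)
    have h2 : ‖w - z‖ ≤ r * ε / 8 := by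
      rw [mem_ball, dist_eq_norm] at hw
      exact hw.le.trans (min_le_right _ _)
    calc _ ≤ _ := h1
      _ ≤ 2 / r * (r * ε / 8) := by gcongr
      _ = ε / 4 := by field_simp; norm_num
  refine ⟨ball z ρ, mem_nhdsWithin_of_mem_nhds (ball_mem_nhds z hρ0), ?_⟩
  filter_upwards [Metric.tendsto_nhds.1 (hG z hz) (ε / 4) (by positivity)] with n hn w hw
  have hwΩ : w ∈ Ω := hrΩ (ball_subset_ball (min_le_left _ _) hw)
  have hGw : ‖G w - G z‖ ≤ ε / 4 :=
    le_of_tendsto ((hG w hwΩ).sub (hG z hz)).norm (Eventually.of_forall fun n => hnear n w hw)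
  rw [dist_eq_norm] at hn ⊢
  have e : G w - F n w = (G w - G z) - (F n z - G z) - (F n w - F n z) := by ring
  rw [e]
  have h1 := _root_.norm_sub_le ((G w - G z) - (F n z - G z)) (F n w - F n z)
  have h2 := _root_.norm_sub_le (G w - G z) (F n z - G z)
  linarith [hnear n w hw]

/-- A nondegenerate locally uniform limit of disk embeddings is a disk embedding. -/
theorem isDiskEmbedding_of_tendstoLocallyUniformlyOn {ι : Type*} {φ : Filter ι} [φ.NeBot]
    {Ω : Set ℂ} (hO : IsOpen Ω) (hc : IsPreconnected Ω) {F : ι → ℂ → ℂ} {G : ℂ → ℂ}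
    (hF : ∀ n, IsDiskEmbedding Ω (F n)) (h : TendstoLocallyUniformlyOn F G φ Ω) {x : ℂ}
    (hx : x ∈ Ω) (hGx : deriv G x ≠ 0) : IsDiskEmbedding Ω G := by
  have hGd : DifferentiableOn ℂ G Ω :=
    h.differentiableOn (Eventually.of_forall fun n => (hF n).differentiableOn) hO
  have hpt : ∀ z ∈ Ω, Tendsto (fun n => F n z) φ (𝓝 (G z)) := fun z hz => h.tendsto_at hz
  have hd : ∀ z ∈ Ω, deriv G z ≠ 0 := by
    intro z hz h0
    have h1 : ∀ᶠ w in 𝓝 z, deriv G w = 0 :=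
      (h.deriv (Eventually.of_forall fun n => (hF n).differentiableOn)
        hO).eventually_eq_zero_of_ne_zero hO (fun n => (hF n).differentiableOn.deriv hO)
        (fun n w hw => (hF n).deriv_ne_zero w hw) hz h0
    have h2 := ((hGd.deriv hO).analyticOnNhd hO).eqOn_zero_of_preconnected_of_eventuallyEq_zero
      hc hz h1
    exact hGx (h2 hx)
  have hle : ∀ z ∈ Ω, ‖G z‖ ≤ 1 := fun z hz =>
    le_of_tendsto (hpt z hz).norm (Eventually.of_forall fun n =>
      (mem_ball_zero_iff.1 ((hF n).mapsTo hz)).le)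
  refine ⟨fun z hz => ?_, fun z hz w hw e => ?_, hd⟩
  · -- maximum principle: `G` is an open map
    rw [mem_ball_zero_iff]
    refine (hle z hz).lt_of_ne fun h1 => ?_
    have hmap : 𝓝 (G z) ≤ map G (𝓝 z) :=
      ((hGd.analyticAt (hO.mem_nhds hz)).hasStrictDerivAt.map_nhds_eq (hd z hz)).ge
    have h3 : closedBall (0:ℂ) 1 ∈ 𝓝 (G z) := hmap (by
      rw [mem_map]
      filter_upwards [hO.mem_nhds hz] with w hw
      exact mem_closedBall_zero_iff.2 (hle w hw))
    have h4 := mem_interior_iff_mem_nhds.2 h3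
    rw [interior_closedBall _ one_ne_zero, mem_ball_zero_iff] at h4
    exact h4.ne h1
  · by_contra hne
    obtain ⟨r, hr, hrΩ⟩ := Metric.isOpen_iff.1 (hO.inter isOpen_compl_singleton) z
      ⟨hz, (hne : z ∉ ({w} : Set ℂ))⟩
    have hsub : ball z r ⊆ Ω := fun y hy => (hrΩ hy).1
    have hconv : TendstoLocallyUniformlyOn (fun n y => F n y - F n w) (fun y => G y - G w) φ
        (ball z r) := by
      rw [Metric.tendstoLocallyUniformlyOn_iff]
      intro ε hε y hy
      obtain ⟨t, ht, h1⟩ := Metric.tendstoLocallyUniformlyOn_iff.1 (h.mono hsub) (ε / 2)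
        (by positivity) y hy
      refine ⟨t, ht, ?_⟩
      filter_upwards [h1, Metric.tendsto_nhds.1 (hpt w hw) (ε / 2) (by positivity)] with n hn1 hn2 v hv
      rw [dist_comm] at hn2
      have := hn1 v hv
      have h5 := dist_sub_sub_le (G v) (G w) (F n v) (F n w)
      linarith
    have h1 := hconv.eventually_eq_zero_of_ne_zero isOpen_ball
      (fun n => ((hF n).differentiableOn.mono hsub).sub_const _)
      (fun n y hy e => (hrΩ hy).2 ((hF n).injOn (hsub hy) hw (sub_eq_zero.1 e)))
      (mem_ball_self hr) (sub_eq_zero.2 e)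
    have h2 : G =ᶠ[𝓝 z] fun _ => G w := h1.mono fun y hy => sub_eq_zero.1 hy
    exact hd z hz (by rw [h2.deriv_eq, deriv_const])

/-- The Riemann mapping theorem for bounded simply connected domains. -/
theorem exists_isDiskEmbedding_image_eq {Ω : Set ℂ} (hO : IsOpen Ω) (hc : IsConnected Ω)
    (hb : Bornology.IsBounded Ω) (hSC : SimplyConnectedSpace ↥Ω) :
    ∃ g, IsDiskEmbedding Ω g ∧ g '' Ω = ball 0 1 := by
  obtain ⟨x, hx⟩ := hc.nonempty
  set S : Set ℝ := {t | ∃ h, IsDiskEmbedding Ω h ∧ h x = 0 ∧ t = ‖deriv h x‖} with hS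
  obtain ⟨r, hr, hrΩ⟩ := Metric.isOpen_iff.1 hO x hx
  have hSb : BddAbove S := by
    refine ⟨1 / r, ?_⟩
    rintro _ ⟨h, H, h0, rfl⟩
    exact Complex.norm_deriv_le_div_of_mapsTo_ball (H.differentiableOn.mono hrΩ) (fun y hy => by
      rw [h0]; exact ball_subset_closedBall (H.mapsTo (hrΩ hy))) hr
  have hSn : S.Nonempty := by
    obtain ⟨R, hR, hRΩ⟩ := hb.subset_ball_lt 0 x
    have hd : ∀ z, HasDerivAt (fun z => (z - x) / (R : ℂ)) (1 / R) z := fun z =>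
      ((hasDerivAt_id z).sub_const x).div_const _
    have hR0 : (R : ℂ) ≠ 0 := by exact_mod_cast hR.ne'
    refine ⟨_, fun z => (z - x) / R, ⟨fun z hz => ?_, fun z hz w hw e => ?_, fun z hz => ?_⟩,
      by simp, rfl⟩
    · have := hRΩ hz
      rw [mem_ball, dist_eq_norm] at this
      rw [mem_ball_zero_iff, norm_div, Complex.norm_real, Real.norm_of_nonneg hR.le,
        div_lt_one hR]
      exact this
    · rwa [div_left_inj' hR0, sub_left_inj] at e
    · rw [(hd z).deriv]
      exact one_div_ne_zero hR0
  have hpos : 0 < sSup S := by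
    obtain ⟨_, h, H, h0, rfl⟩ := hSn
    exact (norm_pos_iff.2 (H.deriv_ne_zero x hx)).trans_le (le_csSup hSb ⟨h, H, h0, rfl⟩)
  obtain ⟨u, -, hu, huS⟩ := exists_seq_tendsto_sSup hSn hSb
  choose F hF hF0 hFu using huS
  obtain ⟨G, hG⟩ := exists_tendstoLocallyUniformlyOn_of_isDiskEmbedding (hyperfilter ℕ) hO hF
  have hle : ((hyperfilter ℕ : Ultrafilter ℕ) : Filter ℕ) ≤ atTop := by
    rw [← Nat.cofinite_eq_atTop]; exact hyperfilter_le_cofinite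
  have hGx : ‖deriv G x‖ = sSup S := by
    have h1 := (hG.deriv (Eventually.of_forall fun n => (hF n).differentiableOn) hO).tendsto_at hx
    refine tendsto_nhds_unique h1.norm ?_
    simpa only [← hFu, Function.comp_def] using hu.mono_left hle
  have hG0 : G x = 0 := by
    have h1 := hG.tendsto_at hx
    simp only [hF0] at h1
    exact (tendsto_nhds_unique h1 tendsto_const_nhds)
  have HG : IsDiskEmbedding Ω G := isDiskEmbedding_of_tendstoLocallyUniformlyOn hO
    hc.isPreconnected hF hG hx
    (norm_pos_iff.1 (hGx ▸ hpos))
  refine ⟨G, HG, Subset.antisymm HG.mapsTo.image_subset fun a ha => ?_⟩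
  by_contra hna
  obtain ⟨k, hk, hk0, hlt⟩ := HG.exists_larger_deriv hO hSC hx hG0 (mem_ball_zero_iff.1 ha) hna
  rw [hGx] at hlt
  exact absurd (le_csSup hSb ⟨k, hk, hk0, rfl⟩) (not_le.2 hlt)

theorem infDist_compl_pos {Ω : Set ℂ} (hO : IsOpen Ω) (hne : Ωᶜ.Nonempty) {w : ℂ} (hw : w ∈ Ω) :
    0 < infDist w Ωᶜ :=
  (hO.isClosed_compl.notMem_iff_infDist_pos hne).1 (by simpa using hw)

theorem Bornology.IsBounded.compl_nonempty {Ω : Set ℂ} (hb : Bornology.IsBounded Ω) :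
    Ωᶜ.Nonempty := by
  rw [nonempty_compl]
  rintro rfl
  exact NormedSpace.unbounded_univ ℂ ℂ hb

/-- A pair of mutually inverse conformal maps between the unit disk and `Ω`, together with the
(Koebe and Schwarz–Pick) comparison of their derivatives with the distance to the boundary. -/
structure IsRiemannPair (Ω : Set ℂ) (f g : ℂ → ℂ) : Prop where
  mapsTo : MapsTo f (ball 0 1) Ω
  mapsTo_inv : MapsTo g Ω (ball 0 1)
  right_inv : ∀ w ∈ Ω, f (g w) = w
  left_inv : ∀ z ∈ ball (0 : ℂ) 1, g (f z) = z
  differentiableAt : ∀ z ∈ ball (0 : ℂ) 1, DifferentiableAt ℂ f z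
  differentiableAt_inv : ∀ w ∈ Ω, DifferentiableAt ℂ g w
  koebe : ∀ z ∈ ball (0 : ℂ) 1, (1 - ‖z‖) * ‖deriv f z‖ ≤ 40 * infDist (f z) Ωᶜ
  schwarz : ∀ w ∈ Ω, ‖deriv g w‖ * infDist w Ωᶜ ≤ 2 * (1 - ‖g w‖)

theorem IsDiskEmbedding.norm_deriv_mul_infDist_le {Ω : Set ℂ} {g : ℂ → ℂ} (hO : IsOpen Ω)
    (hne : Ωᶜ.Nonempty) (H : IsDiskEmbedding Ω g) {w : ℂ} (hw : w ∈ Ω) :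
    ‖deriv g w‖ * infDist w Ωᶜ ≤ 2 * (1 - ‖g w‖) := by
  have ha : ‖g w‖ < 1 := mem_ball_zero_iff.1 (H.mapsTo hw)
  have hδ := infDist_compl_pos hO hne hw
  have hsub : ball w (infDist w Ωᶜ) ⊆ Ω := ball_infDist_compl_subset
  have K := H.diskShift_comp ha
  have h1 := Complex.norm_deriv_le_div_of_mapsTo_ball (R₂ := 1) (K.differentiableOn.mono hsub)
    (fun y hy => by
      have : diskShift (g w) (g w) = 0 := by simp [diskShift]
      rw [this]
      exact ball_subset_closedBall (K.mapsTo (hsub hy))) hδ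
  have e1 : (starRingEnd ℂ) (g w) * g w = (‖g w‖ : ℂ) ^ 2 := by
    rw [mul_comm]; exact Complex.mul_conj' _
  have n1 : ‖(1 - (‖g w‖ : ℂ) ^ 2)‖ = 1 - ‖g w‖ ^ 2 := by
    have : (1 - (‖g w‖ : ℂ) ^ 2) = ((1 - ‖g w‖ ^ 2 : ℝ) : ℂ) := by push_cast; ring
    rw [this, Complex.norm_real, Real.norm_of_nonneg (by nlinarith [norm_nonneg (g w)])]
  have hp : 0 < 1 - ‖g w‖ ^ 2 := by nlinarith [norm_nonneg (g w)]
  rw [H.deriv_diskShift_comp ha hw, e1, norm_mul, norm_div, norm_pow, n1, le_div_iff₀ hδ] at h1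
  have h2 : (1 - ‖g w‖ ^ 2) / (1 - ‖g w‖ ^ 2) ^ 2 = (1 - ‖g w‖ ^ 2)⁻¹ := by field_simp
  rw [h2, mul_assoc, inv_mul_le_iff₀ hp] at h1
  nlinarith [norm_nonneg (g w)]

theorem weak_koebe {Ω : Set ℂ} {f : ℂ → ℂ} (hO : IsOpen Ω) (hne : Ωᶜ.Nonempty)
    (hSC : SimplyConnectedSpace ↥Ω) (hf : MapsTo f (ball 0 1) Ω)
    (hd : ∀ z ∈ ball (0 : ℂ) 1, DifferentiableAt ℂ f z) {z : ℂ} (hz : z ∈ ball (0 : ℂ) 1) :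
    (1 - ‖z‖) * ‖deriv f z‖ ≤ 40 * infDist (f z) Ωᶜ := by
  obtain ⟨a, ha, hδ⟩ := hO.isClosed_compl.exists_infDist_eq_dist hne (f z)
  have hδ0 := infDist_compl_pos hO hne (hf hz)
  have hsub : ball (f z) (infDist (f z) Ωᶜ) ⊆ Ω := ball_infDist_compl_subset
  obtain ⟨u, hu, hud⟩ := exists_sqrt_branch hO hSC (h := fun w => w - a)
    (fun w _ => by fun_prop) (fun w hw h => ha (by rwa [← sub_eq_zero.1 h]))
  set b := u (f z) with hb
  have hb2 : ‖b‖ ^ 2 = infDist (f z) Ωᶜ := by rw [hb, ← norm_pow, hu, hδ, dist_eq_norm]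
  have hb0 : b ≠ 0 := fun h => by rw [h] at hb2; simp at hb2; linarith
  have hbp : 0 < ‖b‖ := norm_pos_iff.2 hb0
  -- the branch stays in the half plane around `b` over the maximal disk
  have hre : ∀ y ∈ ball (f z) (infDist (f z) Ωᶜ), 0 < (u y / b).re := by
    have hcont : ContinuousOn (fun y => (u y / b).re) (ball (f z) (infDist (f z) Ωᶜ)) :=
      Complex.continuous_re.comp_continuousOn
        (ContinuousOn.div_const (fun y hy => (hud y (hsub hy)).continuousAt.continuousWithinAt) _)
    have hnz : ∀ y ∈ ball (f z) (infDist (f z) Ωᶜ), (u y / b).re ≠ 0 := by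
      intro y hy h0
      have h1 : ((u y / b) ^ 2).re ≤ 0 := by
        rw [pow_two, Complex.mul_re, h0]; nlinarith [sq_nonneg (u y / b).im]
      have h2 : (u y / b) ^ 2 = 1 + (y - f z) / b ^ 2 := by
        rw [div_pow, hu, hb, hu]
        have : f z - a ≠ 0 := sub_ne_zero.2 fun h => ha (h ▸ hf hz)
        field_simp
        ring
      have h3 : ‖(y - f z) / b ^ 2‖ < 1 := by
        rw [norm_div, norm_pow, hb2, div_lt_one hδ0, ← dist_eq_norm]
        exact hy
      have h4 := (abs_le.1 (Complex.abs_re_le_norm ((y - f z) / b ^ 2))).1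
      rw [h2, Complex.add_re, Complex.one_re] at h1
      linarith
    intro y hy
    by_contra! hle
    have hpre := (convex_ball (f z) (infDist (f z) Ωᶜ)).isPreconnected
    obtain ⟨x, hx, hx0⟩ := hpre.intermediate_value hy (mem_ball_self hδ0) hcont
      (show (0:ℝ) ∈ Icc _ _ from ⟨hle, by simp [← hb, div_self hb0]⟩)
    exact hnz x hx hx0
  have homit : ∀ y ∈ Ω, 2 / 5 * ‖b‖ ≤ ‖u y + b‖ := by
    intro y hy
    by_contra! hlt
    have h1 : y ∈ ball (f z) (infDist (f z) Ωᶜ) := by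
      have h2 : y - f z = (u y + b) * (u y - b) := by
        have : (u y + b) * (u y - b) = u y ^ 2 - b ^ 2 := by ring
        rw [this, hu, hb, hu]; ring
      have h3 : ‖u y - b‖ ≤ ‖u y + b‖ + 2 * ‖b‖ := by
        have := _root_.norm_sub_le (u y + b) (2 * b)
        rw [norm_mul, Complex.norm_ofNat] at this
        have e : u y - b = u y + b - 2 * b := by ring
        rwa [e]
      rw [mem_ball, dist_eq_norm, h2, norm_mul, ← hb2]
      have := norm_nonneg (u y + b)
      have := norm_nonneg (u y - b)
      nlinarith
    have h2 := hre y h1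
    have h3 : ‖u y / b + 1‖ < 2 / 5 := by
      have : u y / b + 1 = (u y + b) / b := by field_simp
      rw [this, norm_div, div_lt_iff₀ hbp]
      exact hlt
    have h4 := (abs_le.1 (Complex.abs_re_le_norm (u y / b + 1))).2
    rw [Complex.add_re, Complex.one_re] at h4
    linarith
  have hz1 : ‖z‖ < 1 := mem_ball_zero_iff.1 hz
  have hnear : ball z (1 - ‖z‖) ⊆ ball 0 1 := by
    intro y hy
    rw [mem_ball, dist_eq_norm] at hy
    rw [mem_ball_zero_iff]
    have := norm_sub_norm_le y z
    linarith
  have hne0 : ∀ y ∈ Ω, u y + b ≠ 0 := fun y hy h => by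
    have := homit y hy
    rw [h, norm_zero] at this
    linarith
  have hG : ∀ y ∈ ball (0:ℂ) 1, HasDerivAt (fun y => (u (f y) + b)⁻¹)
      (-(1 / (2 * u (f y)) * deriv f y) / (u (f y) + b) ^ 2) y := fun y hy => by
    have h1 := (hud (f y) (hf hy)).comp y (hd y hy).hasDerivAt
    have h2 : deriv (fun w => w - a) (f y) = 1 := by simp
    rw [h2] at h1
    exact (h1.add_const b).inv (hne0 _ (hf hy))
  have hGb : ∀ y ∈ ball (0:ℂ) 1, ‖(u (f y) + b)⁻¹‖ ≤ (2 / 5 * ‖b‖)⁻¹ := fun y hy => by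
    rw [norm_inv]
    exact inv_anti₀ (by positivity) (homit _ (hf hy))
  have hcauchy : ‖deriv (fun y => (u (f y) + b)⁻¹) z‖ ≤ 2 * (2 / 5 * ‖b‖)⁻¹ / (1 - ‖z‖) :=
    Complex.norm_deriv_le_div_of_mapsTo_ball
      (fun y hy => (hG y (hnear hy)).differentiableAt.differentiableWithinAt) (fun y hy => by
        rw [mem_closedBall, dist_eq_norm]
        have h1 := _root_.norm_sub_le ((u (f y) + b)⁻¹) ((u (f z) + b)⁻¹)
        linarith [hGb y (hnear hy), hGb z hz]) (by linarith)
  rw [(hG z hz).deriv, ← hb, ← two_mul, norm_div, norm_neg, norm_mul, norm_div, norm_pow,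
    norm_mul, norm_one, Complex.norm_ofNat, le_div_iff₀ (by linarith)] at hcauchy
  rw [← hb2]
  have e : 1 / (2 * ‖b‖) * ‖deriv f z‖ / (2 * ‖b‖) ^ 2 * (1 - ‖z‖) =
      ((1 - ‖z‖) * ‖deriv f z‖) / (8 * ‖b‖ ^ 3) := by field_simp; ring
  rw [e, div_le_iff₀ (by positivity)] at hcauchy
  have e2 : 2 * (2 / 5 * ‖b‖)⁻¹ * (8 * ‖b‖ ^ 3) = 40 * ‖b‖ ^ 2 := by field_simp; ring
  linarith

theorem IsDiskEmbedding.isRiemannPair {Ω : Set ℂ} {g : ℂ → ℂ} (hO : IsOpen Ω)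
    (hne : Ωᶜ.Nonempty) (hSC : SimplyConnectedSpace ↥Ω) (H : IsDiskEmbedding Ω g)
    (hsurj : g '' Ω = ball 0 1) : ∃ f, IsRiemannPair Ω f g := by
  have hf : ∀ z : ℂ, ∃ w, z ∈ ball (0:ℂ) 1 → w ∈ Ω ∧ g w = z := fun z => by
    by_cases hz : z ∈ ball (0:ℂ) 1
    · rw [← hsurj] at hz
      obtain ⟨w, hw, e⟩ := hz
      exact ⟨w, fun _ => ⟨hw, e⟩⟩
    · exact ⟨0, fun h => absurd h hz⟩
  choose f hf using hf
  have hleft : ∀ w ∈ Ω, f (g w) = w := fun w hw =>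
    H.injOn (hf _ (H.mapsTo hw)).1 hw (hf _ (H.mapsTo hw)).2
  have hd : ∀ z ∈ ball (0 : ℂ) 1, DifferentiableAt ℂ f z := fun z hz => by
    obtain ⟨hw, e⟩ := hf z hz
    have hs : HasStrictDerivAt g (deriv g (f z)) (f z) :=
      (H.differentiableOn.analyticAt (hO.mem_nhds hw)).hasStrictDerivAt
    have hc : ContinuousAt f z := by
      intro s hs'
      have h1 := hs.map_nhds_eq (H.deriv_ne_zero _ hw)
      rw [e] at h1
      rw [mem_map, ← h1, mem_map]
      filter_upwards [hs', hO.mem_nhds hw] with y hy hyΩ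
      rw [mem_preimage, mem_preimage, hleft y hyΩ]
      exact hy
    refine (HasDerivAt.of_local_left_inverse hc (hs.hasDerivAt)
      (H.deriv_ne_zero _ hw) ?_).differentiableAt
    filter_upwards [isOpen_ball.mem_nhds hz] with y hy
    exact (hf y hy).2
  have hm : MapsTo f (ball 0 1) Ω := fun z hz => (hf z hz).1
  exact ⟨f, hm, H.mapsTo, hleft, fun z hz => (hf z hz).2, hd, fun w hw => H.differentiableAt hw,
    fun z hz => weak_koebe hO hne hSC hm hd hz, fun w hw => H.norm_deriv_mul_infDist_le hO hne hw⟩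

theorem exists_isRiemannPair {Ω : Set ℂ} (hO : IsOpen Ω) (hc : IsConnected Ω)
    (hb : Bornology.IsBounded Ω) (hSC : SimplyConnectedSpace ↥Ω) : ∃ f g, IsRiemannPair Ω f g := by
  obtain ⟨g, H, hg⟩ := exists_isDiskEmbedding_image_eq hO hc hb hSC
  obtain ⟨f, hf⟩ := H.isRiemannPair hO hb.compl_nonempty hSC hg
  exact ⟨f, g, hf⟩

theorem qhLength_nonneg {Ω : Set ℂ} {γ : ℝ → ℂ} {a b : ℝ} (hab : a ≤ b) : 0 ≤ qhLength Ω γ a b :=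
  intervalIntegral.integral_nonneg hab fun _ _ => div_nonneg (norm_nonneg _) infDist_nonneg

theorem qhDist_nonneg {Ω : Set ℂ} (x y : ℂ) : 0 ≤ qhDist Ω x y := by
  refine Real.sInf_nonneg ?_
  rintro _ ⟨γ, a, b, h, rfl⟩
  exact qhLength_nonneg h.1

theorem qhDist_le_qhLength {Ω : Set ℂ} {x y : ℂ} {γ : ℝ → ℂ} {a b : ℝ}
    (h : qhAdmissible Ω x y γ a b) : qhDist Ω x y ≤ qhLength Ω γ a b := by
  refine csInf_le ⟨0, ?_⟩ ⟨γ, a, b, h, rfl⟩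
  rintro _ ⟨γ, a, b, h, rfl⟩
  exact qhLength_nonneg h.1

theorem qhAdmissible.mono {Ω : Set ℂ} {x y : ℂ} {γ : ℝ → ℂ} {a b c d : ℝ}
    (h : qhAdmissible Ω x y γ a b) (hac : a ≤ c) (hcd : c ≤ d) (hdb : d ≤ b) :
    qhAdmissible Ω (γ c) (γ d) γ c d := by
  obtain ⟨-, -, -, h1, K, hK⟩ := h
  exact ⟨hcd, rfl, rfl, fun t ht => h1 t (Icc_subset_Icc hac hdb ht), K,
    hK.mono (Icc_subset_Icc hac hdb)⟩

theorem qhAdmissible.exists_infDist_ge {Ω : Set ℂ} (hO : IsOpen Ω) (hne : Ωᶜ.Nonempty) {x y : ℂ}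
    {γ : ℝ → ℂ} {a b : ℝ} (h : qhAdmissible Ω x y γ a b) :
    ∃ d > 0, ∀ t ∈ Icc a b, d ≤ infDist (γ t) Ωᶜ := by
  obtain ⟨hab, -, -, h1, K, hK⟩ := h
  obtain ⟨t₀, ht₀, hmin⟩ := isCompact_Icc.exists_isMinOn (nonempty_Icc.2 hab)
    ((continuous_infDist_pt Ωᶜ).comp_continuousOn hK.continuousOn)
  exact ⟨_, infDist_compl_pos hO hne (h1 t₀ ht₀), fun t ht => hmin ht⟩

theorem qhAdmissible.intervalIntegrable {Ω : Set ℂ} (hO : IsOpen Ω) (hne : Ωᶜ.Nonempty) {x y : ℂ}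
    {γ : ℝ → ℂ} {a b : ℝ} (h : qhAdmissible Ω x y γ a b) :
    IntervalIntegrable (fun t => ‖deriv γ t‖ / infDist (γ t) Ωᶜ) volume a b := by
  obtain ⟨d, hd, hdb⟩ := h.exists_infDist_ge hO hne
  obtain ⟨hab, -, -, h1, K, hK⟩ := h
  rw [intervalIntegrable_iff_integrableOn_Ioo_of_le hab]
  refine IntegrableOn.of_bound (by simp) ?_ (K / d) ?_
  · have hm : AEStronglyMeasurable (fun t => infDist (γ t) Ωᶜ) (volume.restrict (Ioo a b)) :=
      (((continuous_infDist_pt Ωᶜ).comp_continuousOn hK.continuousOn).mono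
        Ioo_subset_Icc_self).aestronglyMeasurable measurableSet_Ioo
    have hm' : AEStronglyMeasurable (fun t => ‖deriv γ t‖) (volume.restrict (Ioo a b)) :=
      (measurable_deriv γ).norm.aestronglyMeasurable
    exact hm'.div₀ hm
  · refine (ae_restrict_iff' measurableSet_Ioo).2 (Eventually.of_forall fun t ht => ?_)
    have h2 : ‖deriv γ t‖ ≤ K := norm_deriv_le_of_lipschitzOn (Icc_mem_nhds ht.1 ht.2) hK
    have h3 := hdb t (Ioo_subset_Icc_self ht)
    rw [norm_div, norm_norm, Real.norm_of_nonneg infDist_nonneg]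
    gcongr

theorem qhDist_symm (Ω : Set ℂ) (x y : ℂ) : qhDist Ω x y = qhDist Ω y x := by
  have key : ∀ x y : ℂ, { L : ℝ | ∃ γ a b, qhAdmissible Ω x y γ a b ∧ L = qhLength Ω γ a b } ⊆
      { L : ℝ | ∃ γ a b, qhAdmissible Ω y x γ a b ∧ L = qhLength Ω γ a b } := by
    rintro x y _ ⟨γ, a, b, ⟨hab, hx, hy, hΩ, K, hK⟩, rfl⟩
    refine ⟨fun t => γ (-t), -b, -a, ⟨by linarith, by simpa using hy, by simpa using hx,
      fun t ht => hΩ _ ⟨by linarith [ht.2], by linarith [ht.1]⟩, K, fun s hs t ht => ?_⟩, ?_⟩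
    · have := hK (x := -s) ⟨by linarith [hs.2], by linarith [hs.1]⟩ (y := -t)
        ⟨by linarith [ht.2], by linarith [ht.1]⟩
      simpa using this
    · rw [qhLength, qhLength]
      have h := intervalIntegral.integral_comp_neg (a := -b) (b := -a)
        (fun t => ‖deriv γ t‖ / infDist (γ t) Ωᶜ)
      rw [neg_neg, neg_neg] at h
      rw [← h]
      congr 1
      ext t
      rw [deriv_comp_neg, norm_neg]
  rw [qhDist, qhDist, Subset.antisymm (key x y) (key y x)]

theorem exists_qhAdmissible_concat {Ω : Set ℂ} (hO : IsOpen Ω) (hne : Ωᶜ.Nonempty) {x y z : ℂ}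
    {γ₁ γ₂ : ℝ → ℂ} {a b c d : ℝ} (h₁ : qhAdmissible Ω x y γ₁ a b)
    (h₂ : qhAdmissible Ω y z γ₂ c d) : ∃ γ, qhAdmissible Ω x z γ a (b + (d - c)) ∧
      qhLength Ω γ a (b + (d - c)) = qhLength Ω γ₁ a b + qhLength Ω γ₂ c d := by
  have i₁ := h₁.intervalIntegrable hO hne
  have i₂ := h₂.intervalIntegrable hO hne
  obtain ⟨hab, hx, hy, hΩ, K, hK⟩ := h₁
  obtain ⟨hcd, hy', hz, hΩ', K', hK'⟩ := h₂
  set γ : ℝ → ℂ := fun t => if t ≤ b then γ₁ t else γ₂ (t + (c - b)) with hγ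
  have g1 : ∀ t, t ≤ b → γ t = γ₁ t := fun t ht => if_pos ht
  have g2 : ∀ t, b ≤ t → γ t = γ₂ (t + (c - b)) := fun t ht => by
    rcases ht.eq_or_lt with rfl | ht
    · rw [g1 _ le_rfl, hy]; simp [hy']
    · exact if_neg (not_le.2 ht)
  have l1 : LipschitzOnWith (max K K') γ (Icc a b) := fun s hs t ht => by
    rw [g1 s hs.2, g1 t ht.2]
    exact (hK.weaken (le_max_left _ _)) hs ht
  have l2 : LipschitzOnWith (max K K') γ (Icc b (b + (d - c))) := fun s hs t ht => by
    rw [g2 s hs.1, g2 t ht.1]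
    have := (hK'.weaken (le_max_right K K')) (x := s + (c - b))
      ⟨by linarith [hs.1], by linarith [hs.2]⟩ (y := t + (c - b))
      ⟨by linarith [ht.1], by linarith [ht.2]⟩
    simpa using this
  have d1 : ∀ t, t < b → deriv γ t = deriv γ₁ t := fun t ht =>
    Filter.EventuallyEq.deriv_eq (by
      filter_upwards [Iio_mem_nhds ht] with s hs using g1 s (le_of_lt hs))
  have d2 : ∀ t, b < t → deriv γ t = deriv γ₂ (t + (c - b)) := fun t ht => by
    rw [← deriv_comp_add_const]
    exact Filter.EventuallyEq.deriv_eq (by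
      filter_upwards [Ioi_mem_nhds ht] with s hs using g2 s (le_of_lt hs))
  have q1 : EqOn (fun t => ‖deriv γ₁ t‖ / infDist (γ₁ t) Ωᶜ)
      (fun t => ‖deriv γ t‖ / infDist (γ t) Ωᶜ) (Ioo a b) := fun t ht => by
    simp only [d1 t ht.2, g1 t ht.2.le]
  have q2 : EqOn (fun t => ‖deriv γ₂ (t + (c - b))‖ / infDist (γ₂ (t + (c - b))) Ωᶜ)
      (fun t => ‖deriv γ t‖ / infDist (γ t) Ωᶜ) (Ioo b (b + (d - c))) := fun t ht => by
    simp only [d2 t ht.1, g2 t ht.1.le]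
  have hbd : b ≤ b + (d - c) := by linarith
  have i₂' := i₂.comp_add_right (c - b)
  have e1 : c - (c - b) = b := by ring
  have e2 : d - (c - b) = b + (d - c) := by ring
  rw [e1, e2] at i₂'
  have j1 : IntervalIntegrable (fun t => ‖deriv γ t‖ / infDist (γ t) Ωᶜ) volume a b := by
    rw [intervalIntegrable_iff_integrableOn_Ioo_of_le hab] at i₁ ⊢
    exact i₁.congr_fun q1 measurableSet_Ioo
  have j2 : IntervalIntegrable (fun t => ‖deriv γ t‖ / infDist (γ t) Ωᶜ) volume b
      (b + (d - c)) := by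
    rw [intervalIntegrable_iff_integrableOn_Ioo_of_le hbd] at i₂' ⊢
    exact i₂'.congr_fun q2 measurableSet_Ioo
  refine ⟨γ, ⟨by linarith, by rw [g1 a hab, hx], ?_, fun t ht => ?_, max K K',
    LipschitzOnWith.of_dist_le_mul fun s hs t ht => ?_⟩, ?_⟩
  · rw [g2 _ hbd, ← hz]; congr 1; ring
  · rcases le_total t b with h | h
    · rw [g1 t h]; exact hΩ t ⟨ht.1, h⟩
    · rw [g2 t h]; exact hΩ' _ ⟨by linarith, by linarith [ht.2]⟩
  · wlog hst : s ≤ t generalizing s t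
    · rw [dist_comm, dist_comm s t]
      exact this t ht s hs (le_of_not_ge hst)
    rcases le_total t b with h | h
    · exact l1.dist_le_mul s ⟨hs.1, hst.trans h⟩ t ⟨ht.1, h⟩
    rcases le_total b s with h' | h'
    · exact l2.dist_le_mul s ⟨h', hs.2⟩ t ⟨h, ht.2⟩
    have b1 := l1.dist_le_mul s ⟨hs.1, h'⟩ b ⟨hab, le_rfl⟩
    have b2 := l2.dist_le_mul b ⟨le_rfl, hbd⟩ t ⟨h, ht.2⟩
    have : dist s t = dist s b + dist b t := by
      rw [Real.dist_eq, Real.dist_eq, Real.dist_eq, abs_of_nonpos (by linarith),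
        abs_of_nonpos (by linarith), abs_of_nonpos (by linarith)]
      ring
    rw [this, mul_add]
    linarith [dist_triangle (γ s) (γ b) (γ t)]
  · rw [qhLength, ← intervalIntegral.integral_add_adjacent_intervals j1 j2, qhLength, qhLength]
    congr 1
    · rw [intervalIntegral.integral_of_le hab, intervalIntegral.integral_of_le hab,
        integral_Ioc_eq_integral_Ioo, integral_Ioc_eq_integral_Ioo]
      exact (setIntegral_congr_fun measurableSet_Ioo q1).symm
    · have h := intervalIntegral.integral_comp_add_right (a := b) (b := b + (d - c))
        (fun t => ‖deriv γ₂ t‖ / infDist (γ₂ t) Ωᶜ) (c - b)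
      have e3 : b + (c - b) = c := by ring
      have e4 : b + (d - c) + (c - b) = d := by ring
      rw [e3, e4] at h
      rw [← h, intervalIntegral.integral_of_le hbd, intervalIntegral.integral_of_le hbd,
        integral_Ioc_eq_integral_Ioo, integral_Ioc_eq_integral_Ioo]
      exact (setIntegral_congr_fun measurableSet_Ioo q2).symm

theorem qhDist_le_sub {Ω : Set ℂ} {p p' : ℝ → ℂ} {B B' : ℝ → ℝ} {a b M : ℝ}
    (hO : IsOpen Ω) (hne : Ωᶜ.Nonempty) (hab : a ≤ b)
    (hp : ∀ t ∈ Icc a b, HasDerivAt p (p' t) t) (hΩ : ∀ t ∈ Icc a b, p t ∈ Ω)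
    (hB : ∀ t ∈ Icc a b, HasDerivAt B (B' t) t) (hM : ∀ t ∈ Icc a b, B' t ≤ M)
    (hle : ∀ t ∈ Icc a b, ‖p' t‖ ≤ B' t * infDist (p t) Ωᶜ) :
    (∃ γ c d, qhAdmissible Ω (p a) (p b) γ c d) ∧ qhDist Ω (p a) (p b) ≤ B b - B a := by
  have hpc : ContinuousOn p (Icc a b) := fun t ht => (hp t ht).continuousAt.continuousWithinAt
  obtain ⟨R, hR⟩ := (isCompact_Icc.image_of_continuousOn
    ((continuous_infDist_pt Ωᶜ).comp_continuousOn hpc)).bddAbove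
  have hlip : LipschitzOnWith (|M| * |R|).toNNReal p (Icc a b) := by
    refine (convex_Icc a b).lipschitzOnWith_of_nnnorm_hasDerivWithin_le (f' := p')
      (fun t ht => (hp t ht).hasDerivWithinAt) fun t ht => ?_
    rw [← NNReal.coe_le_coe, Real.coe_toNNReal _ (by positivity), coe_nnnorm]
    have h1 : infDist (p t) Ωᶜ ≤ R := hR ⟨t, ht, rfl⟩
    calc ‖p' t‖ ≤ B' t * infDist (p t) Ωᶜ := hle t ht
      _ ≤ |M| * infDist (p t) Ωᶜ :=
          mul_le_mul_of_nonneg_right ((hM t ht).trans (le_abs_self M)) infDist_nonneg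
      _ ≤ |M| * |R| := mul_le_mul_of_nonneg_left (h1.trans (le_abs_self R)) (abs_nonneg M)
  have hadm : qhAdmissible Ω (p a) (p b) p a b := ⟨hab, rfl, rfl, hΩ, _, hlip⟩
  refine ⟨⟨p, a, b, hadm⟩, (qhDist_le_qhLength hadm).trans ?_⟩
  refine intervalIntegral.integral_le_sub_of_hasDeriv_right_of_le (g' := B') hab
    (fun t ht => (hB t ht).continuousAt.continuousWithinAt)
    (fun t ht => (hB t (Ioo_subset_Icc_self ht)).hasDerivWithinAt) ?_ fun t ht => ?_
  · exact (intervalIntegrable_iff_integrableOn_Icc_of_le hab).1 (hadm.intervalIntegrable hO hne)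
  · have ht' := Ioo_subset_Icc_self ht
    rw [(hp t ht').deriv, div_le_iff₀ (infDist_compl_pos hO hne (hΩ t ht'))]
    exact hle t ht'

theorem qhDist_le_of_segment {Ω : Set ℂ} (hO : IsOpen Ω) (hne : Ωᶜ.Nonempty) {x y : ℂ} {d : ℝ}
    (hd : 0 < d) (h : ∀ t ∈ Icc (0 : ℝ) 1, d ≤ infDist (x + t * (y - x)) Ωᶜ) :
    (∃ γ a b, qhAdmissible Ω x y γ a b) ∧ qhDist Ω x y ≤ ‖y - x‖ / d := by
  have hΩ : ∀ t ∈ Icc (0 : ℝ) 1, x + t * (y - x) ∈ Ω := fun t ht => by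
    by_contra hc
    have := h t ht
    rw [infDist_zero_of_mem hc] at this
    linarith
  have key := qhDist_le_sub (p := fun t : ℝ => x + t * (y - x)) (p' := fun _ => y - x)
    (B := fun t => t * (‖y - x‖ / d)) (B' := fun _ => ‖y - x‖ / d) (M := ‖y - x‖ / d) hO hne
    zero_le_one (fun t _ => ?_) hΩ (fun t _ => ?_) (fun _ _ => le_rfl) (fun t ht => ?_)
  · simpa using key
  · simpa using ((Complex.ofRealCLM.hasDerivAt (x := t)).mul_const (y - x)).const_add x
  · simpa using (hasDerivAt_id t).mul_const (‖y - x‖ / d)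
  · calc ‖y - x‖ = ‖y - x‖ / d * d := by field_simp
      _ ≤ _ := mul_le_mul_of_nonneg_left (h t ht) (by positivity)

theorem qhDist_self {Ω : Set ℂ} (hO : IsOpen Ω) (hne : Ωᶜ.Nonempty) {x : ℂ} (hx : x ∈ Ω) :
    qhDist Ω x x = 0 := by
  refine le_antisymm ?_ (qhDist_nonneg x x)
  simpa using (qhDist_le_of_segment hO hne (x := x) (y := x) (infDist_compl_pos hO hne hx)
    (by simp)).2

theorem norm_segment_le {z w : ℂ} {r t : ℝ} (hz : ‖z‖ ≤ r) (hw : ‖w‖ ≤ r)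
    (ht : t ∈ Icc (0 : ℝ) 1) : ‖z + t * (w - z)‖ ≤ r := by
  have := (convex_closedBall (0 : ℂ) r).add_smul_sub_mem (x := z) (y := w) (by simpa using hz)
    (by simpa using hw) ht
  simpa using this

theorem IsRiemannPair.qhDist_le_of_norm_le {Ω : Set ℂ} {f g : ℂ → ℂ} (h : IsRiemannPair Ω f g)
    (hO : IsOpen Ω) (hne : Ωᶜ.Nonempty) {z w : ℂ} {r : ℝ} (hz : ‖z‖ ≤ r) (hw : ‖w‖ ≤ r)
    (hr : r < 1) : (∃ γ a b, qhAdmissible Ω (f z) (f w) γ a b) ∧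
      qhDist Ω (f z) (f w) ≤ 40 * ‖w - z‖ / (1 - r) := by
  have hr' : 0 < 1 - r := by linarith
  have hn := fun t (ht : t ∈ Icc (0 : ℝ) 1) => norm_segment_le hz hw ht
  have hb : ∀ t ∈ Icc (0 : ℝ) 1, z + t * (w - z) ∈ ball (0 : ℂ) 1 := fun t ht => by
    rw [mem_ball_zero_iff]; exact (hn t ht).trans_lt hr
  have key := qhDist_le_sub (p := fun t : ℝ => f (z + t * (w - z)))
    (p' := fun t => deriv f (z + t * (w - z)) * (w - z))
    (B := fun t => t * (40 * ‖w - z‖ / (1 - r))) (B' := fun _ => 40 * ‖w - z‖ / (1 - r))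
    (M := 40 * ‖w - z‖ / (1 - r)) hO hne
    zero_le_one (fun t ht => ?_) (fun t ht => h.mapsTo (hb t ht)) (fun t _ => ?_)
    (fun _ _ => le_rfl) (fun t ht => ?_)
  · simpa using key
  · have h1 : HasDerivAt (fun t : ℝ => z + t * (w - z)) (w - z) t := by
      simpa using ((Complex.ofRealCLM.hasDerivAt (x := t)).mul_const (w - z)).const_add z
    exact (h.differentiableAt _ (hb t ht)).hasDerivAt.comp t h1
  · simpa using (hasDerivAt_id t).mul_const (40 * ‖w - z‖ / (1 - r))
  · have h1 := h.koebe _ (hb t ht)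
    have h2 : (1 - r) * ‖deriv f (z + t * (w - z))‖ ≤ 40 * infDist (f (z + t * (w - z))) Ωᶜ :=
      (mul_le_mul_of_nonneg_right (by linarith [hn t ht]) (norm_nonneg _)).trans h1
    rw [norm_mul, div_mul_eq_mul_div, le_div_iff₀ hr']
    nlinarith [norm_nonneg (w - z)]

theorem IsRiemannPair.exists_qhAdmissible {Ω : Set ℂ} {f g : ℂ → ℂ} (h : IsRiemannPair Ω f g)
    (hO : IsOpen Ω) (hne : Ωᶜ.Nonempty) {x y : ℂ} (hx : x ∈ Ω) (hy : y ∈ Ω) :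
    ∃ γ a b, qhAdmissible Ω x y γ a b := by
  have := (h.qhDist_le_of_norm_le hO hne (le_max_left ‖g x‖ ‖g y‖) (le_max_right ‖g x‖ ‖g y‖)
    (max_lt (by simpa using h.mapsTo_inv hx) (by simpa using h.mapsTo_inv hy))).1
  rwa [h.right_inv x hx, h.right_inv y hy] at this

theorem IsRiemannPair.exists_qhLength_lt {Ω : Set ℂ} {f g : ℂ → ℂ} (h : IsRiemannPair Ω f g)
    (hO : IsOpen Ω) (hne : Ωᶜ.Nonempty) {x y : ℂ} (hx : x ∈ Ω) (hy : y ∈ Ω) {c : ℝ}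
    (hc : qhDist Ω x y < c) : ∃ γ a b, qhAdmissible Ω x y γ a b ∧ qhLength Ω γ a b < c := by
  obtain ⟨γ, a, b, hγ⟩ := h.exists_qhAdmissible hO hne hx hy
  obtain ⟨_, ⟨γ, a, b, hγ, rfl⟩, hlt⟩ := exists_lt_of_csInf_lt
    (s := { L : ℝ | ∃ γ a b, qhAdmissible Ω x y γ a b ∧ L = qhLength Ω γ a b })
    ⟨_, γ, a, b, hγ, rfl⟩ hc
  exact ⟨γ, a, b, hγ, hlt⟩

theorem IsRiemannPair.qhDist_triangle {Ω : Set ℂ} {f g : ℂ → ℂ} (h : IsRiemannPair Ω f g)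
    (hO : IsOpen Ω) (hne : Ωᶜ.Nonempty) {x y z : ℂ} (hx : x ∈ Ω) (hy : y ∈ Ω) (hz : z ∈ Ω) :
    qhDist Ω x z ≤ qhDist Ω x y + qhDist Ω y z := by
  refine le_of_forall_pos_le_add fun ε hε => ?_
  obtain ⟨γ₁, a, b, h₁, l₁⟩ := h.exists_qhLength_lt hO hne hx hy
    (lt_add_of_pos_right _ (half_pos hε))
  obtain ⟨γ₂, c, d, h₂, l₂⟩ := h.exists_qhLength_lt hO hne hy hz
    (lt_add_of_pos_right _ (half_pos hε))
  obtain ⟨γ, h₃, l₃⟩ := exists_qhAdmissible_concat hO hne h₁ h₂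
  linarith [qhDist_le_qhLength h₃]

theorem IsRiemannPair.qhDist_radial_le {Ω : Set ℂ} {f g : ℂ → ℂ} (h : IsRiemannPair Ω f g)
    (hO : IsOpen Ω) (hne : Ωᶜ.Nonempty) {z : ℂ} {s e : ℝ} (hz : ‖z‖ < 1) (hs : s ∈ Icc (0 : ℝ) 1)
    (hse : 1 - s ≤ e) :
    qhDist Ω (f (s * z)) (f z) ≤ 40 * Real.log (1 + e / (1 - ‖z‖)) := by
  have hpos : ∀ t ∈ Icc s 1, 1 - ‖z‖ ≤ 1 - t * ‖z‖ := fun t ht => by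
    nlinarith [norm_nonneg z, ht.2]
  have hn : ∀ t ∈ Icc s 1, ‖(t : ℂ) * z‖ = t * ‖z‖ := fun t ht => by
    rw [norm_mul, Complex.norm_real, Real.norm_of_nonneg (hs.1.trans ht.1)]
  have hb : ∀ t ∈ Icc s 1, (t : ℂ) * z ∈ ball (0 : ℂ) 1 := fun t ht => by
    rw [mem_ball_zero_iff, hn t ht]; linarith [hpos t ht]
  have key := (qhDist_le_sub (p := fun t : ℝ => f (t * z)) (p' := fun t => deriv f (t * z) * z)
    (B := fun t => -40 * Real.log (1 - t * ‖z‖)) (B' := fun t => 40 * ‖z‖ / (1 - t * ‖z‖))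
    (M := 40 * ‖z‖ / (1 - ‖z‖)) hO hne hs.2 (fun t ht => ?_) (fun t ht => h.mapsTo (hb t ht))
    (fun t ht => ?_) (fun t ht => ?_) (fun t ht => ?_)).2
  · simp only [Complex.ofReal_one, one_mul] at key
    refine key.trans ?_
    have h0 : 0 < 1 - ‖z‖ := by linarith
    have h1 := hpos s ⟨le_rfl, hs.2⟩
    have h2 : (1 - s * ‖z‖) ≤ (1 + e / (1 - ‖z‖)) * (1 - ‖z‖) := by
      rw [add_mul, div_mul_cancel₀ _ h0.ne']
      nlinarith [norm_nonneg z, hs.2]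
    have h3 := Real.log_le_log (by linarith) h2
    have h4 : 0 < 1 + e / (1 - ‖z‖) := by
      have : 0 ≤ e := by linarith [hs.2]
      positivity
    rw [Real.log_mul h4.ne' h0.ne'] at h3
    linarith
  · have h1 : HasDerivAt (fun t : ℝ => t * z) z t := by
      simpa using ((Complex.ofRealCLM.hasDerivAt (x := t)).mul_const z)
    exact (h.differentiableAt _ (hb t ht)).hasDerivAt.comp t h1
  · have h0 : 1 - t * ‖z‖ ≠ 0 := by linarith [hpos t ht]
    have h1 : HasDerivAt (fun t : ℝ => 1 - t * ‖z‖) (-‖z‖) t := by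
      simpa using ((hasDerivAt_id t).mul_const ‖z‖).const_sub 1
    exact ((h1.log h0).const_mul (-40)).congr_deriv (by ring)
  · have := hpos t ht
    gcongr
  · have h1 := h.koebe _ (hb t ht)
    rw [hn t ht] at h1
    rw [norm_mul, div_mul_eq_mul_div, le_div_iff₀ (by linarith [hpos t ht])]
    nlinarith [norm_nonneg z]

theorem IsRiemannPair.qhDist_le {Ω : Set ℂ} {f g : ℂ → ℂ} (h : IsRiemannPair Ω f g)
    (hO : IsOpen Ω) (hne : Ωᶜ.Nonempty) {z w : ℂ} (hz : ‖z‖ < 1) (hw : ‖w‖ < 1) :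
    qhDist Ω (f z) (f w) ≤ 40 * (Real.log (1 + ‖z - w‖ / (1 - ‖z‖)) +
      Real.log (1 + ‖z - w‖ / (1 - ‖w‖)) + 1) := by
  set e := ‖z - w‖ with he
  set s := 1 - min 1 e with hs
  have he0 : 0 ≤ e := norm_nonneg _
  have hs1 : s ∈ Icc (0 : ℝ) 1 := ⟨by linarith [min_le_left 1 e],
    by linarith [le_min zero_le_one he0]⟩
  have hse : 1 - s ≤ e := by linarith [min_le_right 1 e]
  have hb : ∀ v : ℂ, ‖v‖ < 1 → ‖(s : ℂ) * v‖ ≤ s ∧ (s : ℂ) * v ∈ ball (0 : ℂ) 1 := fun v hv => by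
    have : ‖(s : ℂ) * v‖ = s * ‖v‖ := by
      rw [norm_mul, Complex.norm_real, Real.norm_of_nonneg hs1.1]
    rw [mem_ball_zero_iff, this]
    constructor <;> nlinarith [hs1.1, hs1.2, norm_nonneg v]
  have hm : ∀ v : ℂ, ‖v‖ < 1 → f v ∈ Ω := fun v hv => h.mapsTo (by simpa using hv)
  have h1 := h.qhDist_radial_le hO hne hz hs1 hse
  have h2 := h.qhDist_radial_le hO hne hw hs1 hse
  rw [qhDist_symm] at h1
  have h3 : qhDist Ω (f (s * z)) (f (s * w)) ≤ 40 := by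
    rcases he0.eq_or_lt with h0 | h0
    · have : z = w := by rw [← sub_eq_zero, ← norm_eq_zero]; exact h0.symm
      rw [this, qhDist_self hO hne (h.mapsTo (hb w hw).2)]
      norm_num
    have hs2 : s < 1 := by linarith [lt_min zero_lt_one h0]
    refine (h.qhDist_le_of_norm_le hO hne (hb z hz).1 (hb w hw).1 hs2).2.trans ?_
    rw [div_le_iff₀ (by linarith), ← mul_sub, norm_mul, Complex.norm_real,
      Real.norm_of_nonneg hs1.1, norm_sub_rev, ← he]
    rcases le_total 1 e with h4 | h4
    · have : s = 0 := by rw [hs, min_eq_left h4]; ring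
      rw [this]; norm_num
    · have : s = 1 - e := by rw [hs, min_eq_right h4]
      rw [this]; nlinarith
  have t1 := h.qhDist_triangle hO hne (hm z hz) (h.mapsTo (hb z hz).2) (hm w hw)
  have t2 := h.qhDist_triangle hO hne (h.mapsTo (hb z hz).2) (h.mapsTo (hb w hw).2) (hm w hw)
  linarith

theorem locallyLipschitzOn_of_differentiableOn {Ω : Set ℂ} {G : ℂ → ℂ} (hO : IsOpen Ω)
    (hG : DifferentiableOn ℂ G Ω) : LocallyLipschitzOn Ω G := fun x hx => by
  obtain ⟨K, s, hs, hK⟩ := ((hG.analyticAt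
    (hO.mem_nhds hx)).hasStrictDerivAt).hasStrictFDerivAt.exists_lipschitzOnWith
  exact ⟨K, s, mem_nhdsWithin_of_mem_nhds hs, hK⟩

theorem norm_deriv_le_norm_of_norm_sub_le {v : ℝ → ℝ} {H : ℝ → ℂ} {H' : ℂ} {t : ℝ}
    (hH : HasDerivAt H H' t) (hv : ∀ᶠ s in 𝓝 t, ‖v s - v t‖ ≤ ‖H s - H t‖) :
    ‖deriv v t‖ ≤ ‖H'‖ := by
  refine le_of_forall_pos_le_add fun ε hε => norm_deriv_le_of_lip' (by positivity) ?_
  filter_upwards [hv, (hasDerivAt_iff_isLittleO.1 hH).def hε] with s h1 h2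
  have h3 : ‖H s - H t‖ ≤ ‖H s - H t - (s - t) • H'‖ + ‖(s - t) • H'‖ := by
    simpa using norm_add_le (H s - H t - (s - t) • H') ((s - t) • H')
  rw [norm_smul] at h3
  nlinarith

theorem abs_log_sub_log_le {R a b : ℝ} (hR : 0 < R) (ha : R ≤ a) (hb : R ≤ b) :
    |Real.log a - Real.log b| ≤ R⁻¹ * |a - b| := by
  have key : ∀ a b, R ≤ a → R ≤ b → Real.log a - Real.log b ≤ R⁻¹ * |a - b| := fun a b ha hb => by
    have ha0 := hR.trans_le ha
    have hb0 := hR.trans_le hb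
    rw [← Real.log_div ha0.ne' hb0.ne']
    calc Real.log (a / b) ≤ a / b - 1 := Real.log_le_sub_one_of_pos (by positivity)
      _ = b⁻¹ * (a - b) := by field_simp
      _ ≤ b⁻¹ * |a - b| := by gcongr; exact le_abs_self _
      _ ≤ R⁻¹ * |a - b| := by gcongr
  rw [abs_le]
  have := key b a hb ha
  rw [abs_sub_comm] at this
  exact ⟨by linarith, key a b ha hb⟩

theorem log_le_mul_qhLength {Ω : Set ℂ} {G : ℂ → ℂ} {ρ : ℂ → ℝ} {C : ℝ} (hO : IsOpen Ω)
    (hne : Ωᶜ.Nonempty) (hG : DifferentiableOn ℂ G Ω) (hρ : ∀ w ∈ Ω, 0 < ρ w) (hC : 0 ≤ C)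
    (hGρ : ∀ w ∈ Ω, ‖deriv G w‖ * infDist w Ωᶜ ≤ C * ρ w)
    (hρL : ∀ x ∈ Ω, ∀ w ∈ Ω, ρ w ≤ ρ x + ‖G w - G x‖) {x y : ℂ} {γ : ℝ → ℂ} {a b : ℝ}
    (h : qhAdmissible Ω x y γ a b) :
    Real.log (1 + ‖G y - G x‖ / ρ x) ≤ C * qhLength Ω γ a b := by
  have h_int := h.intervalIntegrable hO hne
  obtain ⟨hab, hx, hy, hΩ, K, hK⟩ := h
  have hxΩ : x ∈ Ω := hx ▸ hΩ a ⟨le_rfl, hab⟩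
  set R := ρ x with hRdef
  have hR : 0 < R := hρ x hxΩ
  obtain ⟨K', hK'⟩ := LocallyLipschitzOn.exists_lipschitzOnWith_of_compact
    (isCompact_Icc.image_of_continuousOn hK.continuousOn)
    ((locallyLipschitzOn_of_differentiableOn hO hG).mono (image_subset_iff.2 hΩ))
  have hL : LipschitzOnWith (K' * K) (G ∘ γ) (Icc a b) :=
    hK'.comp hK (mapsTo_image γ _)
  set v : ℝ → ℝ := fun t => R + ‖G (γ t) - G x‖ with hv
  have hvR : ∀ t, R ≤ v t := fun t => by simp [hv]
  have hvs : ∀ s t, |v s - v t| ≤ ‖(G ∘ γ) s - (G ∘ γ) t‖ := fun s t => by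
    have := abs_norm_sub_norm_le (G (γ s) - G x) (G (γ t) - G x)
    simpa [hv] using this
  set u : ℝ → ℝ := fun t => Real.log (v t) with hu
  have huL : LipschitzOnWith (R⁻¹.toNNReal * (K' * K)) u (Icc a b) := by
    refine LipschitzOnWith.of_dist_le_mul fun s hs t ht => ?_
    rw [Real.dist_eq]
    refine (abs_log_sub_log_le hR (hvR s) (hvR t)).trans ?_
    rw [NNReal.coe_mul, mul_assoc, Real.coe_toNNReal _ (by positivity)]
    refine mul_le_mul_of_nonneg_left ?_ (by positivity)
    refine (hvs s t).trans ?_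
    rw [← dist_eq_norm]
    exact hL.dist_le_mul s hs t ht
  rw [← uIcc_of_le hab] at huL
  have hAC := huL.absolutelyContinuousOnInterval
  have e1 : u a = Real.log R := by simp [hu, hv, hx]
  have e2 : u b = Real.log (R + ‖G y - G x‖) := by simp [hu, hv, hy]
  have e3 : Real.log (1 + ‖G y - G x‖ / R) = u b - u a := by
    rw [e1, e2, ← Real.log_div (by positivity) hR.ne']
    congr 1
    field_simp
  rw [e3, ← hAC.integral_deriv_eq_sub, qhLength, ← intervalIntegral.integral_const_mul]
  refine intervalIntegral.integral_mono_ae_restrict hab hAC.intervalIntegrable_deriv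
    (h_int.const_mul C) ?_
  rw [Measure.restrict_congr_set (Ioo_ae_eq_Icc (a := a) (b := b)).symm, EventuallyLE,
    ae_restrict_iff' measurableSet_Ioo]
  filter_upwards [hK.ae_differentiableWithinAt_of_mem_real] with t ht hto
  have hγ := ((ht (Ioo_subset_Icc_self hto)).differentiableAt (Icc_mem_nhds hto.1 hto.2)).hasDerivAt
  have htΩ := hΩ t (Ioo_subset_Icc_self hto)
  have hδ := infDist_compl_pos hO hne htΩ
  have hGγ : HasDerivAt (G ∘ γ) (deriv G (γ t) * deriv γ t) t :=
    ((hG.differentiableAt (hO.mem_nhds htΩ)).hasDerivAt).comp t hγ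
  have hv0 := hR.trans_le (hvR t)
  by_cases hd : DifferentiableAt ℝ u t
  · have h1 := norm_deriv_le_norm_of_norm_sub_le (v := v) hGγ
      (Eventually.of_forall fun s => hvs s t)
    have h2 : deriv v t = v t * deriv u t := by
      have h3 : v = fun s => Real.exp (u s) := by
        ext s; exact (Real.exp_log (hR.trans_le (hvR s))).symm
      have := hd.hasDerivAt.exp.deriv
      rw [← h3] at this
      rw [this, hu, Real.exp_log hv0]
    rw [h2, norm_mul, Real.norm_of_nonneg hv0.le, norm_mul] at h1
    have h4 : v t * ‖deriv u t‖ * infDist (γ t) Ωᶜ ≤ v t * (C * ‖deriv γ t‖) := by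
      calc v t * ‖deriv u t‖ * infDist (γ t) Ωᶜ
          ≤ ‖deriv G (γ t)‖ * ‖deriv γ t‖ * infDist (γ t) Ωᶜ := by gcongr
        _ = ‖deriv G (γ t)‖ * infDist (γ t) Ωᶜ * ‖deriv γ t‖ := by ring
        _ ≤ C * v t * ‖deriv γ t‖ := mul_le_mul_of_nonneg_right
          ((hGρ _ htΩ).trans (mul_le_mul_of_nonneg_left (hρL x hxΩ _ htΩ) hC)) (norm_nonneg _)
        _ = _ := by ring
    rw [mul_assoc] at h4
    have h5 := le_of_mul_le_mul_left h4 hv0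
    show deriv u t ≤ C * (‖deriv γ t‖ / infDist (γ t) Ωᶜ)
    rw [← mul_div_assoc, le_div_iff₀ hδ]
    exact (mul_le_mul_of_nonneg_right (Real.le_norm_self _) hδ.le).trans h5
  · rw [deriv_zero_of_not_differentiableAt hd]
    exact mul_nonneg hC (div_nonneg (norm_nonneg _) hδ.le)

theorem log_infDist_le_qhLength {Ω : Set ℂ} (hO : IsOpen Ω) (hne : Ωᶜ.Nonempty) {x y : ℂ}
    {γ : ℝ → ℂ} {a b : ℝ} (h : qhAdmissible Ω x y γ a b) :
    Real.log (1 + ‖y - x‖ / infDist x Ωᶜ) ≤ qhLength Ω γ a b := by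
  have := log_le_mul_qhLength (G := id) (ρ := fun w => infDist w Ωᶜ) (C := 1) hO hne
    differentiableOn_id (fun w hw => infDist_compl_pos hO hne hw) zero_le_one
    (fun w _ => by simp) (fun x _ w _ => by
      have := infDist_le_infDist_add_dist (s := Ωᶜ) (x := w) (y := x)
      simpa [dist_eq_norm] using this) h
  simpa using this

theorem IsRiemannPair.norm_sub_le_qhLength {Ω : Set ℂ} {f g : ℂ → ℂ} (hR : IsRiemannPair Ω f g)
    (hO : IsOpen Ω) (hne : Ωᶜ.Nonempty) {x y : ℂ} {γ : ℝ → ℂ} {a b : ℝ}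
    (h : qhAdmissible Ω x y γ a b) :
    Real.log (1 + ‖g y - g x‖ / (1 - ‖g x‖)) ≤ 2 * qhLength Ω γ a b :=
  log_le_mul_qhLength (G := g) (ρ := fun w => 1 - ‖g w‖) (C := 2) hO hne
    (fun w hw => (hR.differentiableAt_inv w hw).differentiableWithinAt)
    (fun w hw => by have := hR.mapsTo_inv hw; simp at this; linarith) zero_le_two
    hR.schwarz (fun x _ w _ => by
      have := norm_sub_norm_le (g x) (g w)
      rw [norm_sub_rev] at this
      linarith) h

theorem IsRiemannPair.le_qhDist {Ω : Set ℂ} {f g : ℂ → ℂ} (hR : IsRiemannPair Ω f g)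
    (hO : IsOpen Ω) (hne : Ωᶜ.Nonempty) {x y : ℂ} (hx : x ∈ Ω) (hy : y ∈ Ω) {c : ℝ}
    (h : ∀ γ a b, qhAdmissible Ω x y γ a b → c ≤ qhLength Ω γ a b) : c ≤ qhDist Ω x y := by
  obtain ⟨γ, a, b, hγ⟩ := hR.exists_qhAdmissible hO hne hx hy
  refine le_csInf ⟨_, γ, a, b, hγ, rfl⟩ ?_
  rintro _ ⟨γ, a, b, hγ, rfl⟩
  exact h γ a b hγ

theorem IsRiemannPair.norm_sub_le {Ω : Set ℂ} {f g : ℂ → ℂ} (hR : IsRiemannPair Ω f g)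
    (hO : IsOpen Ω) (hne : Ωᶜ.Nonempty) {x y : ℂ} (hx : x ∈ Ω) (hy : y ∈ Ω) :
    ‖g x - g y‖ ≤ (1 - ‖g x‖) * (Real.exp (2 * qhDist Ω x y) - 1) := by
  have h1 : Real.log (1 + ‖g y - g x‖ / (1 - ‖g x‖)) / 2 ≤ qhDist Ω x y :=
    hR.le_qhDist hO hne hx hy fun γ a b hγ => by linarith [hR.norm_sub_le_qhLength hO hne hγ]
  have h0 : 0 < 1 - ‖g x‖ := by have := hR.mapsTo_inv hx; simp at this; linarith
  have h2 : Real.log (1 + ‖g y - g x‖ / (1 - ‖g x‖)) ≤ 2 * qhDist Ω x y := by linarith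
  rw [Real.log_le_iff_le_exp (by positivity)] at h2
  rw [norm_sub_rev, mul_comm, ← div_le_iff₀ h0]
  linarith

theorem IsRiemannPair.norm_sub_le_infDist {Ω : Set ℂ} {f g : ℂ → ℂ} (hR : IsRiemannPair Ω f g)
    (hO : IsOpen Ω) (hne : Ωᶜ.Nonempty) {x y : ℂ} (hx : x ∈ Ω) (hy : y ∈ Ω) :
    ‖x - y‖ ≤ infDist x Ωᶜ * (Real.exp (qhDist Ω x y) - 1) := by
  have h1 : Real.log (1 + ‖y - x‖ / infDist x Ωᶜ) ≤ qhDist Ω x y :=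
    hR.le_qhDist hO hne hx hy fun γ a b hγ => log_infDist_le_qhLength hO hne hγ
  have h0 := infDist_compl_pos hO hne hx
  rw [Real.log_le_iff_le_exp (by positivity)] at h1
  rw [norm_sub_rev, mul_comm, ← div_le_iff₀ h0]
  linarith

theorem qhDist_le_of_norm_sub_le {Ω : Set ℂ} (hO : IsOpen Ω) (hne : Ωᶜ.Nonempty) {x y : ℂ}
    (hx : x ∈ Ω) (hy : ‖y - x‖ ≤ infDist x Ωᶜ / 2) :
    qhDist Ω x y ≤ ‖y - x‖ / (infDist x Ωᶜ / 2) := by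
  refine (qhDist_le_of_segment hO hne (half_pos (infDist_compl_pos hO hne hx)) fun t ht => ?_).2
  have h1 := infDist_le_infDist_add_dist (s := Ωᶜ) (x := x) (y := x + t * (y - x))
  have h2 : dist x (x + t * (y - x)) ≤ ‖y - x‖ := by
    rw [dist_eq_norm, sub_add_cancel_left, norm_neg, norm_mul, Complex.norm_real,
      Real.norm_of_nonneg ht.1]
    exact mul_le_of_le_one_left (norm_nonneg _) ht.2
  linarith

theorem tendsto_qhDist_zero {Ω : Set ℂ} (hO : IsOpen Ω) (hne : Ωᶜ.Nonempty) {x : ℂ}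
    (hx : x ∈ Ω) : Tendsto (fun y => qhDist Ω x y) (𝓝 x) (𝓝 0) := by
  have hδ := half_pos (infDist_compl_pos hO hne hx)
  have h1 : Tendsto (fun y => ‖y - x‖ / (infDist x Ωᶜ / 2)) (𝓝 x) (𝓝 0) := by
    have : Continuous fun y => ‖y - x‖ / (infDist x Ωᶜ / 2) := by fun_prop
    simpa using this.tendsto x
  refine tendsto_of_tendsto_of_tendsto_of_le_of_le' tendsto_const_nhds h1
    (Eventually.of_forall fun y => qhDist_nonneg x y) ?_
  filter_upwards [closedBall_mem_nhds x hδ] with y hy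
  rw [mem_closedBall, dist_eq_norm] at hy
  exact qhDist_le_of_norm_sub_le hO hne hx hy

theorem IsRiemannPair.tendsto_qhDist {Ω : Set ℂ} {f g : ℂ → ℂ} (h : IsRiemannPair Ω f g)
    (hO : IsOpen Ω) (hne : Ωᶜ.Nonempty) {x y : ℂ} (hx : x ∈ Ω) (hy : y ∈ Ω) {ι : Type*}
    {l : Filter ι} {u v : ι → ℂ} (hu : Tendsto u l (𝓝 x)) (hv : Tendsto v l (𝓝 y)) :
    Tendsto (fun i => qhDist Ω (u i) (v i)) l (𝓝 (qhDist Ω x y)) := by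
  have h1 := ((tendsto_qhDist_zero hO hne hx).comp hu).add ((tendsto_qhDist_zero hO hne hy).comp hv)
  rw [add_zero] at h1
  rw [tendsto_iff_dist_tendsto_zero]
  refine squeeze_zero' (Eventually.of_forall fun _ => dist_nonneg) ?_ h1
  filter_upwards [hu.eventually (hO.mem_nhds hx), hv.eventually (hO.mem_nhds hy)] with i hi hi'
  have a1 := h.qhDist_triangle hO hne hi hx hi'
  have a2 := h.qhDist_triangle hO hne hx hy hi'
  have a3 := h.qhDist_triangle hO hne hx hi hy
  have a4 := h.qhDist_triangle hO hne hi hi' hy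
  rw [qhDist_symm Ω (u i) x] at a1
  rw [qhDist_symm Ω (v i) y] at a4
  rw [Real.dist_eq, abs_le]
  constructor <;> simp only [Function.comp_apply] <;> linarith

theorem IsRiemannPair.exists_isCompact_qhDist_le {Ω : Set ℂ} {f g : ℂ → ℂ}
    (h : IsRiemannPair Ω f g) (hO : IsOpen Ω) (hb : Bornology.IsBounded Ω) {x : ℂ} (hx : x ∈ Ω)
    (R : ℝ) : ∃ K, IsCompact K ∧ K ⊆ Ω ∧ ∀ w ∈ Ω, qhDist Ω x w ≤ R → w ∈ K := by
  have hne := hb.compl_nonempty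
  have hδ := infDist_compl_pos hO hne hx
  set d := infDist x Ωᶜ * Real.exp (-R) with hd
  have hd0 : 0 < d := by positivity
  refine ⟨closure Ω ∩ {w | d ≤ infDist w Ωᶜ}, ?_, fun w hw => ?_, fun w hw hk => ?_⟩
  · exact hb.isCompact_closure.inter_right
      (isClosed_le continuous_const (continuous_infDist_pt _))
  · by_contra hc
    have : d ≤ infDist w Ωᶜ := hw.2
    rw [infDist_zero_of_mem hc] at this
    linarith
  · refine ⟨subset_closure hw, ?_⟩
    have h1 := h.norm_sub_le_infDist hO hne hw hx
    have h2 := infDist_le_infDist_add_dist (s := Ωᶜ) (x := x) (y := w)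
    rw [dist_comm, dist_eq_norm] at h2
    rw [qhDist_symm] at h1
    have h3 : infDist x Ωᶜ ≤ infDist w Ωᶜ * Real.exp (qhDist Ω x w) := by nlinarith
    have h4 : infDist w Ωᶜ * Real.exp (qhDist Ω x w) ≤ infDist w Ωᶜ * Real.exp R :=
      mul_le_mul_of_nonneg_left (Real.exp_le_exp.2 hk) infDist_nonneg
    show d ≤ _
    rw [hd, Real.exp_neg, ← div_eq_mul_inv, div_le_iff₀ (Real.exp_pos R)]
    exact h3.trans h4

theorem exists_tendsto_ultrafilter {Ω : Set ℂ} {ι : Type*} (F : Ultrafilter ι) {γ : ι → ℝ → ℂ}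
    {S : Set ℝ} (h : ∀ s ∈ S, ∃ K, IsCompact K ∧ K ⊆ Ω ∧ ∀ᶠ i in (F : Filter ι), γ i s ∈ K) :
    ∃ γ' : ℝ → ℂ, ∀ s ∈ S, γ' s ∈ Ω ∧ Tendsto (fun i => γ i s) F (𝓝 (γ' s)) := by
  have : ∀ s : ℝ, ∃ w, s ∈ S → w ∈ Ω ∧ Tendsto (fun i => γ i s) F (𝓝 w) := fun s => by
    by_cases hs : s ∈ S
    · obtain ⟨K, hK, hKΩ, hev⟩ := h s hs
      obtain ⟨w, hw, hle⟩ := hK.ultrafilter_le_nhds (F.map fun i => γ i s)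
        (le_principal_iff.2 hev)
      exact ⟨w, fun _ => ⟨hKΩ hw, hle⟩⟩
    · exact ⟨0, fun h => absurd h hs⟩
  choose γ' hγ' using this
  exact ⟨γ', fun s hs => hγ' s hs⟩

theorem IsRiemannPair.exists_almost_geodesic {Ω : Set ℂ} {f g : ℂ → ℂ}
    (h : IsRiemannPair Ω f g) (hO : IsOpen Ω) (hne : Ωᶜ.Nonempty) {x y : ℂ} (hx : x ∈ Ω)
    (hy : y ∈ Ω) {ε : ℝ} (hε : 0 < ε) : ∃ γ : ℝ → ℂ, γ 0 = x ∧
      (∀ s ∈ Icc 0 (qhDist Ω x y), γ s ∈ Ω) ∧ qhDist Ω (γ (qhDist Ω x y)) y ≤ ε ∧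
      ∀ s ∈ Icc 0 (qhDist Ω x y), ∀ t ∈ Icc 0 (qhDist Ω x y),
        qhDist Ω (γ s) (γ t) ≤ |s - t| := by
  obtain ⟨p, a, b, hp, hl⟩ := h.exists_qhLength_lt hO hne hx hy (lt_add_of_pos_right _ hε)
  have hL := qhDist_le_qhLength hp
  have h_int := hp.intervalIntegrable hO hne
  have hab := hp.1
  set Λ : ℝ → ℝ := fun τ => qhLength Ω p a τ with hΛ
  have hΛa : Λ a = 0 := by simp [hΛ, qhLength]
  have hc : ContinuousOn Λ (Icc a b) := by
    have := intervalIntegral.continuousOn_primitive_interval' h_int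
      (left_mem_uIcc (a := a) (b := b))
    rwa [uIcc_of_le hab] at this
  have hsub : Icc 0 (qhDist Ω x y) ⊆ Λ '' Icc a b := by
    have := intermediate_value_Icc hab hc
    rw [hΛa] at this
    exact (Icc_subset_Icc_right hL).trans this
  have hex : ∀ s : ℝ, ∃ τ, s ∈ Icc 0 (qhDist Ω x y) → τ ∈ Icc a b ∧ Λ τ = s ∧ (s = 0 → τ = a) :=
    fun s => by
      by_cases hs : s ∈ Icc 0 (qhDist Ω x y)
      · by_cases h0 : s = 0
        · exact ⟨a, fun _ => ⟨⟨le_rfl, hab⟩, by rw [hΛa, h0], fun _ => rfl⟩⟩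
        · obtain ⟨τ, h1, h2⟩ := hsub hs
          exact ⟨τ, fun _ => ⟨h1, h2, fun h => absurd h h0⟩⟩
      · exact ⟨0, fun h => absurd h hs⟩
  choose τ hτ using hex
  have hk0 := qhDist_nonneg (Ω := Ω) x y
  have hle : ∀ u ∈ Icc a b, ∀ v ∈ Icc a b, u ≤ v → qhDist Ω (p u) (p v) ≤ Λ v - Λ u :=
    fun u hu v hv huv => by
      refine (qhDist_le_qhLength (hp.mono hu.1 huv hv.2)).trans_eq ?_
      have i1 := h_int.mono_set (c := a) (d := u)
        (by rw [uIcc_of_le hab, uIcc_of_le hu.1]; exact Icc_subset_Icc_right hu.2)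
      have i2 := h_int.mono_set (c := u) (d := v)
        (by rw [uIcc_of_le hab, uIcc_of_le huv]; exact Icc_subset_Icc hu.1 hv.2)
      have := intervalIntegral.integral_add_adjacent_intervals i1 i2
      simp only [hΛ, qhLength]
      linarith
  refine ⟨fun s => p (τ s), ?_, fun s hs => hp.2.2.2.1 _ (hτ s hs).1, ?_, fun s hs t ht => ?_⟩
  · show p (τ 0) = x
    rw [(hτ 0 ⟨le_rfl, hk0⟩).2.2 rfl, hp.2.1]
  · obtain ⟨h1, h2, -⟩ := hτ _ ⟨hk0, le_rfl⟩
    have h3 := hle _ h1 b ⟨hab, le_rfl⟩ h1.2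
    rw [h2, hp.2.2.1] at h3
    have : Λ b = qhLength Ω p a b := rfl
    show qhDist Ω (p (τ (qhDist Ω x y))) y ≤ ε
    linarith
  · obtain ⟨h1, h2, -⟩ := hτ s hs
    obtain ⟨h3, h4, -⟩ := hτ t ht
    rcases le_total (τ s) (τ t) with h5 | h5
    · have := hle _ h1 _ h3 h5
      rw [h2, h4] at this
      rw [abs_sub_comm]
      exact this.trans (le_abs_self _)
    · have := hle _ h3 _ h1 h5
      rw [h2, h4, qhDist_symm] at this
      exact this.trans (le_abs_self _)

theorem IsRiemannPair.eq_of_qhDist_le_zero {Ω : Set ℂ} {f g : ℂ → ℂ} (h : IsRiemannPair Ω f g)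
    (hO : IsOpen Ω) (hne : Ωᶜ.Nonempty) {x y : ℂ} (hx : x ∈ Ω) (hy : y ∈ Ω)
    (hk : qhDist Ω x y ≤ 0) : x = y := by
  have h1 := h.norm_sub_le_infDist hO hne hx hy
  rw [le_antisymm hk (qhDist_nonneg x y)] at h1
  simpa [sub_eq_zero] using h1

theorem IsRiemannPair.exists_geodesic {Ω : Set ℂ} {f g : ℂ → ℂ}
    (h : IsRiemannPair Ω f g) (hO : IsOpen Ω) (hb : Bornology.IsBounded Ω) {x y : ℂ} (hx : x ∈ Ω)
    (hy : y ∈ Ω) : ∃ γ : ℝ → ℂ, γ 0 = x ∧ γ (qhDist Ω x y) = y ∧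
      IsQHGeodesicOn Ω γ (Icc 0 (qhDist Ω x y)) := by
  have hne := hb.compl_nonempty
  set L := qhDist Ω x y with hL
  have hL0 : 0 ≤ L := qhDist_nonneg x y
  choose γ h0 hΩ hend hdist using fun n : ℕ =>
    h.exists_almost_geodesic hO hne hx hy (ε := 1 / ((n : ℝ) + 1)) (by positivity)
  obtain ⟨K, hK, hKΩ, hKx⟩ := h.exists_isCompact_qhDist_le hO hb hx L
  obtain ⟨γ', hγ'⟩ := exists_tendsto_ultrafilter (Ω := Ω) (hyperfilter ℕ) (γ := γ)
    (S := Icc 0 L) fun s hs => ⟨K, hK, hKΩ, Eventually.of_forall fun n => hKx _ (hΩ n s hs) (by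
      have := hdist n 0 ⟨le_rfl, hL0⟩ s hs
      rw [h0, zero_sub, abs_neg, abs_of_nonneg hs.1] at this
      exact this.trans hs.2)⟩
  have hlim : ∀ s ∈ Icc 0 L, ∀ t ∈ Icc 0 L, qhDist Ω (γ' s) (γ' t) ≤ |s - t| :=
    fun s hs t ht => le_of_tendsto
      (h.tendsto_qhDist hO hne (hγ' s hs).1 (hγ' t ht).1 (hγ' s hs).2 (hγ' t ht).2)
      (Eventually.of_forall fun n => hdist n s hs t ht)
  have hx' : γ' 0 = x := by
    have := (hγ' 0 ⟨le_rfl, hL0⟩).2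
    simp only [h0] at this
    exact tendsto_nhds_unique this tendsto_const_nhds
  have hy' : γ' L = y := by
    have h1 := hγ' L ⟨hL0, le_rfl⟩
    refine h.eq_of_qhDist_le_zero hO hne h1.1 hy ?_
    have h2 := h.tendsto_qhDist hO hne h1.1 hy h1.2
      (tendsto_const_nhds (x := y) (f := ((hyperfilter ℕ : Ultrafilter ℕ) : Filter ℕ)))
    have h3 : Tendsto (fun n : ℕ => 1 / ((n : ℝ) + 1)) (hyperfilter ℕ : Filter ℕ) (𝓝 0) :=
      tendsto_one_div_add_atTop_nhds_zero_nat.mono_left Nat.hyperfilter_le_atTop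
    exact le_of_tendsto_of_tendsto' h2 h3 hend
  have hge : ∀ s ∈ Icc 0 L, ∀ t ∈ Icc 0 L, s ≤ t → qhDist Ω (γ' s) (γ' t) = t - s :=
    fun s hs t ht hst => by
      refine le_antisymm ?_ ?_
      · have := hlim s hs t ht
        rwa [abs_sub_comm, abs_of_nonneg (by linarith)] at this
      · have a1 := h.qhDist_triangle hO hne hx (hγ' s hs).1 hy
        have a2 := h.qhDist_triangle hO hne (hγ' s hs).1 (hγ' t ht).1 hy
        have a3 := hlim 0 ⟨le_rfl, hL0⟩ s hs
        have a4 := hlim t ht L ⟨hL0, le_rfl⟩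
        rw [hx', zero_sub, abs_neg, abs_of_nonneg hs.1] at a3
        rw [hy', abs_sub_comm, abs_of_nonneg (by linarith [ht.2])] at a4
        linarith
  refine ⟨γ', hx', hy', fun s hs => (hγ' s hs).1, fun s hs t ht => ?_⟩
  rcases le_total s t with hst | hst
  · rw [hge s hs t ht hst, abs_sub_comm, abs_of_nonneg (by linarith)]
  · rw [qhDist_symm, hge t ht s hs hst, abs_of_nonneg (by linarith)]

theorem IsRiemannPair.isDiskQuasiGeodesic {Ω : Set ℂ} {f g : ℂ → ℂ} (h : IsRiemannPair Ω f g)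
    (hO : IsOpen Ω) (hne : Ωᶜ.Nonempty) {γ : ℝ → ℂ} {I : Set ℝ} (hγ : IsQHGeodesicOn Ω γ I) :
    IsDiskQuasiGeodesic 40 (g ∘ γ) I where
  norm_lt t ht := by simpa using h.mapsTo_inv (hγ.1 t ht)
  lower s hs t ht := by
    rw [← hγ.2 s hs t ht]
    exact h.norm_sub_le hO hne (hγ.1 s hs) (hγ.1 t ht)
  upper s hs t ht := by
    have hs' := hγ.1 s hs
    have ht' := hγ.1 t ht
    have := h.qhDist_le hO hne (z := g (γ s)) (w := g (γ t)) (by simpa using h.mapsTo_inv hs')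
      (by simpa using h.mapsTo_inv ht')
    rw [h.right_inv _ hs', h.right_inv _ ht', hγ.2 s hs t ht] at this
    exact this

theorem sq_div_le_integral_sq_norm_deriv {Φ : ℂ → ℂ} {V : Set ℂ} (hV : IsOpen V)
    (hΦ : DifferentiableOn ℂ Φ V) {r α β lam : ℝ} (hr : 0 < r) (hlam : 0 < lam) (hαβ : α ≤ β)
    (hπ : β - α ≤ 2 * Real.pi) (harc : ∀ θ ∈ Icc α β, circleMap 0 r θ ∈ V)
    (h : lam ≤ ‖Φ (circleMap 0 r β) - Φ (circleMap 0 r α)‖) :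
    ENNReal.ofReal (lam ^ 2 / (2 * Real.pi * r ^ 2)) ≤
      ∫⁻ θ in Icc α β, ENNReal.ofReal (‖deriv Φ (circleMap 0 r θ)‖ ^ 2) := by
  have hcont : ContinuousOn (fun θ => deriv Φ (circleMap 0 r θ)) (Icc α β) :=
    ((hΦ.deriv hV).continuousOn).comp (continuous_circleMap 0 r).continuousOn harc
  have hsq : ContinuousOn (fun θ => ‖deriv Φ (circleMap 0 r θ)‖ ^ 2) (Icc α β) := hcont.norm.pow 2
  have hder : ∀ θ ∈ uIcc α β, HasDerivAt (fun θ => Φ (circleMap 0 r θ))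
      (deriv Φ (circleMap 0 r θ) * (circleMap 0 r θ * Complex.I)) θ := fun θ hθ => by
    rw [uIcc_of_le hαβ] at hθ
    exact ((hΦ.differentiableAt (hV.mem_nhds (harc θ hθ))).hasDerivAt).comp θ
      (hasDerivAt_circleMap 0 r θ)
  have hc1 : ContinuousOn
      (fun θ => deriv Φ (circleMap 0 r θ) * (circleMap 0 r θ * Complex.I)) (uIcc α β) := by
    rw [uIcc_of_le hαβ]
    exact hcont.mul ((continuous_circleMap 0 r).mul continuous_const).continuousOn
  have hint1 := hc1.intervalIntegrable (μ := volume)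
  have hint2 : IntervalIntegrable (fun θ => ‖deriv Φ (circleMap 0 r θ)‖ ^ 2) volume α β := by
    rw [← uIcc_of_le hαβ] at hsq
    exact hsq.intervalIntegrable
  set c := lam / (4 * Real.pi) with hc
  have hc0 : 0 < c := by positivity
  set J := ∫ θ in α..β, ‖deriv Φ (circleMap 0 r θ)‖ ^ 2 with hJ
  have h1 : lam ≤ c * (β - α) + r ^ 2 / (4 * c) * J := by
    calc lam ≤ ‖Φ (circleMap 0 r β) - Φ (circleMap 0 r α)‖ := h
      _ = ‖∫ θ in α..β, deriv Φ (circleMap 0 r θ) * (circleMap 0 r θ * Complex.I)‖ := by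
        rw [intervalIntegral.integral_eq_sub_of_hasDerivAt hder hint1]
      _ ≤ ∫ θ in α..β, ‖deriv Φ (circleMap 0 r θ) * (circleMap 0 r θ * Complex.I)‖ :=
        intervalIntegral.norm_integral_le_integral_norm hαβ
      _ ≤ ∫ θ in α..β, (c + r ^ 2 / (4 * c) * ‖deriv Φ (circleMap 0 r θ)‖ ^ 2) := by
        refine intervalIntegral.integral_mono_on hαβ hint1.norm
          (intervalIntegrable_const.add (hint2.const_mul _)) fun θ _ => ?_
        rw [norm_mul, norm_mul, norm_circleMap_zero, Complex.norm_I, mul_one, abs_of_pos hr]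
        have : c + r ^ 2 / (4 * c) * ‖deriv Φ (circleMap 0 r θ)‖ ^ 2 -
            ‖deriv Φ (circleMap 0 r θ)‖ * r =
            (2 * c - r * ‖deriv Φ (circleMap 0 r θ)‖) ^ 2 / (4 * c) := by
          field_simp; ring
        have h2 : 0 ≤ (2 * c - r * ‖deriv Φ (circleMap 0 r θ)‖) ^ 2 / (4 * c) := by positivity
        linarith
      _ = c * (β - α) + r ^ 2 / (4 * c) * J := by
        rw [intervalIntegral.integral_add intervalIntegrable_const (hint2.const_mul _),
          intervalIntegral.integral_const, intervalIntegral.integral_const_mul, smul_eq_mul,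
          mul_comm c]
  have h3 : lam ^ 2 / (2 * Real.pi * r ^ 2) ≤ J := by
    have h4 : c * (β - α) ≤ lam / 2 := by
      calc c * (β - α) ≤ c * (2 * Real.pi) := by gcongr
        _ = lam / 2 := by rw [hc]; field_simp; ring
    have h5 : r ^ 2 / (4 * c) = Real.pi * r ^ 2 / lam := by rw [hc]; field_simp
    rw [h5] at h1
    have h6 : lam / 2 ≤ Real.pi * r ^ 2 / lam * J := by linarith
    rw [div_le_iff₀ (by positivity)]
    have h7 := mul_le_mul_of_nonneg_left h6 hlam.le
    have h8 : lam * (Real.pi * r ^ 2 / lam * J) = Real.pi * r ^ 2 * J := by field_simp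
    nlinarith
  refine (ENNReal.ofReal_le_ofReal h3).trans_eq ?_
  rw [hJ, intervalIntegral.integral_of_le hαβ, ← integral_Icc_eq_integral_Ioc,
    ofReal_integral_eq_lintegral_ofReal]
  · exact (intervalIntegrable_iff_integrableOn_Icc_of_le hαβ).1 hint2
  · exact Eventually.of_forall fun θ => sq_nonneg _

theorem circleMap_mem_ball_one_iff {r θ : ℝ} (hr : 0 < r) :
    circleMap 0 r θ ∈ ball (1 : ℂ) 1 ↔ r < 2 * Real.cos θ := by
  have h1 : ‖circleMap 0 r θ - 1‖ ^ 2 = 1 + r * (r - 2 * Real.cos θ) := by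
    rw [← Complex.normSq_eq_norm_sq, Complex.normSq_apply]
    simp only [circleMap, zero_add, Complex.sub_re, Complex.sub_im, Complex.one_re, Complex.one_im,
      Complex.mul_re, Complex.mul_im, Complex.ofReal_re, Complex.ofReal_im,
      Complex.exp_ofReal_mul_I_re, Complex.exp_ofReal_mul_I_im]
    have := Real.sin_sq_add_cos_sq θ
    linear_combination r ^ 2 * this
  rw [mem_ball, dist_eq_norm, ← sq_lt_one_iff₀ (norm_nonneg _), h1]
  constructor
  · intro h
    by_contra hc
    nlinarith [mul_nonneg hr.le (sub_nonneg.2 (not_lt.1 hc))]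
  · intro h
    nlinarith [mul_pos hr (sub_pos.2 h)]

theorem exists_circleMap_eq_of_mem_ball_one {r : ℝ} {z : ℂ} (hz : z ∈ ball (1 : ℂ) 1)
    (hzr : ‖z‖ = r) : ∃ θ ∈ Ioo (-(Real.pi / 2)) (Real.pi / 2), circleMap 0 r θ = z := by
  refine ⟨z.arg, ?_, ?_⟩
  · have : 0 < z.re := by
      rw [mem_ball, dist_eq_norm] at hz
      have := (Complex.abs_re_le_norm (z - 1)).trans_lt hz
      rw [abs_lt] at this
      simp at this
      linarith [this.1]
    have := Complex.abs_arg_lt_pi_div_two_iff.2 (Or.inl this)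
    exact abs_lt.1 this
  · rw [circleMap, zero_add, ← hzr, Complex.norm_mul_exp_arg_mul_I]

theorem circleMap_mem_ball_one_of_mem_Icc {r α β θ : ℝ} (hr : 0 < r)
    (hα : α ∈ Icc (-(Real.pi / 2)) (Real.pi / 2)) (hβ : β ∈ Icc (-(Real.pi / 2)) (Real.pi / 2))
    (hα' : circleMap 0 r α ∈ ball (1 : ℂ) 1) (hβ' : circleMap 0 r β ∈ ball (1 : ℂ) 1)
    (hθ : θ ∈ Icc α β) : circleMap 0 r θ ∈ ball (1 : ℂ) 1 := by
  rw [circleMap_mem_ball_one_iff hr] at *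
  have := strictConcaveOn_cos_Icc.concaveOn.min_le_of_mem_Icc hα hβ hθ
  rcases min_le_iff.1 this with h | h <;> linarith

theorem exists_norm_sub_lt_of_lintegral_ne_top {Φ : ℂ → ℂ} (hΦ : DifferentiableOn ℂ Φ (ball 1 1))
    (hfin : ∫⁻ z in ball (1 : ℂ) 1, ENNReal.ofReal (‖deriv Φ z‖ ^ 2) ≠ ∞) {lam r₀ : ℝ}
    (hlam : 0 < lam) (hr₀ : 0 < r₀) : ∃ r ∈ Ioo 0 r₀, ∀ z ∈ ball (1 : ℂ) 1, ∀ w ∈ ball (1 : ℂ) 1,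
      ‖z‖ = r → ‖w‖ = r → ‖Φ z - Φ w‖ < lam := by
  by_contra! hbad
  set F : ℂ → ℝ≥0∞ := (ball (1 : ℂ) 1).indicator fun z => ENNReal.ofReal (‖deriv Φ z‖ ^ 2) with hF
  have hFm : Measurable F :=
    ((measurable_deriv Φ).norm.pow_const 2).ennreal_ofReal.indicator measurableSet_ball
  rw [← lintegral_indicator measurableSet_ball, ← hF, ← Complex.lintegral_comp_polarCoord_symm,
    polarCoord_target, Measure.volume_eq_prod, setLIntegral_prod] at hfin
  swap
  · refine Measurable.aemeasurable ?_
    simp only [Complex.polarCoord_symm_apply, smul_eq_mul]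
    refine measurable_fst.ennreal_ofReal.mul (hFm.comp ?_)
    fun_prop
  have hcirc : ∀ r θ : ℝ, (Complex.polarCoord.symm (r, θ) : ℂ) = circleMap 0 r θ := fun r θ => by
    rw [Complex.polarCoord_symm_apply, circleMap, zero_add, Complex.exp_mul_I]
    simp
  simp only [hcirc, smul_eq_mul] at hfin
  have key : ∀ r ∈ Ioo 0 r₀, ENNReal.ofReal (lam ^ 2 / (2 * Real.pi) * r⁻¹) ≤
      ∫⁻ θ in Ioo (-Real.pi) Real.pi, ENNReal.ofReal r * F (circleMap 0 r θ) := by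
    intro r hr
    have hcm : Measurable fun θ => F (circleMap 0 r θ) :=
      hFm.comp (continuous_circleMap 0 r).measurable
    rw [lintegral_const_mul _ hcm]
    obtain ⟨z, hz, w, hw, hzr, hwr, hzw⟩ := hbad r hr
    obtain ⟨α, hα, rfl⟩ := exists_circleMap_eq_of_mem_ball_one hz hzr
    obtain ⟨β, hβ, rfl⟩ := exists_circleMap_eq_of_mem_ball_one hw hwr
    have main : ∀ α ∈ Ioo (-(Real.pi / 2)) (Real.pi / 2), ∀ β ∈ Ioo (-(Real.pi / 2)) (Real.pi / 2),
        circleMap 0 r α ∈ ball (1 : ℂ) 1 → circleMap 0 r β ∈ ball (1 : ℂ) 1 → α ≤ β →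
        lam ≤ ‖Φ (circleMap 0 r β) - Φ (circleMap 0 r α)‖ →
        ENNReal.ofReal (lam ^ 2 / (2 * Real.pi * r ^ 2)) ≤
          ∫⁻ θ in Ioo (-Real.pi) Real.pi, F (circleMap 0 r θ) := by
      intro α hα β hβ hz hw hαβ hle
      have harc : ∀ θ ∈ Icc α β, circleMap 0 r θ ∈ ball (1 : ℂ) 1 := fun θ hθ =>
        circleMap_mem_ball_one_of_mem_Icc hr.1 (Ioo_subset_Icc_self hα) (Ioo_subset_Icc_self hβ)
          hz hw hθ
      refine (sq_div_le_integral_sq_norm_deriv isOpen_ball hΦ hr.1 hlam hαβ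
        (by linarith [hα.1, hβ.2, Real.pi_pos]) harc hle).trans ?_
      calc _ = ∫⁻ θ in Icc α β, F (circleMap 0 r θ) :=
            setLIntegral_congr_fun measurableSet_Icc fun θ hθ => by
              simp only [hF, indicator_of_mem (harc θ hθ)]
        _ ≤ ∫⁻ θ in Ioo (-Real.pi) Real.pi, F (circleMap 0 r θ) := lintegral_mono_set fun θ hθ =>
            ⟨by linarith [hα.1, hθ.1, Real.pi_pos], by linarith [hβ.2, hθ.2, Real.pi_pos]⟩
    have h2 : ENNReal.ofReal (lam ^ 2 / (2 * Real.pi * r ^ 2)) ≤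
        ∫⁻ θ in Ioo (-Real.pi) Real.pi, F (circleMap 0 r θ) := by
      rcases le_total α β with h | h
      · exact main α hα β hβ hz hw h (by rwa [norm_sub_rev])
      · exact main β hβ α hα hw hz h hzw
    refine le_trans (le_of_eq ?_) (mul_le_mul_right h2 _)
    rw [← ENNReal.ofReal_mul hr.1.le]
    congr 1
    have := hr.1.ne'
    field_simp
  have hfin' : ∫⁻ r in Ioo 0 r₀, ENNReal.ofReal (lam ^ 2 / (2 * Real.pi) * r⁻¹) < ∞ := by
    refine lt_of_le_of_lt ?_ (lt_top_iff_ne_top.2 hfin)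
    refine (setLIntegral_mono' measurableSet_Ioo key).trans
      (lintegral_mono_set Ioo_subset_Ioi_self)
  have hI : IntegrableOn (fun r : ℝ => lam ^ 2 / (2 * Real.pi) * r⁻¹) (Ioo 0 r₀) := by
    refine ⟨(measurable_inv.const_mul _).aestronglyMeasurable, ?_⟩
    rw [hasFiniteIntegral_iff_ofReal]
    · exact hfin'
    · refine (ae_restrict_iff' measurableSet_Ioo).2 (Eventually.of_forall fun r hr => ?_)
      have := hr.1
      simp only [Pi.zero_apply]
      positivity
  have hI' : IntervalIntegrable (fun r : ℝ => r⁻¹) volume 0 r₀ := by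
    rw [intervalIntegrable_iff_integrableOn_Ioo_of_le hr₀.le]
    have := hI.const_mul (lam ^ 2 / (2 * Real.pi))⁻¹
    refine this.congr (Eventually.of_forall fun r => ?_)
    have h0 : lam ^ 2 / (2 * Real.pi) ≠ 0 := by positivity
    simp only
    rw [← mul_assoc, inv_mul_cancel₀ h0, one_mul]
  rcases intervalIntegrable_inv_iff.1 hI' with h | h
  · exact hr₀.ne h
  · exact h left_mem_uIcc

theorem lintegral_sq_norm_deriv_ne_top {Φ : ℂ → ℂ} {V : Set ℂ} (hV : IsOpen V)
    (hΦ : DifferentiableOn ℂ Φ V) (hinj : InjOn Φ V) (hb : Bornology.IsBounded (Φ '' V)) :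
    ∫⁻ z in V, ENNReal.ofReal (‖deriv Φ z‖ ^ 2) ≠ ∞ := by
  have h := lintegral_abs_det_fderiv_eq_addHaar_image volume hV.measurableSet
    (f' := fun z => deriv Φ z • (1 : ℂ →L[ℝ] ℂ)) (fun z hz =>
      ((hΦ.differentiableAt (hV.mem_nhds hz)).hasDerivAt.complexToReal_fderiv).hasFDerivWithinAt)
    hinj
  have hdet : ∀ c : ℂ, |(c • (1 : ℂ →L[ℝ] ℂ)).det| = ‖c‖ ^ 2 := fun c => by
    have := Algebra.norm_complex_apply c
    rw [Algebra.norm_apply] at this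
    have h2 : (c • (1 : ℂ →L[ℝ] ℂ)).det = ‖c‖ ^ 2 := by
      rw [← Complex.normSq_eq_norm_sq, ← this, ContinuousLinearMap.det]
      congr 1
    rw [h2, abs_of_nonneg (by positivity)]
  simp only [hdet] at h
  rw [h]
  exact hb.measure_lt_top.ne

theorem exists_small_image_crosscut {f : ℂ → ℂ} (hf : DifferentiableOn ℂ f (ball 0 1))
    (hinj : InjOn f (ball 0 1)) (hb : Bornology.IsBounded (f '' ball 0 1)) {ζ : ℂ} (hζ : ‖ζ‖ = 1)
    {lam r₀ : ℝ} (hlam : 0 < lam) (hr₀ : 0 < r₀) : ∃ r ∈ Ioo 0 r₀, ∀ z ∈ ball (0 : ℂ) 1,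
      ∀ w ∈ ball (0 : ℂ) 1, dist z ζ = r → dist w ζ = r → dist (f z) (f w) < lam := by
  have hζ0 : ζ ≠ 0 := by rw [← norm_pos_iff, hζ]; exact one_pos
  have hm : MapsTo (fun z => ζ * (1 - z)) (ball 1 1) (ball 0 1) := fun z hz => by
    rw [mem_ball, dist_comm, dist_eq_norm] at hz
    rw [mem_ball_zero_iff, norm_mul, hζ, one_mul]
    exact hz
  have hd : DifferentiableOn ℂ (fun z => f (ζ * (1 - z))) (ball 1 1) :=
    hf.comp (by fun_prop) hm
  have hi : InjOn (fun z => f (ζ * (1 - z))) (ball 1 1) := fun z hz w hw h => by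
    have := hinj (hm hz) (hm hw) h
    have := mul_left_cancel₀ hζ0 this
    simpa using this
  have hb' : Bornology.IsBounded ((fun z => f (ζ * (1 - z))) '' ball 1 1) := hb.subset (by
    rintro _ ⟨z, hz, rfl⟩
    exact ⟨_, hm hz, rfl⟩)
  obtain ⟨r, hr, h⟩ := exists_norm_sub_lt_of_lintegral_ne_top hd
    (lintegral_sq_norm_deriv_ne_top isOpen_ball hd hi hb') hlam hr₀
  have hback : ∀ z ∈ ball (0 : ℂ) 1, 1 - z / ζ ∈ ball (1 : ℂ) 1 ∧ ‖1 - z / ζ‖ = dist z ζ ∧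
      ζ * (1 - (1 - z / ζ)) = z := fun z hz => by
    refine ⟨?_, ?_, ?_⟩
    · rw [mem_ball_zero_iff] at hz
      rw [mem_ball, dist_eq_norm, sub_sub_cancel_left, norm_neg, norm_div, hζ, div_one]
      exact hz
    · rw [dist_comm, dist_eq_norm, one_sub_div hζ0, norm_div, hζ, div_one]
    · rw [sub_sub_cancel, mul_div_cancel₀ _ hζ0]
  refine ⟨r, hr, fun z hz w hw hzr hwr => ?_⟩
  obtain ⟨a1, a2, a3⟩ := hback z hz
  obtain ⟨b1, b2, b3⟩ := hback w hw
  have := h _ a1 _ b1 (a2.trans hzr) (b2.trans hwr)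
  rwa [a3, b3, ← dist_eq_norm] at this

theorem exists_isClosed_isPreconnected_of_locallyConnectedSpace {K : Set ℂ} (hK : IsCompact K)
    [LocallyConnectedSpace K] {ε : ℝ} (hε : 0 < ε) :
    ∃ η > 0, ∀ p ∈ K, ∃ B : Set ℂ, IsClosed B ∧ IsPreconnected B ∧ B ⊆ K ∧ B ⊆ closedBall p ε ∧
      K ∩ ball p η ⊆ B := by
  have : CompactSpace K := isCompact_iff_compactSpace.1 hK
  obtain ⟨δ, hδ, h⟩ := lebesgue_number_lemma_of_metric (s := (univ : Set K))
    (c := fun q : K => connectedComponentIn (ball q (ε / 2)) q) isCompact_univ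
    (fun q => isOpen_ball.connectedComponentIn)
    (fun q _ => mem_iUnion.2 ⟨q, mem_connectedComponentIn (mem_ball_self (by positivity))⟩)
  refine ⟨δ, hδ, fun p hp => ?_⟩
  obtain ⟨q, hq⟩ := h ⟨p, hp⟩ (mem_univ _)
  have hsub : ∀ x ∈ connectedComponentIn (ball q (ε / 2)) q, dist x q < ε / 2 :=
    fun x hx => mem_ball.1 (connectedComponentIn_subset _ _ hx)
  have hpq := hsub _ (hq (mem_ball_self hδ))
  refine ⟨closure (Subtype.val '' connectedComponentIn (ball q (ε / 2)) q), isClosed_closure,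
    ((isPreconnected_connectedComponentIn).image _ continuous_subtype_val.continuousOn).closure,
    closure_minimal ?_ hK.isClosed, closure_minimal ?_ isClosed_closedBall, ?_⟩
  · rintro _ ⟨x, -, rfl⟩
    exact x.2
  · rintro _ ⟨x, hx, rfl⟩
    have h1 := hsub x hx
    have h2 := dist_triangle_right x ⟨p, hp⟩ q
    rw [mem_closedBall]
    rw [Subtype.dist_eq] at h2
    linarith
  · rintro x ⟨hxK, hx⟩
    exact subset_closure ⟨⟨x, hxK⟩, hq hx, rfl⟩

namespace IsRiemannPair

variable {Ω : Set ℂ} {f g : ℂ → ℂ}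

theorem injOn (h : IsRiemannPair Ω f g) : InjOn f (ball 0 1) := fun z hz w hw e => by
  rw [← h.left_inv z hz, e, h.left_inv w hw]

theorem image_eq (h : IsRiemannPair Ω f g) : f '' ball 0 1 = Ω :=
  Subset.antisymm h.mapsTo.image_subset
    fun w hw => ⟨g w, h.mapsTo_inv hw, h.right_inv w hw⟩

theorem differentiableOn (h : IsRiemannPair Ω f g) : DifferentiableOn ℂ f (ball 0 1) :=
  fun z hz => (h.differentiableAt z hz).differentiableWithinAt

theorem continuousOn (h : IsRiemannPair Ω f g) : ContinuousOn f (ball 0 1) :=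
  h.differentiableOn.continuousOn

theorem continuousAt_inv (h : IsRiemannPair Ω f g) {w : ℂ} (hw : w ∈ Ω) : ContinuousAt g w :=
  (h.differentiableAt_inv w hw).continuousAt

theorem exists_image_subset_closedBall (h : IsRiemannPair Ω f g) (hO : IsOpen Ω)
    (hc : IsPreconnected Ω) (hb : Bornology.IsBounded Ω) [LocallyConnectedSpace (frontier Ω)]
    {ζ : ℂ} (hζ : ‖ζ‖ = 1) {ε : ℝ} (hε : 0 < ε) :
    ∃ r > 0, ∃ c, f '' (ball 0 1 ∩ ball ζ r) ⊆ closedBall c ε := by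
  have h0 : (0 : ℂ) ∈ ball (0 : ℂ) 1 := mem_ball_self one_pos
  have h0Ω : f 0 ∈ Ω := h.mapsTo h0
  obtain ⟨ρ, hρ, hgρ⟩ := Metric.continuousAt_iff.1 (h.continuousAt_inv h0Ω) (1 / 2) (by norm_num)
  rw [h.left_inv 0 h0] at hgρ
  obtain ⟨e, he, hee, heρ⟩ : ∃ e > 0, 2 * e ≤ ε ∧ 2 * e < ρ :=
    ⟨min (ε / 2) (ρ / 4), by positivity, by linarith [min_le_left (ε / 2) (ρ / 4)],
      by linarith [min_le_right (ε / 2) (ρ / 4)]⟩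
  have hK : IsCompact (frontier Ω) :=
    isCompact_of_isClosed_isBounded isClosed_frontier (hb.closure.subset frontier_subset_closure)
  obtain ⟨η', hη', hB'⟩ := exists_isClosed_isPreconnected_of_locallyConnectedSpace hK he
  set η := min η' e with hηdef
  have hη : 0 < η := by positivity
  have hηe : η ≤ e := min_le_right _ _
  obtain ⟨r, ⟨hr0, hr2⟩, hr⟩ := exists_small_image_crosscut h.differentiableOn h.injOn
    (by rwa [h.image_eq]) hζ (half_pos hη) (show (0:ℝ) < 1 / 2 by norm_num)
  set C := f '' (ball 0 1 ∩ sphere ζ r) with hC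
  set a : ℂ := ζ * ((1 - r : ℝ) : ℂ) with ha
  have hna : ‖a‖ = 1 - r := by
    rw [ha, norm_mul, hζ, one_mul, Complex.norm_real, Real.norm_of_nonneg (by linarith)]
  have haD : a ∈ ball (0 : ℂ) 1 := by rw [mem_ball_zero_iff, hna]; linarith
  have haζ : dist a ζ = r := by
    have : a - ζ = ζ * ((-r : ℝ) : ℂ) := by rw [ha]; push_cast; ring
    rw [dist_eq_norm, this, norm_mul, hζ, one_mul, Complex.norm_real, norm_neg,
      Real.norm_of_nonneg hr0.le]
  set c := f a with hcdef
  have hcC : c ∈ C := ⟨a, ⟨haD, haζ⟩, rfl⟩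
  have hCC : ∀ x ∈ closure C, ∀ y ∈ closure C, dist x y ≤ η / 2 := by
    have hd : ∀ x ∈ C, ∀ y ∈ C, dist x y ≤ η / 2 := by
      rintro _ ⟨x, ⟨hx, hx'⟩, rfl⟩ _ ⟨y, ⟨hy, hy'⟩, rfl⟩
      exact (hr x hx y hy hx' hy').le
    have h1 : ∀ x ∈ C, ∀ y ∈ closure C, dist x y ≤ η / 2 := fun x hx y hy => by
      have : closure C ⊆ closedBall x (η / 2) :=
        closure_minimal (fun y hy => by rw [mem_closedBall, dist_comm]; exact hd x hx y hy)
          isClosed_closedBall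
      rw [dist_comm]; exact this hy
    intro x hx y hy
    have : closure C ⊆ closedBall y (η / 2) :=
      closure_minimal (fun x hx => h1 x hx y hy) isClosed_closedBall
    exact this hx
  have hCΩ : C ⊆ Ω := (image_mono inter_subset_left).trans h.image_eq.le
  obtain ⟨B, hBcl, hBp, hBΩ, hBc, hBC⟩ : ∃ B : Set ℂ, IsClosed B ∧ IsPreconnected B ∧ B ⊆ Ωᶜ ∧
      B ⊆ closedBall c (2 * e) ∧ closure C ∩ Ωᶜ ⊆ B := by
    rcases (closure C ∩ Ωᶜ).eq_empty_or_nonempty with hem | ⟨p, hpC, hpΩ⟩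
    · exact ⟨∅, isClosed_empty, isPreconnected_empty, empty_subset _, empty_subset _, hem.le⟩
    · have hfr : closure C ∩ Ωᶜ ⊆ frontier Ω := by
        rintro x ⟨hx, hxΩ⟩
        rw [hO.frontier_eq]
        exact ⟨closure_mono hCΩ hx, hxΩ⟩
      obtain ⟨B, h1, h2, h3, h4, h5⟩ := hB' p (hfr ⟨hpC, hpΩ⟩)
      refine ⟨B, h1, h2, fun x hx => ?_, fun x hx => ?_, fun x hx => h5 ⟨hfr hx, ?_⟩⟩
      · have := h3 hx
        rw [hO.frontier_eq] at this
        exact this.2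
      · have h6 := h4 hx
        have h7 := hCC p hpC c (subset_closure hcC)
        have := dist_triangle x p c
        rw [mem_closedBall] at *
        linarith
      · rw [mem_ball]
        linarith [hCC x hx.1 p hpC, min_le_left η' e]
  have hUeq : f '' (ball 0 1 ∩ ball ζ r) = {w ∈ Ω | dist (g w) ζ < r} := by
    ext w
    constructor
    · rintro ⟨z, ⟨hz, hz'⟩, rfl⟩
      refine ⟨h.mapsTo hz, ?_⟩
      rw [h.left_inv z hz]; exact hz'
    · rintro ⟨hw, hw'⟩
      exact ⟨g w, ⟨h.mapsTo_inv hw, hw'⟩, h.right_inv w hw⟩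
  have hcl : ∀ x ∈ Ω, x ∈ closure {w ∈ Ω | dist (g w) ζ < r} → dist (g x) ζ ≤ r := by
    intro x hx hxc
    by_contra! hlt
    have : ∀ᶠ y in 𝓝 x, r < dist (g y) ζ :=
      ((h.continuousAt_inv hx).dist continuousAt_const).eventually (lt_mem_nhds hlt)
    obtain ⟨y, hy, hy'⟩ := (mem_closure_iff_frequently.1 hxc).and_eventually this |>.exists
    linarith [hy.2]
  refine ⟨r, hr0, c, ?_⟩
  rw [hUeq]
  rintro w hwU
  by_contra hwc
  have hwc' : 2 * e < dist c w := by
    rw [mem_closedBall, not_le, dist_comm] at hwc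
    linarith
  have hoc : 2 * e < dist c (f 0) := by
    by_contra! hle
    have := hgρ (show dist c (f 0) < ρ by linarith)
    rw [hcdef, h.left_inv a haD, dist_zero_right, hna] at this
    linarith
  have hXc : (closure C ∪ B) ∩ Ωᶜ = B := by
    rw [union_inter_distrib_right, inter_eq_left.2 hBΩ]
    exact union_eq_right.2 hBC
  refine separation_of_isPreconnected hO hc (X := closure C ∪ B) (isClosed_closure.union hBcl)
    (by rwa [hXc]) (w := w) (o := f 0) ((hasContLogOn_div_closedBall hwc' hoc).mono ?_)
    (U := {w ∈ Ω | dist (g w) ζ < r}) (hb.subset (sep_subset _ _)) ?_ hwU hwU.1 h0Ω ?_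
  · refine union_subset (fun x hx => ?_) hBc
    rw [mem_closedBall]
    linarith [hCC x hx c (subset_closure hcC)]
  · intro x hx
    by_cases hxΩ : x ∈ Ω
    · left; left
      refine subset_closure ⟨g x, ⟨h.mapsTo_inv hxΩ, ?_⟩, h.right_inv x hxΩ⟩
      refine le_antisymm (hcl x hxΩ hx.1) ?_
      by_contra! hlt
      refine hx.2 (mem_interior_iff_mem_nhds.2 ?_)
      filter_upwards [hO.mem_nhds hxΩ, ((h.continuousAt_inv hxΩ).dist
        continuousAt_const).eventually (gt_mem_nhds hlt)] with y h1 h2 using ⟨h1, h2⟩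
    · exact Or.inr hxΩ
  · intro ho
    have := hcl _ h0Ω ho
    rw [h.left_inv 0 h0, dist_zero_left, hζ] at this
    linarith

theorem exists_tendsto_of_locallyConnectedSpace (h : IsRiemannPair Ω f g) (hO : IsOpen Ω)
    (hc : IsPreconnected Ω) (hb : Bornology.IsBounded Ω) [LocallyConnectedSpace (frontier Ω)]
    {ζ : ℂ} (hζ : ‖ζ‖ = 1) : ∃ y, Tendsto f (𝓝[ball 0 1] ζ) (𝓝 y) := by
  have hne : (𝓝[ball (0 : ℂ) 1] ζ).NeBot := by
    rw [← mem_closure_iff_nhdsWithin_neBot, closure_ball _ one_ne_zero, mem_closedBall_zero_iff]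
    exact hζ.le
  refine cauchy_map_iff_exists_tendsto.1 (Metric.cauchy_iff.2 ⟨inferInstance, fun ε hε => ?_⟩)
  obtain ⟨r, hr, c, hrc⟩ := h.exists_image_subset_closedBall hO hc hb hζ
    (show 0 < ε / 3 by positivity)
  refine ⟨_, image_mem_map (inter_mem_nhdsWithin _ (ball_mem_nhds ζ hr)), fun x hx y hy => ?_⟩
  have h1 := hrc hx
  have h2 := hrc hy
  rw [mem_closedBall] at h1 h2
  linarith [dist_triangle_right x y c]

end IsRiemannPair

theorem MapClusterPt.eq_of_tendsto {α X : Type*} [TopologicalSpace X] [T2Space X] {l : Filter α}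
    {u : α → X} {x y : X} (hy : MapClusterPt y l u) (hx : Tendsto u l (𝓝 x)) : y = x :=
  have : (𝓝 y ⊓ 𝓝 x).NeBot := hy.clusterPt.mono hx
  eq_of_nhds_neBot this

theorem nhdsWithin_ball_neBot {ζ : ℂ} (hζ : ‖ζ‖ = 1) : (𝓝[ball (0 : ℂ) 1] ζ).NeBot := by
  rw [← mem_closure_iff_nhdsWithin_neBot, closure_ball _ one_ne_zero, mem_closedBall_zero_iff]
  exact hζ.le

theorem exists_continuousOn_closedBall {f : ℂ → ℂ} (hf : ContinuousOn f (ball 0 1))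
    (hlim : ∀ ζ : ℂ, ‖ζ‖ = 1 → ∃ y, Tendsto f (𝓝[ball 0 1] ζ) (𝓝 y)) :
    ∃ F : ℂ → ℂ, ContinuousOn F (closedBall 0 1) ∧ EqOn F f (ball 0 1) := by
  refine ⟨extendFrom (ball 0 1) f, continuousOn_extendFrom
    (closure_ball (0 : ℂ) one_ne_zero).ge fun z hz => ?_, extendFrom_extends hf⟩
  rcases (mem_closedBall_zero_iff.1 hz).lt_or_eq with h | h
  · exact ⟨f z, hf z (mem_ball_zero_iff.2 h)⟩
  · exact hlim z h

namespace IsRiemannPair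

variable {Ω : Set ℂ} {f g F : ℂ → ℂ}

theorem boundary_notMem (h : IsRiemannPair Ω f g)
    {ζ y : ℂ} (hζ : ‖ζ‖ = 1) (hy : MapClusterPt y (𝓝[ball 0 1] ζ) f) : y ∉ Ω := by
  intro hyΩ
  have h1 := hy.continuousAt_comp (h.continuousAt_inv hyΩ)
  have h2 : Tendsto (g ∘ f) (𝓝[ball 0 1] ζ) (𝓝 ζ) := by
    refine (tendsto_nhdsWithin_of_tendsto_nhds tendsto_id).congr' ?_
    filter_upwards [self_mem_nhdsWithin] with z hz
    exact (h.left_inv z hz).symm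
  have h3 := h1.eq_of_tendsto h2
  have h4 := h.mapsTo_inv hyΩ
  rw [h3, mem_ball_zero_iff, hζ] at h4
  exact lt_irrefl _ h4

theorem mapClusterPt_mem_closure (h : IsRiemannPair Ω f g)
    {ζ y : ℂ} (hy : MapClusterPt y (𝓝[ball 0 1] ζ) f) : y ∈ closure Ω := by
  refine mem_closure_iff_nhds.2 fun U hU => ?_
  obtain ⟨z, hz, hz'⟩ := ((hy.frequently hU).and_eventually self_mem_nhdsWithin).exists
  exact ⟨f z, hz, h.mapsTo hz'⟩

theorem mapClusterPt_mem_frontier (h : IsRiemannPair Ω f g) (hO : IsOpen Ω)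
    {ζ y : ℂ} (hζ : ‖ζ‖ = 1) (hy : MapClusterPt y (𝓝[ball 0 1] ζ) f) : y ∈ frontier Ω := by
  rw [hO.frontier_eq]
  exact ⟨h.mapClusterPt_mem_closure hy, h.boundary_notMem hζ hy⟩

theorem tendsto_extension (hF : ContinuousOn F (closedBall 0 1)) (hFf : EqOn F f (ball 0 1))
    {ζ : ℂ} (hζ : ‖ζ‖ = 1) : Tendsto f (𝓝[ball 0 1] ζ) (𝓝 (F ζ)) := by
  refine Tendsto.congr' ?_ ((hF ζ (mem_closedBall_zero_iff.2 hζ.le)).mono_left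
    (nhdsWithin_mono _ ball_subset_closedBall))
  filter_upwards [self_mem_nhdsWithin] with z hz using hFf hz

theorem mapsTo_frontier (h : IsRiemannPair Ω f g) (hO : IsOpen Ω)
    (hF : ContinuousOn F (closedBall 0 1)) (hFf : EqOn F f (ball 0 1)) :
    MapsTo F (sphere 0 1) (frontier Ω) := fun ζ hζ => by
  have hζ' : ‖ζ‖ = 1 := mem_sphere_zero_iff_norm.1 hζ
  have := nhdsWithin_ball_neBot hζ'
  exact h.mapClusterPt_mem_frontier hO hζ' (tendsto_extension hF hFf hζ').mapClusterPt

theorem image_sphere_eq (h : IsRiemannPair Ω f g) (hO : IsOpen Ω)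
    (hF : ContinuousOn F (closedBall 0 1)) (hFf : EqOn F f (ball 0 1)) :
    F '' sphere 0 1 = frontier Ω := by
  refine Subset.antisymm (h.mapsTo_frontier hO hF hFf).image_subset fun p hp => ?_
  have hcl : closure Ω ⊆ F '' closedBall 0 1 := by
    refine closure_minimal (fun w hw => ?_)
      ((isCompact_closedBall 0 1).image_of_continuousOn hF).isClosed
    have := h.mapsTo_inv hw
    exact ⟨g w, ball_subset_closedBall this, by rw [hFf this, h.right_inv w hw]⟩
  rw [hO.frontier_eq] at hp
  obtain ⟨z, hz, rfl⟩ := hcl hp.1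
  refine ⟨z, mem_sphere_zero_iff_norm.2 (le_antisymm (mem_closedBall_zero_iff.1 hz) ?_), rfl⟩
  by_contra! hlt
  have hz' := mem_ball_zero_iff.2 hlt
  exact hp.2 (by rw [hFf hz']; exact h.mapsTo hz')

theorem qhVisibilityDomain (h : IsRiemannPair Ω f g) (hO : IsOpen Ω) (hne : Ωᶜ.Nonempty)
    (hF : ContinuousOn F (closedBall 0 1)) (hFf : EqOn F f (ball 0 1)) :
    QHVisibilityDomain Ω := by
  intro p hp q hq hpq
  have hd : 0 < dist p q := dist_pos.2 hpq
  obtain ⟨σ, hσ, hu⟩ := Metric.uniformContinuousOn_iff.1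
    ((isCompact_closedBall (0 : ℂ) 1).uniformContinuousOn_of_continuous hF) (dist p q / 3)
    (by positivity)
  obtain ⟨M, hM, hP⟩ := IsDiskQuasiGeodesic.exists_norm_sub_le (C := 40) (by norm_num)
  refine ⟨ball p (dist p q / 3), ball q (dist p q / 3), isOpen_ball, isOpen_ball,
    mem_ball_self (by positivity), mem_ball_self (by positivity), ?_,
    f '' closedBall 0 (1 - σ / (2 * M)), ?_, ?_, fun γ T hT hγ h0 h1 => ?_⟩
  · rw [← disjoint_iff_inter_eq_empty]
    refine Disjoint.mono closure_ball_subset_closedBall closure_ball_subset_closedBall ?_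
    exact closedBall_disjoint_closedBall (by linarith)
  · refine (isCompact_closedBall _ _).image_of_continuousOn (h.continuousOn.mono ?_)
    exact closedBall_subset_ball (by have : 0 < σ / (2 * M) := by positivity
                                     linarith)
  · rintro _ ⟨z, hz, rfl⟩
    exact h.mapsTo (closedBall_subset_ball (by have : 0 < σ / (2 * M) := by positivity
                                               linarith) hz)
  · by_contra! hK
    have hqg := h.isDiskQuasiGeodesic hO hne hγ
    have h2 := hP _ _ hqg (σ / (2 * M)) 0 T hT Subset.rfl fun u hu => by
      by_contra! hlt
      exact hK u hu ⟨g (γ u), mem_closedBall_zero_iff.2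
        (by simp only [Function.comp_apply] at hlt; linarith), h.right_inv _ (hγ.1 u hu)⟩
    have m0 := h.mapsTo_inv (hγ.1 0 ⟨le_rfl, hT⟩)
    have m1 := h.mapsTo_inv (hγ.1 T ⟨hT, le_rfl⟩)
    have h3 := hu _ (ball_subset_closedBall m0) _ (ball_subset_closedBall m1) (by
      rw [dist_eq_norm]
      refine lt_of_le_of_lt h2 ?_
      have : M * (σ / (2 * M)) = σ / 2 := by field_simp
      linarith)
    rw [hFf m0, hFf m1, h.right_inv _ (hγ.1 0 ⟨le_rfl, hT⟩), h.right_inv _ (hγ.1 T ⟨hT, le_rfl⟩)] at h3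
    have h4 := dist_triangle4 p (γ 0) (γ T) q
    rw [mem_ball] at h0 h1
    rw [dist_comm p (γ 0)] at h4
    linarith

theorem exists_depth_lower_bound (h : IsRiemannPair Ω f g) {K : Set ℂ} (hK : IsCompact K)
    (hKΩ : K ⊆ Ω) : ∃ κ > 0, ∀ w ∈ K, κ ≤ 1 - ‖g w‖ := by
  rcases K.eq_empty_or_nonempty with rfl | hne
  · exact ⟨1, one_pos, by simp⟩
  obtain ⟨w, hw, hmin⟩ := hK.exists_isMinOn hne (f := fun w => 1 - ‖g w‖)
    (fun w hw => (continuousAt_const.sub (h.continuousAt_inv (hKΩ hw)).norm).continuousWithinAt)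
  have := mem_ball_zero_iff.1 (h.mapsTo_inv (hKΩ hw))
  exact ⟨1 - ‖g w‖, by linarith, hmin⟩

theorem exists_tendsto_of_qhVisibilityDomain (h : IsRiemannPair Ω f g) (hO : IsOpen Ω)
    (hb : Bornology.IsBounded Ω) (hv : QHVisibilityDomain Ω) {ζ : ℂ} (hζ : ‖ζ‖ = 1) :
    ∃ y, Tendsto f (𝓝[ball 0 1] ζ) (𝓝 y) := by
  have := nhdsWithin_ball_neBot hζ
  have hne := hb.compl_nonempty
  have hcpt : IsCompact (closure Ω) := hb.isCompact_closure
  have hmem : ∀ᶠ z in 𝓝[ball 0 1] ζ, f z ∈ closure Ω := by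
    filter_upwards [self_mem_nhdsWithin] with z hz using subset_closure (h.mapsTo hz)
  obtain ⟨x, -, hx⟩ := hcpt.exists_mapClusterPt (tendsto_principal.2 hmem)
  refine ⟨x, hcpt.tendsto_nhds_of_unique_mapClusterPt hmem fun y _ hy => ?_⟩
  by_contra hyx
  obtain ⟨U, V, hU, hV, hyU, hxV, -, K, hK, hKΩ, hγ⟩ := hv y (h.mapClusterPt_mem_frontier hO hζ hy)
    x (h.mapClusterPt_mem_frontier hO hζ hx) hyx
  obtain ⟨κ, hκ, hκK⟩ := h.exists_depth_lower_bound hK hKΩ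
  obtain ⟨M, hM, hP⟩ := IsDiskQuasiGeodesic.exists_depth_le (C := 40) (by norm_num)
  have hr : 0 < κ / (2 * M) := by positivity
  have hnear : ∀ᶠ z in 𝓝[ball 0 1] ζ, z ∈ ball (0 : ℂ) 1 ∧ dist z ζ < κ / (2 * M) / 2 := by
    filter_upwards [self_mem_nhdsWithin, nhdsWithin_le_nhds (ball_mem_nhds ζ (half_pos hr))]
      with z h1 h2 using ⟨h1, h2⟩
  obtain ⟨z, hzU, hz, hzr⟩ := ((hy.frequently (hU.mem_nhds hyU)).and_eventually hnear).exists
  obtain ⟨w, hwV, hw, hwr⟩ := ((hx.frequently (hV.mem_nhds hxV)).and_eventually hnear).exists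
  obtain ⟨γ, h0, h1, hgeo⟩ := h.exists_geodesic hO hb (h.mapsTo hz) (h.mapsTo hw)
  have hT := qhDist_nonneg (Ω := Ω) (f z) (f w)
  obtain ⟨t, ht, htK⟩ := hγ γ _ hT hgeo (by rwa [h0]) (by rwa [h1])
  have hdepth : ∀ z : ℂ, dist z ζ < κ / (2 * M) / 2 → 1 - ‖z‖ ≤ κ / (2 * M) := fun z hz => by
    have := norm_sub_norm_le ζ z
    rw [hζ, ← dist_eq_norm, dist_comm] at this
    linarith
  have h2 := hP _ _ (h.isDiskQuasiGeodesic hO hne hgeo) (κ / (2 * M)) 0 _ hr hT Subset.rfl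
    (by
      simp only [Function.comp_apply, h0, h1, h.left_inv z hz, h.left_inv w hw]
      rw [← dist_eq_norm]
      linarith [dist_triangle_right z w ζ])
    (by
      simp only [Function.comp_apply, h0, h.left_inv z hz]
      exact hdepth z hzr)
    (by
      simp only [Function.comp_apply, h1, h.left_inv w hw]
      exact hdepth w hwr) t ht
  have h3 := hκK _ htK
  have : M * (κ / (2 * M)) = κ / 2 := by field_simp
  simp only [Function.comp_apply] at h2
  linarith

end IsRiemannPair

namespace IsDiskQuasiGeodesic

variable {C : ℝ} {g : ℝ → ℂ} {I : Set ℝ}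

theorem exists_depth_le_of_le_abs (hC : 0 < C) {η ε : ℝ} (hη : 0 < η) (hε : 0 < ε) :
    ∃ s₀ ≥ 0, ∀ (g : ℝ → ℂ) (I : Set ℝ), IsDiskQuasiGeodesic C g I → 0 ∈ I → η ≤ 1 - ‖g 0‖ →
      ∀ s ∈ I, s₀ ≤ |s| → 1 - ‖g s‖ ≤ ε := by
  refine ⟨C * (Real.log (1 + 2 / η) + Real.log (1 + 2 / ε) + 1) + 1, ?_,
    fun g I h h0 hη0 s hs hs₀ => ?_⟩
  · have h1 : 0 ≤ Real.log (1 + 2 / η) := Real.log_nonneg (by have : 0 < 2 / η := by positivity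
                                                              linarith)
    have h2 : 0 ≤ Real.log (1 + 2 / ε) := Real.log_nonneg (by have : 0 < 2 / ε := by positivity
                                                              linarith)
    positivity
  · by_contra! hlt
    have h1 := h.upper 0 h0 s hs
    rw [zero_sub, abs_neg] at h1
    have h2 : ‖g 0 - g s‖ ≤ 2 := by
      linarith [norm_sub_le (g 0) (g s), h.norm_lt 0 h0, h.norm_lt s hs]
    have h3 : Real.log (1 + ‖g 0 - g s‖ / (1 - ‖g 0‖)) ≤ Real.log (1 + 2 / η) := by
      have : 0 < 1 - ‖g 0‖ := by linarith
      apply Real.log_le_log (by positivity)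
      gcongr
    have h4 : Real.log (1 + ‖g 0 - g s‖ / (1 - ‖g s‖)) ≤ Real.log (1 + 2 / ε) := by
      have : 0 < 1 - ‖g s‖ := by linarith
      apply Real.log_le_log (by positivity)
      gcongr
    have h5 : C * (Real.log (1 + ‖g 0 - g s‖ / (1 - ‖g 0‖)) +
        Real.log (1 + ‖g 0 - g s‖ / (1 - ‖g s‖)) + 1) ≤
        C * (Real.log (1 + 2 / η) + Real.log (1 + 2 / ε) + 1) := by gcongr
    linarith

theorem exists_norm_sub_le_of_tail (hC : 0 < C) {η ε : ℝ} (hη : 0 < η) (hε : 0 < ε) :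
    ∃ s₀ ≥ 0, ∀ (g : ℝ → ℂ) (I : Set ℝ), IsDiskQuasiGeodesic C g I → 0 ∈ I → η ≤ 1 - ‖g 0‖ →
      ∀ s t, s ≤ t → Icc s t ⊆ I → (s₀ ≤ s ∨ t ≤ -s₀) → ‖g s - g t‖ ≤ ε := by
  obtain ⟨M, hM, hP⟩ := exists_norm_sub_le hC
  obtain ⟨s₀, hs₀, h⟩ := exists_depth_le_of_le_abs hC hη (ε := ε / M) (by positivity)
  refine ⟨s₀, hs₀, fun g I hg h0 hη0 s t hst hI hor => ?_⟩
  have := hP g I hg (ε / M) s t hst hI fun u hu => h g I hg h0 hη0 u (hI hu) (by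
    rcases hor with hor | hor
    · exact (hor.trans hu.1).trans (le_abs_self u)
    · exact (by linarith [hu.2] : s₀ ≤ -u).trans (neg_le_abs u))
  rwa [mul_div_cancel₀ _ hM.ne'] at this

theorem tendsto_norm (hC : 0 < C) (h : IsDiskQuasiGeodesic C g univ) {l : Filter ℝ}
    (hl : Tendsto (fun t => |t|) l atTop) : Tendsto (fun t => ‖g t‖) l (𝓝 1) := by
  rw [Metric.tendsto_nhds]
  intro ε hε
  have h0 := h.norm_lt 0 (mem_univ _)
  obtain ⟨s₀, -, hs⟩ := exists_depth_le_of_le_abs hC (sub_pos.2 h0) (half_pos hε)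
  filter_upwards [hl.eventually_ge_atTop s₀] with t ht
  have h1 := hs g univ h (mem_univ _) le_rfl t (mem_univ _) ht
  have h2 := h.norm_lt t (mem_univ _)
  rw [Real.dist_eq, abs_sub_comm, abs_of_nonneg (by linarith)]
  linarith

theorem exists_tendsto_atTop (hC : 0 < C) (h : IsDiskQuasiGeodesic C g univ) :
    ∃ ζ, ‖ζ‖ = 1 ∧ Tendsto g atTop (𝓝 ζ) := by
  obtain ⟨ζ, hζ⟩ : ∃ ζ, Tendsto g atTop (𝓝 ζ) := by
    refine cauchy_map_iff_exists_tendsto.1 (Metric.cauchy_iff.2 ⟨inferInstance, fun ε hε => ?_⟩)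
    obtain ⟨s₀, -, hs⟩ := exists_norm_sub_le_of_tail hC
      (sub_pos.2 (h.norm_lt 0 (mem_univ _))) (half_pos hε)
    have key : ∀ s t, s₀ ≤ s → s ≤ t → dist (g s) (g t) < ε := fun s t h1 h2 => by
      rw [dist_eq_norm]
      linarith [hs g univ h (mem_univ _) le_rfl s t h2 (subset_univ _) (Or.inl h1)]
    refine ⟨_, image_mem_map (Ici_mem_atTop s₀), ?_⟩
    rintro _ ⟨s, hs, rfl⟩ _ ⟨t, ht, rfl⟩
    rcases le_total s t with hst | hst
    · exact key s t hs hst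
    · rw [dist_comm]; exact key t s ht hst
  exact ⟨ζ, tendsto_nhds_unique hζ.norm (h.tendsto_norm hC tendsto_abs_atTop_atTop), hζ⟩

theorem exists_tendsto_ne (hC : 0 < C) (h : IsDiskQuasiGeodesic C g univ) :
    ∃ ζ ξ, ‖ζ‖ = 1 ∧ ‖ξ‖ = 1 ∧ ζ ≠ ξ ∧ Tendsto g atTop (𝓝 ζ) ∧ Tendsto g atBot (𝓝 ξ) := by
  obtain ⟨ζ, hζ, hlimζ⟩ := h.exists_tendsto_atTop hC
  obtain ⟨ξ, hξ, hlim⟩ := (h.comp_neg.mono (by simp)).exists_tendsto_atTop (g := fun t => g (-t)) hC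
  refine ⟨ζ, ξ, hζ, hξ, ?_, hlimζ, ?_⟩
  · rintro rfl
    obtain ⟨M, hM, hP⟩ := exists_depth_le hC
    have h0 := sub_pos.2 (h.norm_lt 0 (mem_univ _))
    have hr : 0 < (1 - ‖g 0‖) / (2 * M) := by positivity
    have e1 := (hlimζ.sub hlim).norm
    rw [sub_self, norm_zero] at e1
    have e2 := (h.tendsto_norm hC tendsto_abs_atTop_atTop)
    have e3 := (h.tendsto_norm (l := atBot) hC tendsto_abs_atBot_atTop).comp tendsto_neg_atTop_atBot
    obtain ⟨t, h1, h2, h3, h4⟩ := ((e1.eventually (gt_mem_nhds hr)).and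
      ((e2.eventually (lt_mem_nhds (sub_lt_self 1 hr))).and
      ((e3.eventually (lt_mem_nhds (sub_lt_self 1 hr))).and (eventually_ge_atTop 0)))).exists
    simp only [Function.comp_apply] at h3
    have := hP g univ h _ (-t) t hr (by linarith) (subset_univ _)
      (by rw [norm_sub_rev]; exact h1.le) (by linarith) (by linarith) 0 ⟨by linarith, h4⟩
    have e : M * ((1 - ‖g 0‖) / (2 * M)) = (1 - ‖g 0‖) / 2 := by field_simp
    linarith
  · have := hlim.comp tendsto_neg_atBot_atTop
    simpa [Function.comp_def] using this

end IsDiskQuasiGeodesic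

theorem setOf_mapClusterPt_eq_singleton {α X : Type*} [TopologicalSpace X] [T2Space X]
    {l : Filter α} [l.NeBot] {u : α → X} {x : X} (hx : Tendsto u l (𝓝 x)) :
    {y | MapClusterPt y l u} = {x} := by
  ext y
  exact ⟨fun hy => MapClusterPt.eq_of_tendsto hy hx, fun hy => by
    rw [mem_singleton_iff.1 hy]; exact hx.mapClusterPt⟩

theorem locallyConnectedSpace_circle : LocallyConnectedSpace (sphere (0 : ℂ) 1) := by
  have : Fact (Module.finrank ℝ ℂ = 1 + 1) := ⟨Complex.finrank_real_complex⟩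
  exact ChartedSpace.locallyConnectedSpace (EuclideanSpace ℝ (Fin 1)) _

namespace IsRiemannPair

variable {Ω : Set ℂ} {f g F : ℂ → ℂ}

theorem locallyConnectedSpace_frontier (h : IsRiemannPair Ω f g) (hO : IsOpen Ω)
    (hF : ContinuousOn F (closedBall 0 1)) (hFf : EqOn F f (ball 0 1)) :
    LocallyConnectedSpace (frontier Ω) := by
  have := locallyConnectedSpace_circle
  have hm := h.mapsTo_frontier hO hF hFf
  have hc : Continuous (hm.restrict F (sphere 0 1) (frontier Ω)) :=
    (hF.mono sphere_subset_closedBall).mapsToRestrict hm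
  have hs : Function.Surjective (hm.restrict F (sphere 0 1) (frontier Ω)) := by
    rintro ⟨p, hp⟩
    rw [← h.image_sphere_eq hO hF hFf] at hp
    obtain ⟨z, hz, rfl⟩ := hp
    exact ⟨⟨z, hz⟩, rfl⟩
  have : CompactSpace (sphere (0 : ℂ) 1) := isCompact_iff_compactSpace.1 (isCompact_sphere _ _)
  exact (hc.isClosedMap.isQuotientMap hc hs).isCoinducing.locallyConnectedSpace

theorem tendsto_of_tendsto_inv (h : IsRiemannPair Ω f g)
    (hF : ContinuousOn F (closedBall 0 1)) (hFf : EqOn F f (ball 0 1)) {γ : ℝ → ℂ}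
    (hγ : ∀ t, γ t ∈ Ω) {l : Filter ℝ} {ζ : ℂ} (hζ : ‖ζ‖ = 1) (hl : Tendsto (g ∘ γ) l (𝓝 ζ)) :
    Tendsto γ l (𝓝 (F ζ)) := by
  have h1 : Tendsto (g ∘ γ) l (𝓝[ball 0 1] ζ) :=
    tendsto_nhdsWithin_iff.2 ⟨hl, Eventually.of_forall fun t => h.mapsTo_inv (hγ t)⟩
  refine ((tendsto_extension hF hFf hζ).comp h1).congr fun t => ?_
  exact h.right_inv _ (hγ t)

theorem noGeodesicLoop (h : IsRiemannPair Ω f g) (hO : IsOpen Ω) (hne : Ωᶜ.Nonempty)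
    (hF : ContinuousOn F (closedBall 0 1)) (hFf : EqOn F f (ball 0 1))
    (hinj : InjOn F (sphere 0 1)) : NoGeodesicLoop Ω := by
  intro γ hγ
  obtain ⟨ζ, ξ, hζ, hξ, hne', h1, h2⟩ :=
    (h.isDiskQuasiGeodesic hO hne hγ).exists_tendsto_ne (by norm_num)
  have hmem : ∀ t, γ t ∈ Ω := fun t => hγ.1 t (mem_univ t)
  rw [setOf_mapClusterPt_eq_singleton (h.tendsto_of_tendsto_inv hF hFf hmem hζ h1),
    setOf_mapClusterPt_eq_singleton (h.tendsto_of_tendsto_inv hF hFf hmem hξ h2)]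
  intro e
  exact hne' (hinj (mem_sphere_zero_iff_norm.2 hζ) (mem_sphere_zero_iff_norm.2 hξ)
    (singleton_eq_singleton_iff.1 e))

theorem nonempty_homeomorph (h : IsRiemannPair Ω f g) (hO : IsOpen Ω)
    (hF : ContinuousOn F (closedBall 0 1)) (hFf : EqOn F f (ball 0 1))
    (hinj : InjOn F (sphere 0 1)) : Nonempty (frontier Ω ≃ₜ sphere (0 : ℂ) 1) := by
  have hm := h.mapsTo_frontier hO hF hFf
  have hc : Continuous (hm.restrict F (sphere 0 1) (frontier Ω)) :=
    (hF.mono sphere_subset_closedBall).mapsToRestrict hm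
  have hb : Function.Bijective (hm.restrict F (sphere 0 1) (frontier Ω)) := by
    refine ⟨fun x y e => Subtype.ext (hinj x.2 y.2 (congrArg Subtype.val e)), ?_⟩
    rintro ⟨p, hp⟩
    rw [← h.image_sphere_eq hO hF hFf] at hp
    obtain ⟨z, hz, rfl⟩ := hp
    exact ⟨⟨z, hz⟩, rfl⟩
  have : CompactSpace (sphere (0 : ℂ) 1) := isCompact_iff_compactSpace.1 (isCompact_sphere _ _)
  exact ⟨(Continuous.homeoOfEquivCompactToT2 (f := Equiv.ofBijective _ hb) hc).symm⟩

end IsRiemannPair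

theorem IsQHGeodesicOn.comp_add {Ω : Set ℂ} {γ : ℝ → ℂ} {a b : ℝ} (c : ℝ)
    (hγ : IsQHGeodesicOn Ω γ (Icc a b)) :
    IsQHGeodesicOn Ω (fun s => γ (c + s)) (Icc (a - c) (b - c)) := by
  have hm : ∀ s ∈ Icc (a - c) (b - c), c + s ∈ Icc a b := fun s hs =>
    ⟨by linarith [hs.1], by linarith [hs.2]⟩
  refine ⟨fun s hs => hγ.1 _ (hm s hs), fun s hs t ht => ?_⟩
  rw [hγ.2 _ (hm s hs) _ (hm t ht), add_sub_add_left_eq_sub]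

namespace IsRiemannPair

variable {Ω : Set ℂ} {f g F : ℂ → ℂ}

theorem exists_geodesicLine_of_tendsto (h : IsRiemannPair Ω f g) (hO : IsOpen Ω)
    (hb : Bornology.IsBounded Ω) {ζ ξ : ℂ} {η : ℝ} (hη : 0 < η) {β : ℕ → ℝ → ℂ} {a b : ℕ → ℝ}
    (ha : Tendsto a atTop atBot) (hbt : Tendsto b atTop atTop)
    (hβ : ∀ n, IsQHGeodesicOn Ω (β n) (Icc (a n) (b n)))
    (h0 : ∀ n, 0 ∈ Icc (a n) (b n)) (hη0 : ∀ n, η ≤ 1 - ‖g (β n 0)‖)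
    (hζ : Tendsto (fun n => g (β n (a n))) atTop (𝓝 ζ))
    (hξ : Tendsto (fun n => g (β n (b n))) atTop (𝓝 ξ)) :
    ∃ γ, IsQHGeodesicLine Ω γ ∧ Tendsto (g ∘ γ) atTop (𝓝 ξ) ∧ Tendsto (g ∘ γ) atBot (𝓝 ζ) := by
  have hne := hb.compl_nonempty
  set L : Filter ℕ := ((hyperfilter ℕ : Ultrafilter ℕ) : Filter ℕ) with hL
  have hLle : L ≤ atTop := Nat.hyperfilter_le_atTop
  have hI : ∀ s, ∀ᶠ n in L, s ∈ Icc (a n) (b n) := fun s => hLle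
    ((ha.eventually_le_atBot s).and (hbt.eventually_ge_atTop s))
  have hz0 : (0 : ℂ) ∈ ball (0 : ℂ) 1 := mem_ball_self one_pos
  have hdist : ∀ n, qhDist Ω (f 0) (β n 0) ≤ 40 * 1 / (1 - (1 - η)) := fun n => by
    have hm := hη0 n
    have hn := norm_nonneg (g (β n 0))
    have := (h.qhDist_le_of_norm_le hO hne (z := 0) (w := g (β n 0)) (r := 1 - η)
      (by rw [norm_zero]; linarith) (by linarith) (by linarith)).2
    rw [h.right_inv _ ((hβ n).1 _ (h0 n)), sub_zero] at this
    refine this.trans ?_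
    have : 0 < 1 - (1 - η) := by linarith
    gcongr
    linarith
  obtain ⟨γ, hγ⟩ := exists_tendsto_ultrafilter (Ω := Ω) (hyperfilter ℕ) (γ := β)
    (S := univ) (fun s _ => by
      obtain ⟨K, hK, hKΩ, hKx⟩ := h.exists_isCompact_qhDist_le hO hb (h.mapsTo hz0)
        (40 * 1 / (1 - (1 - η)) + |s|)
      refine ⟨K, hK, hKΩ, ?_⟩
      filter_upwards [hI s] with n hn
      have h1 := (hβ n).1 _ hn
      refine hKx _ h1 ((h.qhDist_triangle hO hne (h.mapsTo hz0) ((hβ n).1 _ (h0 n)) h1).trans ?_)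
      rw [(hβ n).2 _ (h0 n) _ hn, zero_sub, abs_neg]
      linarith [hdist n])
  have hmem : ∀ s, γ s ∈ Ω := fun s => (hγ s (mem_univ s)).1
  have hlim : ∀ s, Tendsto (fun n => β n s) L (𝓝 (γ s)) := fun s => (hγ s (mem_univ s)).2
  have hglim : ∀ s, Tendsto (fun n => g (β n s)) L (𝓝 (g (γ s))) := fun s =>
    (h.continuousAt_inv (hmem s)).tendsto.comp (hlim s)
  have hd := fun n => h.isDiskQuasiGeodesic hO hne (hβ n)
  refine ⟨γ, ⟨fun s _ => hmem s, fun s _ t _ => ?_⟩, ?_, ?_⟩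
  · refine tendsto_nhds_unique (h.tendsto_qhDist hO hne (hmem s) (hmem t) (hlim s) (hlim t)) ?_
    refine tendsto_const_nhds.congr' ?_
    filter_upwards [hI s, hI t] with n hs ht using ((hβ n).2 _ hs _ ht).symm
  · rw [Metric.tendsto_atTop]
    intro ε hε
    obtain ⟨s₀, -, hs₀⟩ := IsDiskQuasiGeodesic.exists_norm_sub_le_of_tail (C := 40) (by norm_num) hη
      (half_pos hε)
    refine ⟨s₀, fun s hs => ?_⟩
    have h1 : Tendsto (fun n => ‖g (β n s) - g (β n (b n))‖) L (𝓝 ‖g (γ s) - ξ‖) :=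
      ((hglim s).sub (hξ.mono_left hLle)).norm
    have h2 : ‖g (γ s) - ξ‖ ≤ ε / 2 := le_of_tendsto h1 (by
      filter_upwards [hI s] with n hn
      exact hs₀ _ _ (hd n) (h0 n) (hη0 n) s (b n) hn.2 (Icc_subset_Icc_left hn.1) (Or.inl hs))
    rw [dist_eq_norm]
    exact lt_of_le_of_lt h2 (half_lt_self hε)
  · rw [Metric.tendsto_nhds]
    intro ε hε
    obtain ⟨s₀, -, hs₀⟩ := IsDiskQuasiGeodesic.exists_norm_sub_le_of_tail (C := 40) (by norm_num) hη
      (half_pos hε)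
    filter_upwards [eventually_le_atBot (-s₀)] with s hs
    have h1 : Tendsto (fun n => ‖g (β n (a n)) - g (β n s)‖) L (𝓝 ‖ζ - g (γ s)‖) :=
      ((hζ.mono_left hLle).sub (hglim s)).norm
    have h2 : ‖ζ - g (γ s)‖ ≤ ε / 2 := le_of_tendsto h1 (by
      filter_upwards [hI s] with n hn
      exact hs₀ _ _ (hd n) (h0 n) (hη0 n) (a n) s hn.1 (Icc_subset_Icc_right hn.2) (Or.inr hs))
    rw [dist_comm, dist_eq_norm]
    exact lt_of_le_of_lt h2 (half_lt_self hε)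

theorem exists_geodesicLine (h : IsRiemannPair Ω f g) (hO : IsOpen Ω)
    (hb : Bornology.IsBounded Ω) {ζ ξ : ℂ} (hζ : ‖ζ‖ = 1) (hξ : ‖ξ‖ = 1) (hne' : ζ ≠ ξ) :
    ∃ γ, IsQHGeodesicLine Ω γ ∧ Tendsto (g ∘ γ) atTop (𝓝 ξ) ∧ Tendsto (g ∘ γ) atBot (𝓝 ζ) := by
  have hne := hb.compl_nonempty
  have hδ : 0 < ‖ζ - ξ‖ := norm_pos_iff.2 (sub_ne_zero.2 hne')
  obtain ⟨M, hM, hP⟩ := IsDiskQuasiGeodesic.exists_norm_sub_le (C := 40) (by norm_num)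
  set η := ‖ζ - ξ‖ / (3 * M) with hη
  have hη0 : 0 < η := by positivity
  set ρ : ℕ → ℝ := fun n => 1 - 1 / ((n : ℝ) + 2) with hρ
  have hρ1 : ∀ n, 1 / 2 ≤ ρ n ∧ ρ n < 1 := fun n => by
    have h1 : 1 / ((n : ℝ) + 2) ≤ 1 / 2 := by gcongr; linarith [n.cast_nonneg (α := ℝ)]
    have h2 : 0 < 1 / ((n : ℝ) + 2) := by positivity
    constructor <;> simp only [hρ] <;> linarith
  have hρlim : Tendsto ρ atTop (𝓝 1) := by
    have h1 : Tendsto (fun n : ℕ => 1 / ((n : ℝ) + 2)) atTop (𝓝 0) :=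
      tendsto_const_nhds.div_atTop
        (tendsto_atTop_add_const_right _ _ tendsto_natCast_atTop_atTop)
    simpa [hρ] using h1.const_sub 1
  have hnorm : ∀ n, ∀ z : ℂ, ‖(ρ n : ℂ) * z‖ = ρ n * ‖z‖ := fun n z => by
    rw [norm_mul, Complex.norm_real, Real.norm_of_nonneg (by linarith [(hρ1 n).1])]
  have hball : ∀ n, ∀ z : ℂ, ‖z‖ = 1 → (ρ n : ℂ) * z ∈ ball (0 : ℂ) 1 := fun n z hz => by
    rw [mem_ball_zero_iff, hnorm, hz, mul_one]; exact (hρ1 n).2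
  have htend : ∀ z : ℂ, Tendsto (fun n => (ρ n : ℂ) * z) atTop (𝓝 z) := fun z => by
    have := ((Complex.continuous_ofReal.tendsto 1).comp hρlim).mul_const z
    simpa using this
  choose γ hγ0 hγ1 hγ using fun n =>
    h.exists_geodesic hO hb (h.mapsTo (hball n ζ hζ)) (h.mapsTo (hball n ξ hξ))
  set T : ℕ → ℝ := fun n => qhDist Ω (f ((ρ n : ℂ) * ζ)) (f ((ρ n : ℂ) * ξ)) with hT
  have hT0 : ∀ n, 0 ≤ T n := fun n => qhDist_nonneg _ _
  have hγ1 : ∀ n, γ n (T n) = f ((ρ n : ℂ) * ξ) := hγ1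
  have hd := fun n => h.isDiskQuasiGeodesic hO hne (hγ n)
  have hex : ∀ n, ∃ t ∈ Icc 0 (T n), η < 1 - ‖g (γ n t)‖ := fun n => by
    by_contra! hcon
    have := hP _ _ (hd n) η 0 (T n) (hT0 n) Subset.rfl hcon
    simp only [Function.comp_apply, hγ0, hγ1, h.left_inv _ (hball n ζ hζ),
      h.left_inv _ (hball n ξ hξ), ← mul_sub, hnorm] at this
    have e : M * η = ‖ζ - ξ‖ / 3 := by rw [hη]; field_simp
    rw [e] at this
    nlinarith [(hρ1 n).1]
  choose t ht htη using hex
  have hlog : ∀ R : ℝ, ∀ᶠ n in atTop, (1 - ρ n) * Real.exp (2 * R) < η := fun R => by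
    have := (hρlim.const_sub 1).mul_const (Real.exp (2 * R))
    rw [sub_self, zero_mul] at this
    exact this.eventually (gt_mem_nhds hη0)
  have htlim : Tendsto t atTop atTop := by
    refine tendsto_atTop.2 fun R => ?_
    filter_upwards [hlog R] with n hn
    have h1 := (hd n).depth_le ⟨le_rfl, hT0 n⟩ (ht n)
    simp only [Function.comp_apply, hγ0, h.left_inv _ (hball n ζ hζ), hnorm, hζ, mul_one, zero_sub,
      abs_neg, abs_of_nonneg (ht n).1] at h1
    by_contra! hlt
    have h2 : (1 - ρ n) * Real.exp (2 * t n) ≤ (1 - ρ n) * Real.exp (2 * R) := by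
      have := (hρ1 n).2
      gcongr
    linarith [htη n]
  have hTlim : Tendsto (fun n => T n - t n) atTop atTop := by
    refine tendsto_atTop.2 fun R => ?_
    filter_upwards [hlog R] with n hn
    have h1 := (hd n).depth_le ⟨hT0 n, le_rfl⟩ (ht n)
    simp only [Function.comp_apply, hγ1, h.left_inv _ (hball n ξ hξ), hnorm, hξ, mul_one] at h1
    rw [abs_of_nonneg (sub_nonneg.2 (ht n).2)] at h1
    by_contra! hlt
    have h2 : (1 - ρ n) * Real.exp (2 * (T n - t n)) ≤ (1 - ρ n) * Real.exp (2 * R) := by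
      have := (hρ1 n).2
      gcongr
    linarith [htη n]
  refine h.exists_geodesicLine_of_tendsto hO hb hη0 (β := fun n s => γ n (t n + s))
    (a := fun n => 0 - t n) (b := fun n => T n - t n) ?_ hTlim (fun n => (hγ n).comp_add (t n))
    (fun n => ⟨by linarith [(ht n).1], by linarith [(ht n).2]⟩)
    (fun n => by simpa using (htη n).le) ?_ ?_
  · simpa only [zero_sub, Function.comp_def] using tendsto_neg_atTop_atBot.comp htlim
  · refine (htend ζ).congr fun n => ?_
    rw [zero_sub, add_neg_cancel, hγ0, h.left_inv _ (hball n ζ hζ)]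
  · refine (htend ξ).congr fun n => ?_
    rw [add_sub_cancel, hγ1, h.left_inv _ (hball n ξ hξ)]

theorem injOn_of_noGeodesicLoop (h : IsRiemannPair Ω f g) (hO : IsOpen Ω)
    (hb : Bornology.IsBounded Ω) (hF : ContinuousOn F (closedBall 0 1))
    (hFf : EqOn F f (ball 0 1)) (hloop : NoGeodesicLoop Ω) : InjOn F (sphere 0 1) := by
  intro ζ hζ ξ hξ he
  by_contra hne
  rw [mem_sphere_zero_iff_norm] at hζ hξ
  obtain ⟨γ, hγ, h1, h2⟩ := h.exists_geodesicLine hO hb hζ hξ hne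
  have hmem : ∀ t, γ t ∈ Ω := fun t => hγ.1 t (mem_univ t)
  refine hloop γ hγ ?_
  rw [setOf_mapClusterPt_eq_singleton (h.tendsto_of_tendsto_inv hF hFf hmem hξ h1),
    setOf_mapClusterPt_eq_singleton (h.tendsto_of_tendsto_inv hF hFf hmem hζ h2), he]

end IsRiemannPair

/-- The side of the line through `ζ` and `ξ` on which `z` lies. -/
def chordSide (ζ ξ z : ℂ) : ℝ := ((z - ζ) * (starRingEnd ℂ) (ξ - ζ)).im

theorem continuous_chordSide (ζ ξ : ℂ) : Continuous (chordSide ζ ξ) := by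
  unfold chordSide
  exact Complex.continuous_im.comp (by fun_prop)

theorem chordSide_swap (ζ ξ z : ℂ) : chordSide ξ ζ z = -chordSide ζ ξ z := by
  simp only [chordSide, Complex.mul_im, Complex.sub_re, Complex.sub_im, Complex.conj_re,
    Complex.conj_im]
  ring

theorem convex_chordSide_pos (ζ ξ : ℂ) : Convex ℝ {z | 0 < chordSide ζ ξ z} := by
  intro x hx y hy a b ha hb hab
  have e : chordSide ζ ξ (a • x + b • y) = a * chordSide ζ ξ x + b * chordSide ζ ξ y := by
    have : b = 1 - a := by linarith
    subst this
    simp only [chordSide, Complex.mul_im, Complex.sub_re, Complex.sub_im, Complex.conj_re,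
      Complex.conj_im, Complex.add_re, Complex.add_im, Complex.real_smul, Complex.mul_re,
      Complex.ofReal_re, Complex.ofReal_im]
    ring
  simp only [mem_ofPred_eq] at *
  rw [e]
  rcases ha.eq_or_lt with rfl | ha
  · have : b = 1 := by linarith
    subst this; linarith
  · nlinarith [mul_pos ha hx, mul_nonneg hb hy.le]

theorem norm_eq_one_iff_re_im {z : ℂ} : ‖z‖ = 1 ↔ z.re * z.re + z.im * z.im = 1 := by
  rw [← Complex.normSq_apply, Complex.normSq_eq_norm_sq,
    pow_eq_one_iff_of_nonneg (norm_nonneg z) two_ne_zero]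

theorem eq_or_eq_of_chordSide_eq_zero {ζ ξ z : ℂ} (hζ : ‖ζ‖ = 1) (hξ : ‖ξ‖ = 1) (hz : ‖z‖ = 1)
    (hne : ζ ≠ ξ) (h : chordSide ζ ξ z = 0) : z = ζ ∨ z = ξ := by
  rw [norm_eq_one_iff_re_im] at hζ hξ hz
  obtain ⟨a, b⟩ := ζ
  obtain ⟨c, d⟩ := ξ
  obtain ⟨x, y⟩ := z
  simp only [chordSide, Complex.mul_im, Complex.sub_re, Complex.sub_im, Complex.conj_re,
    Complex.conj_im] at *
  by_contra! hcon
  have hv : 0 < (c - a) ^ 2 + (d - b) ^ 2 := by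
    by_contra! hle
    have h1 : c - a = 0 := by nlinarith [sq_nonneg (c - a), sq_nonneg (d - b)]
    have h2 : d - b = 0 := by nlinarith [sq_nonneg (c - a), sq_nonneg (d - b)]
    exact hne (Complex.ext (by simp; linarith) (by simp; linarith))
  obtain ⟨t, hx, hy⟩ : ∃ t, x - a = t * (c - a) ∧ y - b = t * (d - b) := by
    refine ⟨((x - a) * (c - a) + (y - b) * (d - b)) / ((c - a) ^ 2 + (d - b) ^ 2), ?_, ?_⟩
    · rw [div_mul_eq_mul_div, eq_div_iff hv.ne']
      linear_combination (-(d - b)) * h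
    · rw [div_mul_eq_mul_div, eq_div_iff hv.ne']
      linear_combination (c - a) * h
  have ht : t * (t - 1) * ((c - a) ^ 2 + (d - b) ^ 2) = 0 := by
    have hx' : x = a + t * (c - a) := by linarith
    have hy' : y = b + t * (d - b) := by linarith
    rw [hx', hy'] at hz
    linear_combination hz - t * hξ - (1 - t) * hζ
  rcases mul_eq_zero.1 ht with h1 | h1
  · rcases mul_eq_zero.1 h1 with h2 | h2
    · subst h2
      exact hcon.1 (Complex.ext (by simp; linarith) (by simp; linarith))
    · have : t = 1 := by linarith
      subst this
      exact hcon.2 (Complex.ext (by simp; linarith) (by simp; linarith))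
  · exact hv.ne' h1

theorem exists_chordSide_pos {ζ ξ : ℂ} (hζ : ‖ζ‖ = 1) (hξ : ‖ξ‖ = 1) (hne : ζ ≠ ξ) :
    ∃ a : ℂ, ‖a‖ = 1 ∧ 0 < chordSide ζ ξ a := by
  have hv : 0 < ‖ξ - ζ‖ := norm_pos_iff.2 (sub_ne_zero.2 hne.symm)
  set v := ξ - ζ with hvd
  refine ⟨Complex.I * v / ‖v‖, by simp [hv.ne'], ?_⟩
  have hvv : v * (starRingEnd ℂ) v = ((‖v‖ ^ 2 : ℝ) : ℂ) := by
    rw [Complex.mul_conj, Complex.normSq_eq_norm_sq]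
  have hvc : (‖v‖ : ℂ) ≠ 0 := by exact_mod_cast hv.ne'
  have e1 : (Complex.I * v / ‖v‖ - ζ) * (starRingEnd ℂ) v =
      Complex.I * (‖v‖ : ℂ) - ζ * (starRingEnd ℂ) v := by
    rw [sub_mul]
    congr 1
    rw [div_mul_eq_mul_div, mul_assoc, hvv]
    push_cast
    field_simp
  have e2 : chordSide ζ ξ (Complex.I * v / ‖v‖) = ‖v‖ - (ζ * (starRingEnd ℂ) v).im := by
    rw [chordSide, ← hvd, e1]
    simp
  rw [e2]
  have e3 : (ζ * (starRingEnd ℂ) v).re ^ 2 + (ζ * (starRingEnd ℂ) v).im ^ 2 = ‖v‖ ^ 2 := by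
    have : ‖ζ * (starRingEnd ℂ) v‖ = ‖v‖ := by rw [norm_mul, hζ, one_mul, RCLike.norm_conj]
    rw [← this, ← Complex.normSq_eq_norm_sq, Complex.normSq_apply]
    ring
  have e4 : (ζ * (starRingEnd ℂ) v).re = -‖v‖ ^ 2 / 2 := by
    rw [norm_eq_one_iff_re_im] at hζ hξ
    rw [← Complex.normSq_eq_norm_sq, Complex.normSq_apply, hvd]
    simp only [Complex.mul_re, Complex.sub_re, Complex.sub_im, Complex.conj_re, Complex.conj_im]
    linarith
  have e5 : 0 < (ζ * (starRingEnd ℂ) v).re ^ 2 := by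
    rw [e4]
    exact sq_pos_of_neg (by linarith [pow_pos hv 2])
  have := abs_lt_of_sq_lt_sq (a := (ζ * (starRingEnd ℂ) v).im) (b := ‖v‖) (by linarith) hv.le
  linarith [le_abs_self (ζ * (starRingEnd ℂ) v).im]

theorem eq_at_zero_of_forall_mem_arc {F : ℂ → ℂ} {p : ℂ} {W : Set ℂ}
    (hF : DiffContOnCl ℂ F (ball 0 1)) (hW : IsOpen W)
    (hne : ∃ a ∈ W, ‖a‖ = 1) (hp : ∀ z ∈ W, ‖z‖ = 1 → F z = p) : F 0 = p := by
  obtain ⟨a, haW, ha⟩ := hne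
  obtain ⟨t, ht⟩ := (isCompact_sphere (0 : ℂ) 1).elim_finite_subcover
    (fun u : sphere (0 : ℂ) 1 => {z : ℂ | (u : ℂ) * z ∈ W})
    (fun u => hW.preimage (continuous_const.mul continuous_id)) (fun z hz => by
      have hz1 : ‖z‖ = 1 := mem_sphere_zero_iff_norm.1 hz
      have hz0 : z ≠ 0 := by rintro rfl; simp at hz1
      refine mem_iUnion.2 ⟨⟨a / z, by simp [ha, hz1]⟩, ?_⟩
      change a / z * z ∈ W
      rwa [div_mul_cancel₀ _ hz0])
  have hu : ∀ u : sphere (0 : ℂ) 1, ‖(u : ℂ)‖ = 1 := fun u => mem_sphere_zero_iff_norm.1 u.2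
  have hcl : closure (ball (0 : ℂ) 1) = closedBall 0 1 := closure_ball _ one_ne_zero
  have hterm : ∀ u : sphere (0 : ℂ) 1, DiffContOnCl ℂ (fun z => F (u * z) - p) (ball 0 1) := by
    intro u
    refine ⟨(hF.differentiableOn.comp (by fun_prop) fun z hz => ?_).sub_const p,
      (hF.continuousOn.comp (by fun_prop) fun z hz => ?_).sub continuousOn_const⟩
    · rw [mem_ball_zero_iff] at *
      rwa [norm_mul, hu, one_mul]
    · rw [hcl, mem_closedBall_zero_iff] at *
      rwa [norm_mul, hu, one_mul]
  have hprod : DiffContOnCl ℂ (fun z => ∏ u ∈ t, (F (u * z) - p)) (ball 0 1) :=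
    ⟨DifferentiableOn.fun_finsetProd fun u _ => (hterm u).differentiableOn,
      continuousOn_finsetProd t fun u _ => (hterm u).continuousOn⟩
  have h0 := Complex.norm_le_of_forall_mem_frontier_norm_le (C := 0) isBounded_ball hprod
    (fun z hz => by
      rw [frontier_ball _ one_ne_zero] at hz
      obtain ⟨u, hut, hzu⟩ := mem_iUnion₂.1 (ht hz)
      rw [Finset.prod_eq_zero hut, norm_zero]
      rw [hp _ hzu (by rw [norm_mul, hu, one_mul, mem_sphere_zero_iff_norm.1 hz]), sub_self])
    (subset_closure (mem_ball_self one_pos))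
  have h1 := norm_le_zero_iff.1 h0
  obtain ⟨u, -, hu0⟩ := Finset.prod_eq_zero_iff.1 h1
  rw [mul_zero] at hu0
  exact sub_eq_zero.1 hu0

theorem isPreconnected_compl_singleton_circle (q : sphere (0 : ℂ) 1) :
    IsPreconnected ({q}ᶜ : Set (sphere (0 : ℂ) 1)) := by
  have hq : ‖(q : ℂ)‖ = 1 := mem_sphere_zero_iff_norm.1 q.2
  have h := (stereographic hq).symm_image_target_eq_source
  rw [stereographic_source, stereographic_target] at h
  have e : (⟨q, by simp [hq]⟩ : sphere (0 : ℂ) 1) = q := rfl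
  rw [e] at h
  rw [← h]
  refine isPreconnected_univ.image _ ?_
  have := (stereographic hq).continuousOn_symm
  rwa [stereographic_target] at this

theorem isPreconnected_diff_singleton_of_homeomorph {K : Set ℂ} (e : K ≃ₜ sphere (0 : ℂ) 1)
    {p : ℂ} (hp : p ∈ K) : IsPreconnected (K \ {p}) := by
  have h := ((isPreconnected_compl_singleton_circle (e ⟨p, hp⟩)).image e.symm
    e.symm.continuous.continuousOn).image Subtype.val continuous_subtype_val.continuousOn
  convert h using 1
  ext x
  constructor
  · rintro ⟨hx, hxp⟩
    refine ⟨⟨x, hx⟩, ⟨e ⟨x, hx⟩, fun he => hxp ?_, e.symm_apply_apply _⟩, rfl⟩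
    exact congrArg Subtype.val (e.injective he)
  · rintro ⟨_, ⟨y, hy, rfl⟩, rfl⟩
    refine ⟨(e.symm y).2, fun he => hy ?_⟩
    have : e.symm y = ⟨p, hp⟩ := Subtype.ext he
    rw [mem_singleton_iff, ← this, e.apply_symm_apply]

namespace IsRiemannPair

variable {Ω : Set ℂ} {f g F : ℂ → ℂ}

theorem notMem_of_norm_eq_one (h : IsRiemannPair Ω f g) (hO : IsOpen Ω)
    (hF : ContinuousOn F (closedBall 0 1)) (hFf : EqOn F f (ball 0 1)) {z : ℂ} (hz : ‖z‖ = 1) :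
    F z ∉ Ω := by
  have := h.mapsTo_frontier hO hF hFf (mem_sphere_zero_iff_norm.2 hz)
  rw [hO.frontier_eq] at this
  exact this.2

theorem norm_eq_one_of_notMem (h : IsRiemannPair Ω f g) (hFf : EqOn F f (ball 0 1)) {z : ℂ}
    (hz : z ∈ closedBall (0 : ℂ) 1) (hzΩ : F z ∉ Ω) : ‖z‖ = 1 := by
  refine le_antisymm (mem_closedBall_zero_iff.1 hz) ?_
  by_contra! hlt
  have hz' := mem_ball_zero_iff.2 hlt
  exact hzΩ (by rw [hFf hz']; exact h.mapsTo hz')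

/-- The image of a chord of the disk whose endpoints are identified. -/
theorem chord_image_inter_compl (h : IsRiemannPair Ω f g) (hO : IsOpen Ω)
    (hF : ContinuousOn F (closedBall 0 1)) (hFf : EqOn F f (ball 0 1)) {ζ ξ : ℂ} (hζ : ‖ζ‖ = 1)
    (hξ : ‖ξ‖ = 1) (hne : ζ ≠ ξ) (he : F ζ = F ξ) :
    F '' (closedBall 0 1 ∩ {z | chordSide ζ ξ z = 0}) ∩ Ωᶜ = {F ζ} := by
  ext y
  constructor
  · rintro ⟨⟨z, ⟨hz, hz0⟩, rfl⟩, hzΩ⟩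
    rcases eq_or_eq_of_chordSide_eq_zero hζ hξ (h.norm_eq_one_of_notMem hFf hz hzΩ) hne hz0 with
      rfl | rfl
    · rfl
    · exact he.symm
  · rintro rfl
    exact ⟨⟨ζ, ⟨mem_closedBall_zero_iff.2 hζ.le, by simp [chordSide]⟩, rfl⟩,
      h.notMem_of_norm_eq_one hO hF hFf hζ⟩

theorem notMem_connectedComponentIn_compl_chord (h : IsRiemannPair Ω f g) (hO : IsOpen Ω)
    (hc : IsPreconnected Ω) (hb : Bornology.IsBounded Ω)
    (hF : ContinuousOn F (closedBall 0 1)) (hFf : EqOn F f (ball 0 1)) {ζ ξ : ℂ} (hζ : ‖ζ‖ = 1)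
    (hξ : ‖ξ‖ = 1) (hne : ζ ≠ ξ) (he : F ζ = F ξ) {z₁ z₂ : ℂ} (hz₁ : z₁ ∈ ball (0 : ℂ) 1)
    (hz₂ : z₂ ∈ ball (0 : ℂ) 1) (h₁ : 0 < chordSide ζ ξ z₁) (h₂ : chordSide ζ ξ z₂ < 0)
    (h₃ : f z₁ ∈ (F '' (closedBall 0 1 ∩ {z | chordSide ζ ξ z = 0}))ᶜ) :
    f z₂ ∉ connectedComponentIn (F '' (closedBall 0 1 ∩ {z | chordSide ζ ξ z = 0}))ᶜ (f z₁) := by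
  intro hmem
  have h_int := h.chord_image_inter_compl hO hF hFf hζ hξ hne he
  set X := F '' (closedBall 0 1 ∩ {z | chordSide ζ ξ z = 0}) with hX
  have hcs := continuous_chordSide ζ ξ
  have hXcl : IsClosed X := by
    refine IsCompact.isClosed (IsCompact.image_of_continuousOn ?_ (hF.mono inter_subset_left))
    exact (isCompact_closedBall 0 1).inter_right (isClosed_eq hcs continuous_const)
  have hgc : ∀ x ∈ Ω, ContinuousAt (fun w => chordSide ζ ξ (g w)) x := fun x hx =>
    hcs.continuousAt.comp (h.continuousAt_inv hx)
  have hcl : ∀ x ∈ Ω, x ∈ closure {w ∈ Ω | 0 < chordSide ζ ξ (g w)} → 0 ≤ chordSide ζ ξ (g x) := by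
    intro x hx hxc
    by_contra! hlt
    obtain ⟨y, hy, hy'⟩ := (mem_closure_iff_frequently.1 hxc).and_eventually
      ((hgc x hx).eventually (gt_mem_nhds hlt)) |>.exists
    linarith [hy.2]
  refine separation_of_isPreconnected hO hc hXcl (by rw [h_int]; exact isPreconnected_singleton)
    (w := f z₁) (o := f z₂) (hasContLogOn_div_of_isPreconnected
      (hXcl.isOpen_compl.connectedComponentIn) isPreconnected_connectedComponentIn
      (disjoint_compl_right.mono_right (connectedComponentIn_subset _ _))
      (mem_connectedComponentIn h₃) hmem)
    (U := {w ∈ Ω | 0 < chordSide ζ ξ (g w)}) (hb.subset (sep_subset _ _)) ?_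
    ⟨h.mapsTo hz₁, by rwa [h.left_inv _ hz₁]⟩ (h.mapsTo hz₁) (h.mapsTo hz₂) ?_
  · intro x hx
    by_cases hxΩ : x ∈ Ω
    · left
      have hgx := h.mapsTo_inv hxΩ
      refine ⟨g x, ⟨ball_subset_closedBall hgx, ?_⟩, by rw [hFf hgx, h.right_inv x hxΩ]⟩
      refine le_antisymm ?_ (hcl x hxΩ hx.1)
      by_contra! hlt
      refine hx.2 (mem_interior_iff_mem_nhds.2 ?_)
      filter_upwards [hO.mem_nhds hxΩ, (hgc x hxΩ).eventually (lt_mem_nhds hlt)]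
        with y h1 h2 using ⟨h1, h2⟩
    · exact Or.inr hxΩ
  · intro ho
    have := hcl _ (h.mapsTo hz₂) ho
    rw [h.left_inv _ hz₂] at this
    linarith

theorem mem_connectedComponentIn_of_chordSide_pos {X : Set ℂ}
    (hF : ContinuousOn F (closedBall 0 1)) (hFf : EqOn F f (ball 0 1)) {ζ ξ z a : ℂ}
    (hX : ∀ z ∈ ball (0 : ℂ) 1, 0 < chordSide ζ ξ z → F z ∉ X) (hz : z ∈ ball (0 : ℂ) 1)
    (hz0 : 0 < chordSide ζ ξ z) (ha : a ∈ closedBall (0 : ℂ) 1) (ha0 : 0 < chordSide ζ ξ a)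
    (haX : F a ∉ X) : F a ∈ connectedComponentIn Xᶜ (f z) := by
  have hconv : Convex ℝ (ball (0 : ℂ) 1 ∩ {z | 0 < chordSide ζ ξ z}) :=
    (convex_ball 0 1).inter (convex_chordSide_pos ζ ξ)
  have hE : IsPreconnected (closedBall (0 : ℂ) 1 ∩ {z | 0 < chordSide ζ ξ z} ∩ {z | F z ∉ X}) := by
    refine hconv.isPreconnected.subset_closure (fun z hz => ⟨⟨ball_subset_closedBall hz.1, hz.2⟩,
      hX z hz.1 hz.2⟩) fun z hz => ?_
    have ho : IsOpen {z | 0 < chordSide ζ ξ z} :=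
      isOpen_lt continuous_const (continuous_chordSide ζ ξ)
    have := ho.inter_closure (t := ball (0 : ℂ) 1)
    rw [inter_comm _ (ball _ _), closure_ball _ one_ne_zero] at this
    exact this ⟨hz.1.2, hz.1.1⟩
  have himg := (hE.image F (hF.mono fun z hz => hz.1.1)).subset_connectedComponentIn (F := Xᶜ)
    (x := f z) ⟨z, ⟨⟨ball_subset_closedBall hz, hz0⟩, hX z hz hz0⟩, hFf hz⟩
    (by rintro _ ⟨w, hw, rfl⟩; exact hw.2)
  exact himg ⟨a, ⟨⟨ha, ha0⟩, haX⟩, rfl⟩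

theorem exists_arc_ne (h : IsRiemannPair Ω f g) (hO : IsOpen Ω)
    (hF : ContinuousOn F (closedBall 0 1)) (hFf : EqOn F f (ball 0 1)) {ζ ξ : ℂ} (hζ : ‖ζ‖ = 1)
    (hξ : ‖ξ‖ = 1) (hne : ζ ≠ ξ) :
    ∃ a : ℂ, ‖a‖ = 1 ∧ 0 < chordSide ζ ξ a ∧ F a ≠ F ζ := by
  by_contra! hcon
  obtain ⟨a, ha, ha0⟩ := exists_chordSide_pos hζ hξ hne
  have h0 := eq_at_zero_of_forall_mem_arc (F := F) (p := F ζ) (W := {z | 0 < chordSide ζ ξ z})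
    ⟨h.differentiableOn.congr hFf, by rwa [closure_ball _ one_ne_zero]⟩
    (isOpen_lt continuous_const (continuous_chordSide ζ ξ)) ⟨a, ha0, ha⟩
    fun z hz hz1 => hcon z hz1 hz
  refine h.notMem_of_norm_eq_one hO hF hFf hζ ?_
  rw [← h0, hFf (mem_ball_self one_pos)]
  exact h.mapsTo (mem_ball_self one_pos)

theorem exists_mem_ball_chordSide_pos {ζ ξ : ℂ} (hζ : ‖ζ‖ = 1) (hξ : ‖ξ‖ = 1) (hne : ζ ≠ ξ) :
    ∃ z ∈ ball (0 : ℂ) 1, 0 < chordSide ζ ξ z := by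
  obtain ⟨a, ha, ha0⟩ := exists_chordSide_pos hζ hξ hne
  have hcl : a ∈ closure (ball (0 : ℂ) 1) := by
    rw [closure_ball _ one_ne_zero, mem_closedBall_zero_iff]; exact ha.le
  obtain ⟨z, hz, hz'⟩ := mem_closure_iff.1 hcl _
    (isOpen_lt continuous_const (continuous_chordSide ζ ξ)) ha0
  exact ⟨z, hz', hz⟩

theorem injOn_of_homeomorph (h : IsRiemannPair Ω f g) (hO : IsOpen Ω)
    (hc : IsPreconnected Ω) (hb : Bornology.IsBounded Ω)
    (hF : ContinuousOn F (closedBall 0 1)) (hFf : EqOn F f (ball 0 1))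
    (e : frontier Ω ≃ₜ sphere (0 : ℂ) 1) : InjOn F (sphere 0 1) := by
  intro ζ hζ ξ hξ he
  by_contra hne
  have hζF := h.mapsTo_frontier hO hF hFf hζ
  rw [mem_sphere_zero_iff_norm] at hζ hξ
  have h_int := h.chord_image_inter_compl hO hF hFf hζ hξ hne he
  have hsep := fun z₁ z₂ => h.notMem_connectedComponentIn_compl_chord hO hc hb hF hFf hζ hξ hne he
    (z₁ := z₁) (z₂ := z₂)
  set X := F '' (closedBall 0 1 ∩ {z | chordSide ζ ξ z = 0}) with hX
  obtain ⟨a, ha, ha0, haF⟩ := h.exists_arc_ne hO hF hFf hζ hξ hne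
  obtain ⟨b, hb1, hb0, hbF⟩ := h.exists_arc_ne hO hF hFf hξ hζ (Ne.symm hne)
  obtain ⟨z₁, hz₁, h₁⟩ := exists_mem_ball_chordSide_pos hζ hξ hne
  obtain ⟨z₂, hz₂, h₂⟩ := exists_mem_ball_chordSide_pos hξ hζ (Ne.symm hne)
  have hXball : ∀ z ∈ ball (0 : ℂ) 1, chordSide ζ ξ z ≠ 0 → F z ∉ X := by
    rintro z hz hz0 ⟨w, ⟨hw, hw0⟩, hwz⟩
    have hwb : w ∈ ball (0 : ℂ) 1 := by
      rcases (mem_closedBall_zero_iff.1 hw).lt_or_eq with hlt | heq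
      · exact mem_ball_zero_iff.2 hlt
      · refine absurd ?_ (h.notMem_of_norm_eq_one hO hF hFf heq)
        rw [hwz, hFf hz]
        exact h.mapsTo hz
    rw [hFf hwb, hFf hz] at hwz
    rw [h.injOn hwb hz hwz] at hw0
    exact hz0 hw0
  have hXfr : frontier Ω \ {F ζ} ⊆ Xᶜ := by
    rintro x ⟨hx, hxp⟩ hxX
    rw [hO.frontier_eq] at hx
    have : x ∈ X ∩ Ωᶜ := ⟨hxX, hx.2⟩
    rw [h_int] at this
    exact hxp this
  have haFr : F a ∈ frontier Ω \ {F ζ} :=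
    ⟨h.mapsTo_frontier hO hF hFf (mem_sphere_zero_iff_norm.2 ha), haF⟩
  have hbFr : F b ∈ frontier Ω \ {F ζ} :=
    ⟨h.mapsTo_frontier hO hF hFf (mem_sphere_zero_iff_norm.2 hb1), by rw [he]; exact hbF⟩
  have m₁ := mem_connectedComponentIn_of_chordSide_pos hF hFf
    (fun z hz hz0 => hXball z hz hz0.ne') hz₁ h₁ (mem_closedBall_zero_iff.2 ha.le) ha0
    (hXfr haFr)
  have m₂ := mem_connectedComponentIn_of_chordSide_pos hF hFf
    (fun z hz hz0 => hXball z hz (by rw [chordSide_swap] at hz0; exact (neg_pos.1 hz0).ne)) hz₂ h₂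
    (mem_closedBall_zero_iff.2 hb1.le) hb0 (hXfr hbFr)
  have m₃ := (isPreconnected_diff_singleton_of_homeomorph e hζF).subset_connectedComponentIn haFr
    hXfr hbFr
  have hz₁X : f z₁ ∈ Xᶜ := by rw [← hFf hz₁]; exact hXball z₁ hz₁ h₁.ne'
  have hz₂X : f z₂ ∈ Xᶜ := by
    rw [chordSide_swap] at h₂
    rw [← hFf hz₂]; exact hXball z₂ hz₂ (neg_pos.1 h₂).ne
  refine hsep z₁ z₂ hz₁ hz₂ h₁ (by rw [chordSide_swap] at h₂; exact neg_pos.1 h₂) hz₁X ?_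
  rw [connectedComponentIn_eq m₁, connectedComponentIn_eq m₃, ← connectedComponentIn_eq m₂]
  exact mem_connectedComponentIn hz₂X

end IsRiemannPair

/-- A bounded simply connected domain `Ω ⊊ ℂ` is a QH-visibility domain
iff its Euclidean boundary is locally connected; and it is a QH-visibility domain with no
geodesic loop in the Euclidean closure iff it is a Jordan domain (boundary homeomorphic to
the circle). -/
theorem statement12 (Ω : Set ℂ)
    (hOpen : IsOpen Ω) (hConn : IsConnected Ω) (hBdd : Bornology.IsBounded Ω)
    (hSC : SimplyConnectedSpace ↥Ω) :
    (QHVisibilityDomain Ω ↔ LocallyConnectedSpace ↥(frontier Ω)) ∧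
    ((QHVisibilityDomain Ω ∧ NoGeodesicLoop Ω) ↔
      Nonempty (↥(frontier Ω) ≃ₜ ↥(Metric.sphere (0 : ℂ) 1))) := by
  obtain ⟨f, g, h⟩ := exists_isRiemannPair hOpen hConn hBdd hSC
  have hne := hBdd.compl_nonempty
  have hvis : QHVisibilityDomain Ω →
      ∃ F : ℂ → ℂ, ContinuousOn F (closedBall 0 1) ∧ EqOn F f (ball 0 1) := fun hv =>
    exists_continuousOn_closedBall h.continuousOn
      fun _ hζ => h.exists_tendsto_of_qhVisibilityDomain hOpen hBdd hv hζ
  have hlc : LocallyConnectedSpace (frontier Ω) →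
      ∃ F : ℂ → ℂ, ContinuousOn F (closedBall 0 1) ∧ EqOn F f (ball 0 1) := fun _ =>
    exists_continuousOn_closedBall h.continuousOn
      fun _ hζ => h.exists_tendsto_of_locallyConnectedSpace hOpen hConn.isPreconnected hBdd hζ
  refine ⟨⟨fun hv => ?_, fun hl => ?_⟩, fun ⟨hv, hloop⟩ => ?_, fun ⟨e⟩ => ?_⟩
  · obtain ⟨F, hF, hFf⟩ := hvis hv
    exact h.locallyConnectedSpace_frontier hOpen hF hFf
  · obtain ⟨F, hF, hFf⟩ := hlc hl
    exact h.qhVisibilityDomain hOpen hne hF hFf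
  · obtain ⟨F, hF, hFf⟩ := hvis hv
    exact h.nonempty_homeomorph hOpen hF hFf (h.injOn_of_noGeodesicLoop hOpen hBdd hF hFf hloop)
  · have := locallyConnectedSpace_circle
    obtain ⟨F, hF, hFf⟩ := hlc e.locallyConnectedSpace
    exact ⟨h.qhVisibilityDomain hOpen hne hF hFf, h.noGeodesicLoop hOpen hne hF hFf
      (h.injOn_of_homeomorph hOpen hConn.isPreconnected hBdd hF hFf e)⟩

end
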